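/- Let n ≥ 1, let I = [0,1], and let (X,x₀) be a well-pointed path-connected space. Then there is a weak homotopy equivalence from C⁰(I^n;X) to the n-fold loop space Ω^n C⁰(I^n, ∂I^n; X); that is, the relative labelled configuration space C⁰(I^n, ∂I^n; X) is an n-fold delooping of C⁰(I^n;X). -/

import Mathlib

open scoped unitInterval Topology
open Metric Set

noncomputable section

universe uWP

/-! ### Ordered configuration spaces -/

/-- The ordered configuration space `C⁰_k(M)`: `k`-tuples of pairwise distinct points of `M`,
topologized as a subspace of `M^k`. -/
def OrdConfig (M : Type*) [TopologicalSpace M] (k : ℕ) : Type _ :=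
  {p : Fin k → M // Function.Injective p}

instance (M : Type*) [TopologicalSpace M] (k : ℕ) : TopologicalSpace (OrdConfig M k) :=
  inferInstanceAs (TopologicalSpace {p : Fin k → M // Function.Injective p})

/-- The action of the symmetric group `Σ_k` on the ordered configuration space,
permuting the coordinates. -/
def OrdConfig.perm {M : Type*} [TopologicalSpace M] {k : ℕ} (e : Equiv.Perm (Fin k))
    (p : OrdConfig M k) : OrdConfig M k :=
  ⟨p.1 ∘ e, p.2.comp e.injective⟩

/-! ### Labelled configuration spaces -/

/-- The "pre-configuration space": disjoint union over `k` of `C⁰_k(M) × X^k`. -/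
def LabelPre (M X : Type*) [TopologicalSpace M] [TopologicalSpace X] : Type _ :=
  Σ k : ℕ, OrdConfig M k × (Fin k → X)

instance (M X : Type*) [TopologicalSpace M] [TopologicalSpace X] :
    TopologicalSpace (LabelPre M X) :=
  inferInstanceAs (TopologicalSpace (Σ k : ℕ, OrdConfig M k × (Fin k → X)))

/-- The relation generating the equivalence defining `C⁰(M;X)`: permuting points together
with their labels, and deleting points labelled by the base point `x₀`. -/
inductive LabelRel (M X : Type*) [TopologicalSpace M] [TopologicalSpace X] (x₀ : X) :
    LabelPre M X → LabelPre M X → Prop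
  | perm {k : ℕ} (c : OrdConfig M k) (l : Fin k → X) (e : Equiv.Perm (Fin k)) :
      LabelRel M X x₀ ⟨k, c, l⟩ ⟨k, OrdConfig.perm e c, l ∘ e⟩
  | delete {k : ℕ} (c : OrdConfig M (k + 1)) (l : Fin (k + 1) → X) (i : Fin (k + 1))
      (h : l i = x₀) :
      LabelRel M X x₀ ⟨k + 1, c, l⟩
        ⟨k, ⟨c.1 ∘ i.succAbove, c.2.comp Fin.succAbove_right_injective⟩, l ∘ i.succAbove⟩

/-- The labelled configuration space `C⁰(M;X)`, with the quotient topology. -/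
def LabeledConfig (M X : Type*) [TopologicalSpace M] [TopologicalSpace X] (x₀ : X) :=
  Quot (LabelRel M X x₀)

instance (M X : Type*) [TopologicalSpace M] [TopologicalSpace X] (x₀ : X) :
    TopologicalSpace (LabeledConfig M X x₀) :=
  inferInstanceAs (TopologicalSpace (Quot (LabelRel M X x₀)))

/-- The empty configuration. -/
def LabelPre.empty (M X : Type*) [TopologicalSpace M] [TopologicalSpace X] : LabelPre M X :=
  ⟨0, ⟨Fin.elim0, fun i => i.elim0⟩, Fin.elim0⟩

/-- The class of the empty configuration; the base point of `C⁰(M;X)`. -/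
def LabeledConfig.empty (M X : Type*) [TopologicalSpace M] [TopologicalSpace X] (x₀ : X) :
    LabeledConfig M X x₀ :=
  Quot.mk _ (LabelPre.empty M X)

/-- The label of a pre-configuration `a` at a point `m` of `M`: the label of the point of the
configuration located at `m`, if there is one, and the base point `x₀` otherwise. -/
noncomputable def labelAt {M X : Type*} [TopologicalSpace M] [TopologicalSpace X] (x₀ : X)
    (a : LabelPre M X) (m : M) : X :=
  haveI := Classical.propDecidable (∃ i, a.2.1.1 i = m)
  if h : ∃ i, a.2.1.1 i = m then a.2.2 h.choose else x₀

/-- Two labelled configurations agree off `N` if they have representatives whose labelled points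
outside of `N` coincide. -/
def AgreeOff {M X : Type*} [TopologicalSpace M] [TopologicalSpace X] (x₀ : X) (N : Set M)
    (a b : LabeledConfig M X x₀) : Prop :=
  ∃ a' b' : LabelPre M X, a = Quot.mk _ a' ∧ b = Quot.mk _ b' ∧
    ∀ m ∉ N, labelAt x₀ a' m = labelAt x₀ b' m

/-- The relative labelled configuration space `C⁰(M,N;X)`: the quotient of `C⁰(M;X)`
identifying two labelled configurations whenever they agree on `M ∖ N`. -/
def RelConfig (M : Type*) [TopologicalSpace M] (N : Set M) (X : Type*) [TopologicalSpace X]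
    (x₀ : X) : Type _ :=
  Quot (AgreeOff (M := M) (X := X) x₀ N)

instance (M : Type*) [TopologicalSpace M] (N : Set M) (X : Type*) [TopologicalSpace X] (x₀ : X) :
    TopologicalSpace (RelConfig M N X x₀) :=
  inferInstanceAs (TopologicalSpace (Quot _))

/-- The base point of `C⁰(M,N;X)`: the class of the empty configuration. -/
def RelConfig.base (M : Type*) [TopologicalSpace M] (N : Set M) (X : Type*) [TopologicalSpace X]
    (x₀ : X) : RelConfig M N X x₀ :=
  Quot.mk _ (LabeledConfig.empty M X x₀)

/-! ### Well-pointedness -/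

/-- `(X, x₀)` is well-pointed if the inclusion `{x₀} ↪ X` is a cofibration, i.e. satisfies the
homotopy extension property. -/
def IsWellPointed (X : Type uWP) [TopologicalSpace X] (x₀ : X) : Prop :=
  ∀ (Y : Type uWP) (_ : TopologicalSpace Y) (f : C(X, Y)) (p : C(I, Y)),
    p 0 = f x₀ → ∃ G : C(I × X, Y), (∀ x, G (0, x) = f x) ∧ ∀ t, G (t, x₀) = p t

/-! ### Cubes, suspensions and loop spaces -/

/-- The `n`-cube `I^n`. -/
def NCube (n : ℕ) : Type :=
  Fin n → I

instance (n : ℕ) : TopologicalSpace (NCube n) :=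
  inferInstanceAs (TopologicalSpace (Fin n → I))

/-- The boundary `∂I^n` of the `n`-cube. -/
def NCube.boundary (n : ℕ) : Set (NCube n) :=
  {t | ∃ i, t i = 0 ∨ t i = 1}

/-- The subset of `I^n × X` collapsed in the definition of the reduced suspension:
`(∂I^n × X) ∪ (I^n × {x₀})`. -/
def SuspCollapse (n : ℕ) (X : Type*) [TopologicalSpace X] (x₀ : X) : Set (NCube n × X) :=
  (NCube.boundary n ×ˢ (univ : Set X)) ∪ ((univ : Set (NCube n)) ×ˢ ({x₀} : Set X))

/-- The `n`-fold reduced suspension `Σⁿ X = (I^n × X)/((∂I^n × X) ∪ (I^n × {x₀}))`. -/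
def Susp (n : ℕ) (X : Type*) [TopologicalSpace X] (x₀ : X) :=
  Quot (fun a b : NCube n × X => a ∈ SuspCollapse n X x₀ ∧ b ∈ SuspCollapse n X x₀)

instance (n : ℕ) (X : Type*) [TopologicalSpace X] (x₀ : X) : TopologicalSpace (Susp n X x₀) :=
  inferInstanceAs (TopologicalSpace (Quot _))

/-- The base point of the reduced suspension: the class of the collapsed subset. -/
def Susp.base (n : ℕ) (X : Type*) [TopologicalSpace X] (x₀ : X) : Susp n X x₀ :=
  Quot.mk _ (fun _ => 0, x₀)

/-- The `n`-fold based loop space `Ωⁿ(Y,y₀)`, modelled as the space of continuous maps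
`I^n → Y` sending `∂I^n` to the base point, with the compact-open topology. -/
def NLoop (n : ℕ) (Y : Type*) [TopologicalSpace Y] (y₀ : Y) :=
  {f : C(NCube n, Y) // ∀ t ∈ NCube.boundary n, f t = y₀}

instance (n : ℕ) (Y : Type*) [TopologicalSpace Y] (y₀ : Y) : TopologicalSpace (NLoop n Y y₀) :=
  inferInstanceAs (TopologicalSpace {f : C(NCube n, Y) // ∀ t ∈ NCube.boundary n, f t = y₀})

/-! ### Weak homotopy equivalences -/

/-- The map induced on path components by a continuous map. -/
def ZerothHomotopy.inducedMap {X Y : Type*} [TopologicalSpace X] [TopologicalSpace Y]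
    (f : C(X, Y)) : ZerothHomotopy X → ZerothHomotopy Y :=
  @Quotient.map _ _ (pathSetoid X) (pathSetoid Y) f
    (fun _ _ h => Nonempty.map (fun p => p.map f.continuous) h)

/-- The map induced by a continuous map on generalized loops. -/
def GenLoop.inducedMap {N X Y : Type*} [TopologicalSpace X] [TopologicalSpace Y] {x : X}
    (f : C(X, Y)) (p : GenLoop N X x) : GenLoop N Y (f x) :=
  ⟨f.comp p.1, fun y hy => by
    simp only [ContinuousMap.comp_apply]
    rw [p.2 y hy]⟩

/-- The map induced by a continuous map on homotopy groups. -/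
def HomotopyGroup.inducedMap (N : Type*) {X Y : Type*} [TopologicalSpace X] [TopologicalSpace Y]
    (x : X) (f : C(X, Y)) : HomotopyGroup N X x → HomotopyGroup N Y (f x) :=
  Quotient.map (GenLoop.inducedMap f)
    (fun _ _ h => Nonempty.map (fun H => H.compContinuousMap f) h)

/-- A continuous map is a weak homotopy equivalence if it induces a bijection on path
components and isomorphisms on all homotopy groups at every base point. -/
def IsWeakHomotopyEquiv {X Y : Type*} [TopologicalSpace X] [TopologicalSpace Y]
    (f : C(X, Y)) : Prop :=
  Function.Bijective (ZerothHomotopy.inducedMap f) ∧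
    ∀ (n : ℕ) (x : X), Function.Bijective (HomotopyGroup.inducedMap (Fin n) x f)

/-! ### Abstract cubes -/

/-- `bd` corresponds to the boundary of a cube under some homeomorphism of `Q` with a cube. -/
def IsCube {Q : Type} [TopologicalSpace Q] (bd : Set Q) : Prop :=
  ∃ (ι : Type) (_ : Fintype ι) (h : Q ≃ₜ (ι → I)), ∀ z, z ∈ bd ↔ ∃ i, h z i = 0 ∨ h z i = 1

/-- The boundary of the product of a cube with `I`. -/
def prodBd {Q : Type} (bd : Set Q) : Set (Q × I) := {q | q.1 ∈ bd ∨ q.2 = 0 ∨ q.2 = 1}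

theorem isCube_pi (ι : Type) [Fintype ι] : IsCube (Cube.boundary ι) :=
  ⟨ι, inferInstance, Homeomorph.refl _, fun _ => Iff.rfl⟩

theorem isCube_boundary (n : ℕ) : IsCube (NCube.boundary n) :=
  ⟨Fin n, inferInstance, Homeomorph.refl _, fun _ => Iff.rfl⟩

theorem isCube_unitInterval : IsCube ({z | z = 0 ∨ z = 1} : Set I) :=
  ⟨Fin 1, inferInstance, (Homeomorph.funUnique (Fin 1) I).symm, fun z => by simp⟩

theorem IsCube.prod {Q R : Type} [TopologicalSpace Q] [TopologicalSpace R] {bd : Set Q}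
    {bd' : Set R} (hQ : IsCube bd) (hR : IsCube bd') :
    IsCube {q : Q × R | q.1 ∈ bd ∨ q.2 ∈ bd'} := by
  obtain ⟨ι, _, h, hb⟩ := hQ
  obtain ⟨κ, _, h', hb'⟩ := hR
  refine ⟨ι ⊕ κ, inferInstance,
    (h.prodCongr h').trans (Homeomorph.sumArrowHomeomorphProdArrow).symm, fun z => ?_⟩
  simp [hb, hb', Homeomorph.sumArrowHomeomorphProdArrow, Equiv.sumArrowEquivProdArrow]

theorem IsCube.prod_unitInterval {Q : Type} [TopologicalSpace Q] {bd : Set Q} (hQ : IsCube bd) :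
    IsCube (prodBd bd) := hQ.prod isCube_unitInterval

theorem IsCube.isClosed {Q : Type} [TopologicalSpace Q] {bd : Set Q} (hQ : IsCube bd) :
    IsClosed bd := by
  obtain ⟨ι, _, h, hb⟩ := hQ
  have : bd = ⋃ i, {z | h z i = 0} ∪ {z | h z i = 1} := by
    ext z; simp [hb]
  rw [this]
  refine isClosed_iUnion_of_finite fun i => ?_
  exact (isClosed_eq (by fun_prop) (by fun_prop)).union (isClosed_eq (by fun_prop) (by fun_prop))

theorem IsCube.contractibleSpace {Q : Type} [TopologicalSpace Q] {bd : Set Q} (hQ : IsCube bd) :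
    ∃ c : C(I × Q, Q), (∀ q, c (0, q) = q) ∧ ∃ q₀, ∀ q, c (1, q) = q₀ := by
  obtain ⟨ι, _, h, hb⟩ := hQ
  refine ⟨⟨fun p => h.symm fun i => unitInterval.symm p.1 * h p.2 i, by fun_prop⟩, fun q => ?_,
    h.symm 0, fun q => ?_⟩
  · simp
  · simp; rfl

/-- The union of the bottom and the sides of the cylinder on a cube. -/
def boxJ {Q : Type} (bd : Set Q) : Set (Q × I) := {q | q.2 = 0 ∨ q.1 ∈ bd}

theorem IsCube.isClosed_boxJ {Q : Type} [TopologicalSpace Q] {bd : Set Q} (hQ : IsCube bd) :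
    IsClosed (boxJ bd) :=
  (isClosed_eq continuous_snd continuous_const).union (hQ.isClosed.preimage continuous_fst)

theorem exists_box_retraction (ι : Type) [Fintype ι] :
    ∃ r : C((ι → I) × I, (ι → I) × I), (∀ p, (r p).2 = 0 ∨ ∃ i, (r p).1 i = 0 ∨ (r p).1 i = 1) ∧
      ∀ p, (p.2 = 0 ∨ ∃ i, p.1 i = 0 ∨ p.1 i = 1) → r p = p := by
  let x : (ι → I) × I → ι → ℝ := fun p i => 2 * (p.1 i : ℝ) - 1
  let μ : (ι → I) × I → ℝ := fun p => max ‖x p‖ ((2 - p.2) / 2)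
  have hx : Continuous x := by fun_prop
  have hμ : Continuous μ := by fun_prop
  have hμ0 : ∀ p, 1 / 2 ≤ μ p := fun p => by
    have := p.2.2.2
    exact le_max_of_le_right (by linarith)
  have hne : ∀ p, μ p ≠ 0 := fun p => by linarith [hμ0 p]
  have hx1 : ∀ p i, |x p i| ≤ 1 := fun p i => by
    have h0 := (p.1 i).2.1
    have h1 := (p.1 i).2.2
    exact abs_le.2 ⟨by simp only [x]; linarith, by simp only [x]; linarith⟩
  have hn1 : ∀ p, ‖x p‖ ≤ 1 := fun p => (pi_norm_le_iff_of_nonneg zero_le_one).2 (hx1 p)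
  have hμ1 : ∀ p, (p.2 = 0 ∨ ∃ i, p.1 i = 0 ∨ p.1 i = 1) → μ p = 1 := by
    rintro p (h | ⟨i, h⟩)
    · simp [μ, h, hn1 p]
    · have h2 : 1 ≤ ‖x p‖ := by
        refine le_trans ?_ (norm_le_pi_norm (x p) i)
        rcases h with h | h <;> simp [x, h]
        norm_num
      have := p.2.2.1
      exact le_antisymm (max_le (hn1 p) (by linarith)) (h2.trans (le_max_left _ _))
  refine ⟨⟨fun p => (fun i => projIcc 0 1 zero_le_one ((x p i / μ p + 1) / 2),
    projIcc 0 1 zero_le_one (2 - (2 - p.2) / μ p)), ?_⟩, fun p => ?_, fun p hp => ?_⟩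
  · refine Continuous.prodMk (continuous_pi fun i => continuous_projIcc.comp ?_)
      (continuous_projIcc.comp ?_)
    · exact (((continuous_apply i).comp hx).div hμ hne |>.add continuous_const).div_const _
    · exact continuous_const.sub
        ((continuous_const.sub (continuous_subtype_val.comp continuous_snd)).div hμ hne)
  · rcases le_total ‖x p‖ ((2 - p.2) / 2) with h | h
    · left
      have : μ p = (2 - p.2) / 2 := max_eq_right h
      have h2 : (2 - (p.2 : ℝ)) / μ p = 2 := by
        rw [div_eq_iff (hne p), this]; ring
      simp [h2]
    · right
      have hm : μ p = ‖x p‖ := max_eq_left h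
      have hι : Nonempty ι := by
        by_contra hι
        rw [not_nonempty_iff] at hι
        have : ‖x p‖ = 0 := by simp [Subsingleton.elim (x p) 0]
        exact hne p (hm.trans this)
      obtain ⟨i, hi⟩ : ∃ i, ‖x p‖ = |x p i| := by
        obtain ⟨i, hi⟩ := Finite.exists_max fun i => |x p i|
        exact ⟨i, le_antisymm ((pi_norm_le_iff_of_nonneg (abs_nonneg _)).2 hi)
          (norm_le_pi_norm (x p) i)⟩
      refine ⟨i, ?_⟩
      have h3 : 0 < ‖x p‖ := by have := hμ0 p; linarith
      rcases abs_choice (x p i) with h4 | h4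
      · right
        have : x p i / μ p = 1 := by rw [hm, hi, h4, div_self]; rw [hi, h4] at h3; exact h3.ne'
        simp only [ContinuousMap.coe_mk, this]
        norm_num
      · left
        have : x p i / μ p = -1 := by
          rw [hm, hi, h4, div_neg, div_self]; rw [hi, h4] at h3; linarith
        simp only [ContinuousMap.coe_mk, this]
        norm_num
  · simp only [ContinuousMap.coe_mk, hμ1 p hp, div_one, x]
    refine Prod.ext (funext fun i => ?_) ?_
    · simp only [sub_add_cancel]
      rw [mul_div_cancel_left₀ _ two_ne_zero]
      exact projIcc_val _ _
    · simp only [sub_sub_cancel]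
      exact projIcc_val _ _

/-- Extension from the bottom and sides of a box. -/
theorem IsCube.exists_extend_box {Q : Type} [TopologicalSpace Q] {bd : Set Q} (hQ : IsCube bd)
    {Y : Type*} [TopologicalSpace Y] {f : Q × I → Y} (hf : ContinuousOn f (boxJ bd)) :
    ∃ F : C(Q × I, Y), EqOn F f (boxJ bd) ∧ ∀ p, ∃ q ∈ boxJ bd, F p = f q := by
  obtain ⟨ι, _, h, hb⟩ := hQ
  obtain ⟨r, h1, h2⟩ := exists_box_retraction ι
  let e : Q × I ≃ₜ (ι → I) × I := h.prodCongr (Homeomorph.refl I)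
  have hJ : ∀ p, e.symm (r (e p)) ∈ boxJ bd := fun p => by
    rcases h1 (e p) with h3 | h3
    · left; exact h3
    · right; rw [hb]
      simpa [e] using h3
  refine ⟨⟨fun p => f (e.symm (r (e p))), ?_⟩, fun p hp => ?_, fun p => ⟨_, hJ p, rfl⟩⟩
  · exact hf.comp_continuous (by fun_prop) hJ
  · have : r (e p) = e p := h2 _ (by simpa [e, boxJ, hb] using hp)
    simp [this]

theorem IsCube.hep {Q : Type} [TopologicalSpace Q] {bd : Set Q} (hQ : IsCube bd)
    {Y : Type*} [TopologicalSpace Y] (f : C(Q, Y)) {h : Q × I → Y}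
    (hh : ContinuousOn h (bd ×ˢ univ)) (h0 : ∀ z ∈ bd, h (z, 0) = f z) :
    ∃ F : C(Q × I, Y), (∀ z, F (z, 0) = f z) ∧ (∀ z ∈ bd, ∀ t, F (z, t) = h (z, t)) ∧
      ∀ p, (∃ z, F p = f z) ∨ ∃ z ∈ bd, ∃ t, F p = h (z, t) := by
  classical
  let g : Q × I → Y := fun p => if p.2 = 0 then f p.1 else h p
  have hg1 : ∀ z, g (z, 0) = f z := fun z => by simp [g]
  have hg2 : ∀ z ∈ bd, ∀ t, g (z, t) = h (z, t) := fun z hz t => by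
    by_cases ht : t = 0
    · simp [g, ht, h0 z hz]
    · simp [g, ht]
  have hg : ContinuousOn g (boxJ bd) := by
    have : boxJ bd = {q | q.2 = 0} ∪ bd ×ˢ univ := by ext q; simp [boxJ]
    rw [this]
    refine ContinuousOn.union_of_isClosed ?_ ?_ (isClosed_eq continuous_snd continuous_const)
      (hQ.isClosed.prod isClosed_univ)
    · refine (f.continuous.comp continuous_fst).continuousOn.congr fun q hq => ?_
      obtain ⟨z, t⟩ := q
      obtain rfl : t = 0 := hq
      exact hg1 z
    · exact hh.congr fun q hq => hg2 q.1 hq.1 q.2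
  obtain ⟨F, hF, hv⟩ := hQ.exists_extend_box hg
  refine ⟨F, fun z => (hF (Or.inl rfl)).trans (hg1 z),
    fun z hz t => (hF (Or.inr hz)).trans (hg2 z hz t), fun p => ?_⟩
  obtain ⟨⟨z, t⟩, hq, h3⟩ := hv p
  rcases hq with hq | hq
  · obtain rfl : t = 0 := hq
    exact Or.inl ⟨z, h3.trans (hg1 z)⟩
  · exact Or.inr ⟨z, hq, t, h3.trans (hg2 z hq t)⟩

/-- Two maps on a cube agreeing at the end of homotopies with the same boundary behaviour. -/
theorem IsCube.homotopicRel_of_faces {Q : Type} [TopologicalSpace Q] {bd : Set Q} (hQ : IsCube bd)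
    {Y : Type*} [TopologicalSpace Y] (N₀ N₁ N₂ : C(Q × I, Y)) (f₀ f₁ : C(Q, Y))
    (e₀ : ∀ z, N₀ (z, 0) = f₀ z) (e₁ : ∀ z, N₁ (z, 0) = f₁ z)
    (h01 : ∀ z ∈ bd, ∀ t, N₀ (z, t) = N₁ (z, t)) (h2 : ∀ z ∈ bd, ∀ t, N₂ (z, t) = N₀ (z, 1))
    (h20 : ∀ z, N₂ (z, 0) = N₀ (z, 1)) (h21 : ∀ z, N₂ (z, 1) = N₁ (z, 1)) :
    f₀.HomotopicRel f₁ bd := by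
  classical
  let h : (Q × I) × I → Y := fun p =>
    if p.1.2 = 1 then N₁ (p.1.1, unitInterval.symm p.2) else N₀ (p.1.1, unitInterval.symm p.2)
  have hh1 : ∀ z s, h ((z, 1), s) = N₁ (z, unitInterval.symm s) := fun z s => by simp [h]
  have hh0 : ∀ z s, h ((z, 0), s) = N₀ (z, unitInterval.symm s) := fun z s => by simp [h]
  have hhb : ∀ z ∈ bd, ∀ v s, h ((z, v), s) = N₀ (z, unitInterval.symm s) := fun z hz v s => by
    by_cases hv : v = 1
    · simp [h, hv, h01 z hz]
    · simp [h, hv]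
  have hc : ContinuousOn h (prodBd bd ×ˢ univ) := by
    have : prodBd bd ×ˢ (univ : Set I) =
        ({p | p.1.1 ∈ bd} ∪ {p | p.1.2 = 0}) ∪ {p | p.1.2 = 1} := by
      ext p; simp [prodBd, or_assoc]
    rw [this]
    have k1 : IsClosed {p : (Q × I) × I | p.1.1 ∈ bd} := hQ.isClosed.preimage (by fun_prop)
    have k2 : IsClosed {p : (Q × I) × I | p.1.2 = 0} := isClosed_eq (by fun_prop) (by fun_prop)
    have k3 : IsClosed {p : (Q × I) × I | p.1.2 = 1} := isClosed_eq (by fun_prop) (by fun_prop)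
    have c0 : Continuous fun p : (Q × I) × I => N₀ (p.1.1, unitInterval.symm p.2) := by fun_prop
    have c1 : Continuous fun p : (Q × I) × I => N₁ (p.1.1, unitInterval.symm p.2) := by fun_prop
    refine ((c0.continuousOn.congr ?_).union_of_isClosed (c0.continuousOn.congr ?_)
      k1 k2).union_of_isClosed (c1.continuousOn.congr ?_) (k1.union k2) k3
    · rintro ⟨⟨z, v⟩, s⟩ hz
      exact hhb z hz v s
    · rintro ⟨⟨z, v⟩, s⟩ hz
      obtain rfl : v = 0 := hz
      exact hh0 z s
    · rintro ⟨⟨z, v⟩, s⟩ hz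
      obtain rfl : v = 1 := hz
      exact hh1 z s
  obtain ⟨F, hF0, hFb, -⟩ := hQ.prod_unitInterval.hep N₂ hc (by
    rintro ⟨z, v⟩ (hz | hv | hv)
    · rw [hhb z hz, h2 z hz]; simp
    · change v = 0 at hv
      subst hv; rw [hh0, h20]; simp
    · change v = 1 at hv
      subst hv; rw [hh1, h21]; simp)
  refine ⟨⟨⟨⟨fun p => F ((p.2, p.1), 1), by fun_prop⟩, fun z => ?_, fun z => ?_⟩,
    fun t z hz => ?_⟩⟩
  · change F ((z, 0), 1) = f₀ z
    rw [hFb _ (Or.inr (Or.inl rfl)), hh0, ← e₀]; simp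
  · change F ((z, 1), 1) = f₁ z
    rw [hFb _ (Or.inr (Or.inr rfl)), hh1, ← e₁]; simp
  · change F ((z, t), 1) = f₀ z
    rw [hFb _ (Or.inl hz), hhb z hz, ← e₀]; simp

/-! ### Relative lifting up to homotopy -/

/-- Every map of a cube into `Y`, lifted to `X` on the boundary, can be lifted to `X`
up to homotopy relative to the boundary. -/
def HasW {X Y : Type*} [TopologicalSpace X] [TopologicalSpace Y] (f : C(X, Y)) : Prop :=
  ∀ (Q : Type) [TopologicalSpace Q] (bd : Set Q), IsCube bd → ∀ (b : C(Q, Y)) (a : Q → X),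
    ContinuousOn a bd → (∀ z ∈ bd, f (a z) = b z) →
    ∃ g : C(Q, X), EqOn g a bd ∧ b.HomotopicRel (f.comp g) bd

theorem HasW.of_pi {X Y : Type*} [TopologicalSpace X] [TopologicalSpace Y] {f : C(X, Y)}
    (H : ∀ (m : ℕ) (b : C(Fin m → I, Y)) (a : (Fin m → I) → X),
      ContinuousOn a (Cube.boundary (Fin m)) → (∀ z ∈ Cube.boundary (Fin m), f (a z) = b z) →
      ∃ g : C(Fin m → I, X), EqOn g a (Cube.boundary (Fin m)) ∧
        b.HomotopicRel (f.comp g) (Cube.boundary (Fin m))) : HasW f := by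
  intro Q _ bd hQ b a ha hab
  obtain ⟨ι, _, h, hb⟩ := hQ
  let j := Fintype.equivFin ι
  let e : Q ≃ₜ (Fin (Fintype.card ι) → I) :=
    h.trans ⟨j.arrowCongr (Equiv.refl I), by
      refine continuous_pi fun i => ?_
      exact continuous_apply (j.symm i), by
      refine continuous_pi fun i => ?_
      exact continuous_apply (j i)⟩
  have he : ∀ z, e z ∈ Cube.boundary (Fin (Fintype.card ι)) ↔ z ∈ bd := fun z => by
    rw [hb]
    have : ∀ i, e z i = h z (j.symm i) := fun i => rfl
    simp only [Cube.boundary, mem_ofPred_eq, this]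
    exact ⟨fun ⟨i, hi⟩ => ⟨_, hi⟩, fun ⟨i, hi⟩ => ⟨j i, by simpa using hi⟩⟩
  have he' : ∀ z, e.symm z ∈ bd ↔ z ∈ Cube.boundary (Fin (Fintype.card ι)) := fun z => by
    rw [← he]; simp
  obtain ⟨g, hg, ⟨K⟩⟩ := H _ (b.comp ⟨e.symm, e.symm.continuous⟩) (a ∘ e.symm)
    (ha.comp e.symm.continuous.continuousOn fun z hz => (he' z).2 hz)
    (fun z hz => hab _ ((he' z).2 hz))
  refine ⟨g.comp ⟨e, e.continuous⟩, fun z hz => ?_, ⟨⟨⟨⟨fun p => K (p.1, e p.2), by fun_prop⟩,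
    fun z => ?_, fun z => ?_⟩, fun t z hz => ?_⟩⟩⟩
  · simpa using hg ((he z).2 hz)
  · simp
  · simp
  · simpa using K.eq_fst t ((he z).2 hz)

section WeakEquivalence

variable {X Y Z W : Type*} [TopologicalSpace X] [TopologicalSpace Y] [TopologicalSpace Z]
  [TopologicalSpace W]

theorem HasW.comp {f : C(X, Y)} {g : C(Y, Z)} (hg : HasW g) (hf : HasW f) :
    HasW (g.comp f) := by
  intro Q _ bd hQ b a ha hab
  obtain ⟨b', hb', K⟩ := hg Q bd hQ b (f ∘ a) (f.continuous.comp_continuousOn ha) hab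
  obtain ⟨a', ha', K'⟩ := hf Q bd hQ b' a ha fun z hz => (hb' hz).symm
  exact ⟨a', ha', K.trans (K'.map fun H => H.compContinuousMap g)⟩

/-- It suffices to lift after moving the pair (map, lift on the boundary) by a homotopy. -/
theorem HasW.of_pair_homotopy {f : C(X, Y)} {Q : Type} [TopologicalSpace Q] {bd : Set Q}
    (hQ : IsCube bd) (b : C(Q × I, Y)) (a : Q × I → X) (ha : ContinuousOn a (bd ×ˢ univ))
    (hab : ∀ z ∈ bd, ∀ t, f (a (z, t)) = b (z, t)) (b₀ b₁ : C(Q, Y)) (e₀ : ∀ z, b (z, 0) = b₀ z)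
    (e₁ : ∀ z, b (z, 1) = b₁ z)
    (H : ∃ g : C(Q, X), (∀ z ∈ bd, g z = a (z, 1)) ∧ b₁.HomotopicRel (f.comp g) bd) :
    ∃ g : C(Q, X), (∀ z ∈ bd, g z = a (z, 0)) ∧ b₀.HomotopicRel (f.comp g) bd := by
  obtain ⟨γ, hγ, ⟨K⟩⟩ := H
  obtain ⟨Γ, hΓ0, hΓ, -⟩ := hQ.hep γ (h := fun p => a (p.1, unitInterval.symm p.2))
    (ha.comp (by fun_prop) fun p hp => ⟨hp.1, mem_univ _⟩) fun z hz => by simp [hγ z hz]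
  refine ⟨⟨fun z => Γ (z, 1), by fun_prop⟩, fun z hz => by simp [hΓ z hz], ?_⟩
  refine hQ.homotopicRel_of_faces b ⟨fun p => f (Γ (p.1, unitInterval.symm p.2)), by fun_prop⟩
    ⟨fun p => K (p.2, p.1), by fun_prop⟩ b₀ _ e₀ (by simp) ?_ ?_ ?_ ?_
  · intro z hz t; simp [hΓ z hz, hab z hz]
  · intro z hz t
    have := K.eq_fst t hz
    simp only [ContinuousMap.coe_mk]
    rw [this, e₁]
  · intro z; simp [e₁]
  · intro z; simp [hΓ0]

theorem HasW.congr_homotopic {f f' : C(X, Y)} (hf : HasW f) (h : f.Homotopic f') : HasW f' := by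
  obtain ⟨H⟩ := h
  intro Q _ bd hQ b a ha hab
  obtain ⟨B, hB0, hB, -⟩ := hQ.hep b (h := fun p => H (unitInterval.symm p.2, a p.1))
    (H.continuous.comp_continuousOn ((by fun_prop : Continuous fun p : Q × I =>
      unitInterval.symm p.2).continuousOn.prodMk (ha.comp (by fun_prop) fun p hp => hp.1)))
    fun z hz => by simp [hab z hz]
  obtain ⟨g, hg, ⟨K⟩⟩ := hf Q bd hQ ⟨fun z => B (z, 1), by fun_prop⟩ a ha
    fun z hz => by simp [hB z hz]
  refine ⟨g, hg, ?_⟩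
  refine hQ.homotopicRel_of_faces B ⟨fun p => H (unitInterval.symm p.2, g p.1), by fun_prop⟩
    ⟨fun p => K (p.2, p.1), by fun_prop⟩ b _ hB0 (by simp) ?_ ?_ ?_ ?_
  · intro z hz t; simp [hB z hz, hg hz]
  · intro z hz t
    exact K.eq_fst t hz
  · intro z; simp
  · intro z; simp

theorem HasW.id : HasW (ContinuousMap.id X) := fun _ _ _ _ b _ _ hab =>
  ⟨b, fun z hz => (hab z hz).symm, ContinuousMap.HomotopicRel.refl _⟩

/-- One third of the two-out-of-six property. -/
theorem HasW.of_comp {f : C(X, Y)} {g : C(Y, Z)} {h : C(Z, W)} (hgf : HasW (g.comp f))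
    (hhg : HasW (h.comp g)) : HasW f := by
  classical
  intro Q _ bd hQ b a ha hab
  obtain ⟨γ, hγ, ⟨K⟩⟩ := hgf Q bd hQ (g.comp b) a ha fun z hz => congrArg g (hab z hz)
  let s : Q × I → Y := fun p => if p.2 = 1 then f (γ p.1) else b p.1
  have s1 : ∀ z, s (z, 1) = f (γ z) := fun z => by simp [s]
  have s0 : ∀ z, s (z, 0) = b z := fun z => by simp [s]
  have sb : ∀ z ∈ bd, ∀ t, s (z, t) = b z := fun z hz t => by
    by_cases ht : t = 1
    · simp [s, ht, hγ hz, hab z hz]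
    · simp [s, ht]
  have hs : ContinuousOn s (prodBd bd) := by
    have : prodBd bd = ({p | p.1 ∈ bd} ∪ {p | p.2 = 0}) ∪ {p | p.2 = 1} := by
      ext p; simp [prodBd, or_assoc]
    rw [this]
    have k1 : IsClosed {p : Q × I | p.1 ∈ bd} := hQ.isClosed.preimage (by fun_prop)
    have k2 : IsClosed {p : Q × I | p.2 = 0} := isClosed_eq (by fun_prop) (by fun_prop)
    have k3 : IsClosed {p : Q × I | p.2 = 1} := isClosed_eq (by fun_prop) (by fun_prop)
    have c0 : Continuous fun p : Q × I => b p.1 := by fun_prop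
    have c1 : Continuous fun p : Q × I => f (γ p.1) := by fun_prop
    refine ((c0.continuousOn.congr ?_).union_of_isClosed (c0.continuousOn.congr ?_)
      k1 k2).union_of_isClosed (c1.continuousOn.congr ?_) (k1.union k2) k3
    · rintro ⟨z, v⟩ hz
      exact sb z hz v
    · rintro ⟨z, v⟩ hz
      obtain rfl : v = 0 := hz
      exact s0 z
    · rintro ⟨z, v⟩ hz
      obtain rfl : v = 1 := hz
      exact s1 z
  obtain ⟨S, hS, -⟩ := hhg _ _ hQ.prod_unitInterval
    ⟨fun p => h (K (p.2, p.1)), by fun_prop⟩ s hs (by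
    rintro ⟨z, v⟩ (hz | hv | hv)
    · have := K.eq_fst v hz
      simp only [ContinuousMap.coe_mk]
      rw [sb z hz, this]; rfl
    · change v = 0 at hv
      subst hv; simp [s0]
    · change v = 1 at hv
      subst hv; simp [s1])
  refine ⟨γ, hγ, ⟨⟨⟨⟨fun p => S (p.2, p.1), by fun_prop⟩, fun z => ?_, fun z => ?_⟩,
    fun t z hz => ?_⟩⟩⟩
  · exact (hS (Or.inr (Or.inl rfl))).trans (s0 z)
  · exact (hS (Or.inr (Or.inr rfl))).trans (s1 z)
  · exact (hS (Or.inl hz)).trans (sb z hz t)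

theorem HasW.of_homotopy_inverse {f : C(X, Y)} {g : C(Y, X)}
    (hgf : (g.comp f).Homotopic (ContinuousMap.id X))
    (hfg : (f.comp g).Homotopic (ContinuousMap.id Y)) : HasW f :=
  HasW.of_comp (HasW.id.congr_homotopic hgf.symm) (HasW.id.congr_homotopic hfg.symm)

theorem HasW.of_inverse {f : C(X, Y)} (g : C(Y, X)) (hgf : ∀ x, g (f x) = x)
    (hfg : ∀ y, f (g y) = y) : HasW f := by
  refine HasW.of_homotopy_inverse (g := g) ?_ ?_
  · rw [show g.comp f = ContinuousMap.id X from ContinuousMap.ext hgf]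
  · rw [show f.comp g = ContinuousMap.id Y from ContinuousMap.ext hfg]

theorem HasW.isWeakHomotopyEquiv [Nonempty X] {f : C(X, Y)} (hf : HasW f) :
    IsWeakHomotopyEquiv f := by
  refine ⟨⟨?_, ?_⟩, fun n x => ⟨?_, ?_⟩⟩
  · classical
    intro p q
    induction p using Quotient.inductionOn with | _ x
    induction q using Quotient.inductionOn with | _ y
    intro h
    obtain ⟨p⟩ : Joined (f x) (f y) := Quotient.exact h
    have ha : ContinuousOn (fun z : I => if z = 0 then x else y) ({z | z = 0 ∨ z = 1} : Set I) := by
      have : ({z | z = 0 ∨ z = 1} : Set I) = {0} ∪ {1} := rfl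
      rw [this]
      exact (continuousOn_singleton _ _).union_of_isClosed (continuousOn_singleton _ _)
        isClosed_singleton isClosed_singleton
    obtain ⟨g, hg, -⟩ := hf I _ isCube_unitInterval p.toContinuousMap _ ha (by
      rintro z (rfl | rfl) <;> simp)
    exact Quotient.sound ⟨⟨g, by simpa using hg (Or.inl rfl), by simpa using hg (Or.inr rfl)⟩⟩
  · intro q
    induction q using Quotient.inductionOn with | _ y
    have hb : ∀ z, z ∉ Cube.boundary (Fin 0) := fun z ⟨i, _⟩ => i.elim0
    obtain ⟨g, -, ⟨K⟩⟩ := hf _ _ (isCube_pi (Fin 0)) (ContinuousMap.const _ y)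
      (fun _ => Classical.arbitrary X) (fun z hz => (hb z hz).elim) (fun z hz => (hb z hz).elim)
    exact ⟨Quotient.mk _ (g 0), Quotient.sound
      ⟨⟨⟨fun t => K (unitInterval.symm t, 0), by fun_prop⟩, by simp, by simp⟩⟩⟩
  · intro p q
    induction p using Quotient.inductionOn with | _ p
    induction q using Quotient.inductionOn with | _ q
    intro h
    obtain ⟨K⟩ : (GenLoop.inducedMap f p).1.HomotopicRel (GenLoop.inducedMap f q).1 _ :=
      Quotient.exact h
    classical
    let s : (Fin n → I) × I → X := fun z => if z.2 = 1 then q.1 z.1 else p.1 z.1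
    have s1 : ∀ z, s (z, 1) = q.1 z := fun z => by simp [s]
    have s0 : ∀ z, s (z, 0) = p.1 z := fun z => by simp [s]
    have sb : ∀ z ∈ Cube.boundary (Fin n), ∀ t, s (z, t) = x := fun z hz t => by
      have h1 := p.2 z hz
      have h2 := q.2 z hz
      by_cases ht : t = 1
      · simpa [s, ht] using h2
      · simpa [s, ht] using h1
    have hs : ContinuousOn s (prodBd (Cube.boundary (Fin n))) := by
      have : prodBd (Cube.boundary (Fin n)) =
          ({p | p.1 ∈ Cube.boundary (Fin n)} ∪ {p | p.2 = 0}) ∪ {p | p.2 = 1} := by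
        ext p; simp [prodBd, or_assoc]
      rw [this]
      have k1 : IsClosed {p : (Fin n → I) × I | p.1 ∈ Cube.boundary (Fin n)} :=
        (isCube_pi (Fin n)).isClosed.preimage (by fun_prop)
      have k2 : IsClosed {p : (Fin n → I) × I | p.2 = 0} := isClosed_eq (by fun_prop) (by fun_prop)
      have k3 : IsClosed {p : (Fin n → I) × I | p.2 = 1} := isClosed_eq (by fun_prop) (by fun_prop)
      have c0 : Continuous fun z : (Fin n → I) × I => p.1 z.1 := by fun_prop
      have c1 : Continuous fun z : (Fin n → I) × I => q.1 z.1 := by fun_prop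
      refine (((continuous_const (y := x)).continuousOn.congr ?_).union_of_isClosed
        (c0.continuousOn.congr ?_) k1 k2).union_of_isClosed (c1.continuousOn.congr ?_)
        (k1.union k2) k3
      · rintro ⟨z, v⟩ hz
        exact sb z hz v
      · rintro ⟨z, v⟩ hz
        obtain rfl : v = 0 := hz
        exact s0 z
      · rintro ⟨z, v⟩ hz
        obtain rfl : v = 1 := hz
        exact s1 z
    obtain ⟨S, hS, -⟩ := hf _ _ (isCube_pi (Fin n)).prod_unitInterval
      ⟨fun p => K (p.2, p.1), by fun_prop⟩ s hs (by
      rintro ⟨z, v⟩ (hz | hv | hv)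
      · have h1 := K.eq_fst v hz
        have h2 := p.2 z hz
        simp only [ContinuousMap.coe_mk]
        rw [sb z hz, h1]; exact (congrArg f h2).symm
      · change v = 0 at hv
        subst hv; simp [s0]; rfl
      · change v = 1 at hv
        subst hv; simp [s1]; rfl)
    refine Quotient.sound ⟨⟨⟨⟨fun p => S (p.2, p.1), by fun_prop⟩, fun z => ?_, fun z => ?_⟩,
      fun t z hz => ?_⟩⟩
    · exact (hS (Or.inr (Or.inl rfl))).trans (s0 z)
    · exact (hS (Or.inr (Or.inr rfl))).trans (s1 z)
    · exact ((hS (Or.inl hz)).trans (sb z hz t)).trans (p.2 z hz).symm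
  · intro q
    induction q using Quotient.inductionOn with | _ q
    obtain ⟨g, hg, hK⟩ := hf _ _ (isCube_pi (Fin n)) q.1 (fun _ => x) continuousOn_const
      fun z hz => (q.2 z hz).symm
    exact ⟨Quotient.mk _ ⟨g, hg⟩, Quotient.sound hK.symm⟩

/-! ### Loop spaces -/

/-- The based loop space. -/
def LoopAt (Z : Type*) [TopologicalSpace Z] (z₀ : Z) := {ω : C(I, Z) // ω 0 = z₀ ∧ ω 1 = z₀}

instance (Z : Type*) [TopologicalSpace Z] (z₀ : Z) : TopologicalSpace (LoopAt Z z₀) :=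
  inferInstanceAs (TopologicalSpace {ω : C(I, Z) // ω 0 = z₀ ∧ ω 1 = z₀})

/-- The constant loop. -/
def LoopAt.const (z₀ : Z) : LoopAt Z z₀ := ⟨ContinuousMap.const _ z₀, rfl, rfl⟩

instance (n : ℕ) : CompactSpace (NCube n) := inferInstanceAs (CompactSpace (Fin n → I))

instance (n : ℕ) : T2Space (NCube n) := inferInstanceAs (T2Space (Fin n → I))

/-- The map induced on `n`-fold loop spaces. -/
def NLoop.map (n : ℕ) (f : C(X, Y)) {x : X} {y : Y} (h : f x = y) :
    C(NLoop n X x, NLoop n Y y) where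
  toFun ω := ⟨f.comp ω.1, fun t ht => by simp [ω.2 t ht, h]⟩
  continuous_toFun := Continuous.subtype_mk (by fun_prop) _

theorem NLoop.continuous_eval (n : ℕ) (x : X) :
    Continuous fun p : NLoop n X x × NCube n => p.1.1 p.2 :=
  ContinuousEval.continuous_eval.comp
    ((continuous_subtype_val.comp continuous_fst).prodMk continuous_snd)

theorem LoopAt.continuous_eval (x : X) :
    Continuous fun p : LoopAt X x × I => p.1.1 p.2 :=
  ContinuousEval.continuous_eval.comp
    ((continuous_subtype_val.comp continuous_fst).prodMk continuous_snd)

theorem HasW.nLoop (n : ℕ) {f : C(X, Y)} (hf : HasW f) {x : X} {y : Y} (h : f x = y) :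
    HasW (NLoop.map n f h) := by
  classical
  intro Q _ bd hQ b a ha hab
  let s : Q × NCube n → X := fun p => if p.1 ∈ bd then (a p.1).1 p.2 else x
  have s1 : ∀ z ∈ bd, ∀ t, s (z, t) = (a z).1 t := fun z hz t => by simp [s, hz]
  have s2 : ∀ z, ∀ t ∈ NCube.boundary n, s (z, t) = x := fun z t ht => by
    by_cases hz : z ∈ bd
    · simp [s, hz, (a z).2 t ht]
    · simp [s, hz]
  have hab' : ∀ z ∈ bd, ∀ t, f ((a z).1 t) = (b z).1 t := fun z hz t => by
    rw [← hab z hz]; rfl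
  have hs : ContinuousOn s {q : Q × NCube n | q.1 ∈ bd ∨ q.2 ∈ NCube.boundary n} := by
    refine ContinuousOn.union_of_isClosed (s := {q : Q × NCube n | q.1 ∈ bd})
      (t := {q : Q × NCube n | q.2 ∈ NCube.boundary n}) ?_ ?_
      (hQ.isClosed.preimage continuous_fst)
      ((isCube_boundary n).isClosed.preimage continuous_snd)
    · refine ContinuousOn.congr (f := fun p : Q × NCube n => (a p.1).1 p.2) ?_
        fun p hp => s1 p.1 hp p.2
      exact (NLoop.continuous_eval n x).comp_continuousOn
        ((ha.comp continuousOn_fst fun p hp => hp).prodMk continuousOn_snd)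
    · exact (continuous_const (y := x)).continuousOn.congr fun p hp => s2 p.1 p.2 hp
  obtain ⟨g, hg, ⟨K⟩⟩ := hf _ _ (hQ.prod (isCube_boundary n))
    ⟨fun p => (b p.1).1 p.2, (NLoop.continuous_eval n y).comp
      ((b.continuous.comp continuous_fst).prodMk continuous_snd)⟩ s hs (by
      rintro ⟨z, t⟩ (hz | ht)
      · rw [s1 z hz, hab' z hz]; rfl
      · rw [s2 z t ht, h]; exact ((b z).2 t ht).symm)
  refine ⟨⟨fun z => ⟨g.curry z, fun t ht => (hg (Or.inr ht)).trans (s2 z t ht)⟩,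
    Continuous.subtype_mk g.curry.continuous _⟩, fun z hz => Subtype.ext (ContinuousMap.ext fun t =>
      (hg (Or.inl hz)).trans (s1 z hz t)), ?_⟩
  let K' : C(I × Q, C(NCube n, Y)) :=
    ContinuousMap.curry ⟨fun p => K (p.1.1, (p.1.2, p.2)), by fun_prop⟩
  refine ⟨⟨⟨⟨fun p => ⟨K' p, fun t ht => ?_⟩, Continuous.subtype_mk K'.continuous _⟩,
    fun z => ?_, fun z => ?_⟩, fun t z hz => ?_⟩⟩
  · exact (K.eq_fst _ (Or.inr ht)).trans ((b p.2).2 t ht)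
  · exact Subtype.ext (ContinuousMap.ext fun t => K.map_zero_left (z, t))
  · exact Subtype.ext (ContinuousMap.ext fun t => K.map_one_left (z, t))
  · exact Subtype.ext (ContinuousMap.ext fun u => K.eq_fst t (Or.inl hz))

/-- The first coordinates of a point of a cube. -/
def NCube.front {n : ℕ} (t : NCube (n + 1)) : NCube n := fun i => t i.castSucc

/-- Adding a last coordinate. -/
def NCube.snoc {n : ℕ} (t : NCube n) (s : I) : NCube (n + 1) :=
  Fin.snoc (α := fun _ => I) t s

theorem NCube.snoc_castSucc {n : ℕ} (t : NCube n) (s : I) (i : Fin n) :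
    NCube.snoc t s i.castSucc = t i := Fin.snoc_castSucc (α := fun _ => I) s t i

theorem NCube.snoc_last {n : ℕ} (t : NCube n) (s : I) :
    NCube.snoc t s (Fin.last n) = s := Fin.snoc_last (α := fun _ => I) s t

theorem NCube.continuous_apply {n : ℕ} (i : Fin n) : Continuous fun t : NCube n => t i :=
  _root_.continuous_apply (A := fun _ : Fin n => I) i

theorem NCube.continuous_of_apply {n : ℕ} {f : X → NCube n} (h : ∀ i, Continuous fun x => f x i) :
    Continuous f :=
  continuous_pi (A := fun _ : Fin n => I) h

theorem NCube.continuous_front {n : ℕ} : Continuous (NCube.front (n := n)) :=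
  NCube.continuous_of_apply fun i => NCube.continuous_apply i.castSucc

theorem NCube.continuous_snoc {n : ℕ} :
    Continuous fun p : NCube n × I => NCube.snoc p.1 p.2 :=
  NCube.continuous_of_apply fun i => by
    induction i using Fin.lastCases with
    | last => simpa only [NCube.snoc_last] using continuous_snd
    | cast i =>
      simp only [NCube.snoc_castSucc]
      exact (NCube.continuous_apply i).comp continuous_fst

/-- Loops of based loops as loops of one dimension more. -/
def NLoop.uncurry (n : ℕ) (z₀ : Z) :
    C(NLoop n (LoopAt Z z₀) (LoopAt.const z₀), NLoop (n + 1) Z z₀) where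
  toFun ω := ⟨⟨fun t => (ω.1 t.front).1 (t (Fin.last n)),
    (LoopAt.continuous_eval z₀).comp ((ω.1.continuous.comp
      NCube.continuous_front).prodMk (NCube.continuous_apply _))⟩, by
    rintro t ⟨i, hi⟩
    induction i using Fin.lastCases with
    | last =>
      rcases hi with hi | hi
      · simpa [hi] using (ω.1 t.front).2.1
      · simpa [hi] using (ω.1 t.front).2.2
    | cast i =>
      have := ω.2 t.front ⟨i, hi⟩
      simp only [ContinuousMap.coe_mk, this]
      rfl⟩
  continuous_toFun := by
    refine Continuous.subtype_mk (ContinuousMap.continuous_of_continuous_uncurry _ ?_) _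
    exact (LoopAt.continuous_eval z₀).comp
      (((NLoop.continuous_eval n _).comp (continuous_fst.prodMk
        (NCube.continuous_front.comp continuous_snd))).prodMk
      ((NCube.continuous_apply _).comp continuous_snd))

theorem NLoop.hasW_uncurry (n : ℕ) (z₀ : Z) : HasW (NLoop.uncurry n z₀) := by
  have h1 : Continuous fun p : (NLoop (n + 1) Z z₀ × NCube n) × I =>
      p.1.1.1 (NCube.snoc p.1.2 p.2) :=
    (NLoop.continuous_eval (n + 1) z₀).comp ((continuous_fst.comp continuous_fst).prodMk
      (NCube.continuous_snoc.comp ((continuous_snd.comp continuous_fst).prodMk continuous_snd)))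
  have h2 : Continuous fun p : NLoop (n + 1) Z z₀ × NCube n =>
      (⟨(ContinuousMap.curry ⟨_, h1⟩) p,
        p.1.2 _ ⟨Fin.last n, by left; exact NCube.snoc_last _ _⟩,
        p.1.2 _ ⟨Fin.last n, by right; exact NCube.snoc_last _ _⟩⟩ : LoopAt Z z₀) :=
    Continuous.subtype_mk (ContinuousMap.continuous _) _
  have h3 : Continuous fun p : NLoop (n + 1) Z z₀ =>
      (⟨ContinuousMap.curry ⟨_, h2⟩ p, by
        rintro t ⟨i, hi⟩
        refine Subtype.ext (ContinuousMap.ext fun s => ?_)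
        exact p.2 _ ⟨i.castSucc, by rwa [NCube.snoc_castSucc]⟩⟩ :
          NLoop n (LoopAt Z z₀) (LoopAt.const z₀)) :=
    Continuous.subtype_mk (ContinuousMap.continuous _) _
  refine HasW.of_inverse ⟨_, h3⟩ (fun ω => ?_) fun ω => ?_
  · refine Subtype.ext (ContinuousMap.ext fun t => Subtype.ext (ContinuousMap.ext fun s => ?_))
    change (ω.1 (NCube.snoc t s).front).1 (NCube.snoc t s (Fin.last n)) = (ω.1 t).1 s
    rw [NCube.snoc_last]
    congr 3
    exact funext fun i => NCube.snoc_castSucc _ _ _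
  · refine Subtype.ext (ContinuousMap.ext fun t => ?_)
    change ω.1 (NCube.snoc t.front (t (Fin.last n))) = ω.1 t
    congr 1
    exact Fin.snoc_init_self (α := fun _ => I) t

theorem NLoop.exists_hasW_zero (z₀ : Z) : ∃ f : C(Z, NLoop 0 Z z₀), HasW f := by
  have hb : ∀ z, z ∉ NCube.boundary 0 := fun z ⟨i, _⟩ => i.elim0
  refine ⟨⟨fun z => ⟨ContinuousMap.const _ z, fun z hz => (hb z hz).elim⟩,
    Continuous.subtype_mk (ContinuousMap.continuous_of_continuous_uncurry _ continuous_fst) _⟩,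
    HasW.of_inverse ⟨fun ω => ω.1 fun i => i.elim0, ?_⟩ (fun z => rfl) fun ω => ?_⟩
  · exact (NLoop.continuous_eval 0 z₀).comp (continuous_id.prodMk continuous_const)
  · refine Subtype.ext (ContinuousMap.ext fun t => ?_)
    exact congrArg ω.1 (funext fun i => i.elim0)

/-- Iterating one-step deloopings. -/
theorem exists_hasW_nLoop {A : ℕ → Type*} [∀ k, TopologicalSpace (A k)] (pt : ∀ k, A k) (n : ℕ)
    (G : ∀ k < n, ∃ G : C(A k, LoopAt (A (k + 1)) (pt (k + 1))),
      G (pt k) = LoopAt.const _ ∧ HasW G) :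
    ∀ k ≤ n, ∃ F : C(A 0, NLoop k (A k) (pt k)), HasW F
  | 0, _ => NLoop.exists_hasW_zero _
  | k + 1, hk => by
    obtain ⟨F, hF⟩ := exists_hasW_nLoop pt n G k (by omega)
    obtain ⟨G, h, hG⟩ := G k hk
    exact ⟨_, (NLoop.hasW_uncurry k _).comp ((hG.nLoop k h).comp hF)⟩

end WeakEquivalence

section BoxTools

variable {Q : Type} [TopologicalSpace Q] {bd : Set Q} {Y : Type*} [TopologicalSpace Y]

theorem IsCube.exists_glue_prodBd (hQ : IsCube bd) (f₀ f₁ : C(Q, Y)) {h : Q × I → Y}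
    (hh : ContinuousOn h (bd ×ˢ univ)) (h0 : ∀ z ∈ bd, h (z, 0) = f₀ z)
    (h1 : ∀ z ∈ bd, h (z, 1) = f₁ z) :
    ∃ s : Q × I → Y, ContinuousOn s (prodBd bd) ∧ (∀ z, s (z, 0) = f₀ z) ∧
      (∀ z, s (z, 1) = f₁ z) ∧ ∀ z ∈ bd, ∀ t, s (z, t) = h (z, t) := by
  classical
  let s : Q × I → Y := fun p => if p.2 = 0 then f₀ p.1 else if p.2 = 1 then f₁ p.1 else h p
  have s0 : ∀ z, s (z, 0) = f₀ z := fun z => by simp [s]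
  have s1 : ∀ z, s (z, 1) = f₁ z := fun z => by simp [s]
  have sb : ∀ z ∈ bd, ∀ t, s (z, t) = h (z, t) := fun z hz t => by
    by_cases ht : t = 0
    · rw [ht, s0, h0 z hz]
    · by_cases ht' : t = 1
      · rw [ht', s1, h1 z hz]
      · simp [s, ht, ht']
  refine ⟨s, ?_, s0, s1, sb⟩
  have : prodBd bd = (bd ×ˢ univ ∪ {p | p.2 = 0}) ∪ {p | p.2 = 1} := by
    ext p; simp [prodBd, or_assoc]
  rw [this]
  have k1 : IsClosed (bd ×ˢ (univ : Set I)) := hQ.isClosed.prod isClosed_univ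
  have k2 : IsClosed {p : Q × I | p.2 = 0} := isClosed_eq (by fun_prop) (by fun_prop)
  have k3 : IsClosed {p : Q × I | p.2 = 1} := isClosed_eq (by fun_prop) (by fun_prop)
  have c0 : Continuous fun p : Q × I => f₀ p.1 := by fun_prop
  have c1 : Continuous fun p : Q × I => f₁ p.1 := by fun_prop
  refine ((hh.congr ?_).union_of_isClosed (c0.continuousOn.congr ?_)
    k1 k2).union_of_isClosed (c1.continuousOn.congr ?_) (k1.union k2) k3
  · rintro ⟨z, v⟩ hz
    exact sb z hz.1 v
  · rintro ⟨z, v⟩ hz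
    obtain rfl : v = 0 := hz
    exact s0 z
  · rintro ⟨z, v⟩ hz
    obtain rfl : v = 1 := hz
    exact s1 z

/-- The top of a box can be changed by a homotopy relative to the boundary. -/
theorem IsCube.exists_replace_top (hQ : IsCube bd) (F : C(Q × I, Y)) (f e : C(Q, Y))
    (hf : ∀ z, F (z, 1) = f z) (h : f.HomotopicRel e bd) :
    ∃ F' : C(Q × I, Y), EqOn F' F (boxJ bd) ∧ ∀ z, F' (z, 1) = e z := by
  classical
  obtain ⟨K⟩ := h
  let s : (Q × I) × I → Y := fun p => if p.1.2 = 1 then K (p.2, p.1.1) else F p.1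
  have s1 : ∀ z v, s ((z, 1), v) = K (v, z) := fun z v => by simp [s]
  have sJ : ∀ p ∈ boxJ bd, ∀ v, s (p, v) = F p := by
    rintro ⟨z, t⟩ hp v
    by_cases ht : t = 1
    · subst ht
      rcases hp with hp | hp
      · simp at hp
      · rw [s1, K.eq_fst v hp, hf]
    · simp [s, ht]
  have hs : ContinuousOn s (prodBd bd ×ˢ univ) := by
    have : prodBd bd ×ˢ (univ : Set I) = (boxJ bd ×ˢ univ) ∪ {p | p.1.2 = 1} := by
      ext p; simp only [prodBd, boxJ, mem_prod, mem_union, mem_univ, and_true]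
      exact ⟨fun h => by rcases h with h | h | h
                         exacts [Or.inl (Or.inr h), Or.inl (Or.inl h), Or.inr h],
        fun h => by rcases h with (h | h) | h
                    exacts [Or.inr (Or.inl h), Or.inl h, Or.inr (Or.inr h)]⟩
    rw [this]
    refine ContinuousOn.union_of_isClosed ?_ ?_ (hQ.isClosed_boxJ.prod isClosed_univ)
      (isClosed_eq (by fun_prop) (by fun_prop))
    · refine ((by fun_prop : Continuous fun p : (Q × I) × I => F p.1)).continuousOn.congr ?_
      rintro ⟨p, v⟩ hp
      exact sJ p hp.1 v
    · refine ((by fun_prop : Continuous fun p : (Q × I) × I =>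
        K (p.2, p.1.1))).continuousOn.congr ?_
      rintro ⟨⟨z, t⟩, v⟩ hp
      obtain rfl : t = 1 := hp
      exact s1 z v
  obtain ⟨G, -, hG, -⟩ := hQ.prod_unitInterval.hep F hs (by
    rintro ⟨z, t⟩ (hz | ht | ht)
    · exact sJ _ (Or.inr hz) 0
    · exact sJ _ (Or.inl ht) 0
    · obtain rfl : t = 1 := ht
      exact (s1 _ _).trans ((K.map_zero_left z).trans (hf z).symm))
  refine ⟨⟨fun p => G (p, 1), by fun_prop⟩, ?_, fun z => ?_⟩
  · rintro ⟨z, t⟩ hp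
    refine (hG _ ?_ 1).trans (sJ _ hp 1)
    rcases hp with hp | hp
    exacts [Or.inr (Or.inl hp), Or.inl hp]
  · exact (hG (z, 1) (Or.inr (Or.inr rfl)) 1).trans ((s1 z 1).trans (K.map_one_left z))

/-- Maps into a contractible space extend from the boundary of a cube. -/
theorem IsCube.exists_extend_contractible (hQ : IsCube bd) (H : C(I × Y, Y)) (y₀ : Y)
    (H0 : ∀ y, H (0, y) = y) (H1 : ∀ y, H (1, y) = y₀) {f : Q → Y} (hf : ContinuousOn f bd) :
    ∃ F : C(Q, Y), EqOn F f bd := by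
  obtain ⟨F, -, hF, -⟩ := hQ.hep (ContinuousMap.const Q y₀)
    (h := fun p => H (unitInterval.symm p.2, f p.1))
    (H.continuous.comp_continuousOn ((by fun_prop : Continuous fun p : Q × I =>
      unitInterval.symm p.2).continuousOn.prodMk (hf.comp (by fun_prop) fun p hp => hp.1)))
    (fun z _ => by simp [H1])
  exact ⟨⟨fun z => F (z, 1), by fun_prop⟩, fun z hz => by simp [hF z hz, H0]⟩

/-- Two maps into a contractible space are homotopic, with given homotopy on the boundary. -/
theorem IsCube.exists_homotopy_contractible (hQ : IsCube bd) (H : C(I × Y, Y)) (y₀ : Y)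
    (H0 : ∀ y, H (0, y) = y) (H1 : ∀ y, H (1, y) = y₀) (f₀ f₁ : C(Q, Y)) {h : Q × I → Y}
    (hh : ContinuousOn h (bd ×ˢ univ)) (h0 : ∀ z ∈ bd, h (z, 0) = f₀ z)
    (h1 : ∀ z ∈ bd, h (z, 1) = f₁ z) :
    ∃ F : C(Q × I, Y), (∀ z, F (z, 0) = f₀ z) ∧ (∀ z, F (z, 1) = f₁ z) ∧
      ∀ z ∈ bd, ∀ t, F (z, t) = h (z, t) := by
  obtain ⟨s, hs, s0, s1, sb⟩ := hQ.exists_glue_prodBd f₀ f₁ hh h0 h1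
  obtain ⟨F, hF⟩ := hQ.prod_unitInterval.exists_extend_contractible H y₀ H0 H1 hs
  exact ⟨F, fun z => (hF (Or.inr (Or.inl rfl))).trans (s0 z),
    fun z => (hF (Or.inr (Or.inr rfl))).trans (s1 z),
    fun z hz t => (hF (Or.inl hz)).trans (sb z hz t)⟩

theorem IsCube.exists_bd_function (hQ : IsCube bd) {μ : ℝ} (h0 : 0 < μ) :
    ∃ d : C(Q, ℝ), (∀ z, 0 ≤ d z) ∧ (∀ z, d z ≤ μ) ∧ ∀ z, d z = 0 ↔ z ∈ bd := by
  obtain ⟨ι, _, h, hb⟩ := hQ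
  refine ⟨⟨fun z => μ * ∏ i, ((h z i : ℝ) * (1 - h z i)), by fun_prop⟩, fun z => ?_, fun z => ?_,
    fun z => ?_⟩
  · exact mul_nonneg h0.le (Finset.prod_nonneg fun i _ =>
      mul_nonneg (h z i).2.1 (sub_nonneg.2 (h z i).2.2))
  · refine mul_le_of_le_one_right h0.le (Finset.prod_le_one (fun i _ =>
      mul_nonneg (h z i).2.1 (sub_nonneg.2 (h z i).2.2)) fun i _ => ?_)
    have h1 := (h z i).2.1
    have h2 := (h z i).2.2
    nlinarith
  · simp only [ContinuousMap.coe_mk, mul_eq_zero, h0.ne', false_or, Finset.prod_eq_zero_iff, hb,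
      Finset.mem_univ, true_and, sub_eq_zero]
    refine exists_congr fun i => ?_
    rw [Subtype.ext_iff, Subtype.ext_iff, eq_comm (a := (1 : ℝ))]
    rfl

end BoxTools

/-! ### Gluing along the middle of an interval -/

/-- The first half of the unit interval. -/
def half₁ : C(I, I) := ⟨fun t => ⟨t / 2, by have := t.2.1; positivity, by
  have := t.2.2; linarith⟩, by fun_prop⟩

/-- The second half of the unit interval. -/
def half₂ : C(I, I) := ⟨fun t => ⟨(1 + t) / 2, by have := t.2.1; positivity, by
  have := t.2.2; linarith⟩, by fun_prop⟩

theorem coe_half₁ (t : I) : (half₁ t : ℝ) = t / 2 := rfl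

theorem coe_half₂ (t : I) : (half₂ t : ℝ) = (1 + t) / 2 := rfl

theorem half₁_one_eq_half₂_zero : half₁ 1 = half₂ 0 := by
  ext; simp [coe_half₁, coe_half₂]

theorem half₁_zero : half₁ 0 = 0 := by ext; simp [coe_half₁]

theorem half₂_one : half₂ 1 = 1 := by ext; simp [coe_half₂]

theorem exists_half (t : I) : (∃ s, t = half₁ s) ∨ ∃ s, t = half₂ s := by
  have h0 := t.2.1
  have h1 := t.2.2
  rcases le_total (t : ℝ) (1 / 2) with h | h
  · exact Or.inl ⟨⟨2 * t, by linarith, by linarith⟩, by ext; simp [coe_half₁]⟩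
  · exact Or.inr ⟨⟨2 * t - 1, by linarith, by linarith⟩, by ext; simp [coe_half₂]⟩

theorem exists_glue_half {Z Y : Type*} [TopologicalSpace Z] [TopologicalSpace Y]
    (f₁ f₂ : C(Z × I, Y)) (h : ∀ z, f₁ (z, 1) = f₂ (z, 0)) :
    ∃ f : C(Z × I, Y), (∀ z t, f (z, half₁ t) = f₁ (z, t)) ∧
      ∀ z t, f (z, half₂ t) = f₂ (z, t) := by
  let g : Z × I → Y := fun p => if (p.2 : ℝ) ≤ 1 / 2
    then f₁ (p.1, projIcc 0 1 zero_le_one (2 * (p.2 : ℝ)))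
    else f₂ (p.1, projIcc 0 1 zero_le_one (2 * (p.2 : ℝ) - 1))
  have hg : Continuous g := by
    refine Continuous.if_le ?_ ?_ (by fun_prop) (by fun_prop) ?_
    · exact f₁.continuous.comp (continuous_fst.prodMk (continuous_projIcc.comp (by fun_prop)))
    · exact f₂.continuous.comp (continuous_fst.prodMk (continuous_projIcc.comp (by fun_prop)))
    · rintro ⟨z, t⟩ ht
      simp only at ht
      simp only [ht]
      norm_num
      simpa using h z
  have p1 : ∀ t : I, projIcc (0 : ℝ) 1 zero_le_one (2 * (half₁ t : ℝ)) = t := fun t => by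
    rw [coe_half₁, mul_div_cancel₀ _ two_ne_zero]; exact projIcc_val _ _
  have p2 : ∀ t : I, projIcc (0 : ℝ) 1 zero_le_one (2 * (half₂ t : ℝ) - 1) = t := fun t => by
    rw [coe_half₂, mul_div_cancel₀ _ two_ne_zero, add_sub_cancel_left]; exact projIcc_val _ _
  refine ⟨⟨g, hg⟩, fun z t => ?_, fun z t => ?_⟩
  · have : (half₁ t : ℝ) ≤ 1 / 2 := by have := t.2.2; rw [coe_half₁]; linarith
    simp only [ContinuousMap.coe_mk, g, this, if_true, p1]
  · rcases eq_or_ne t 0 with rfl | ht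
    · rw [← half₁_one_eq_half₂_zero, ← h]
      have : (half₁ 1 : ℝ) ≤ 1 / 2 := by rw [coe_half₁]; simp
      simp only [ContinuousMap.coe_mk, g, this, if_true, p1]
    · have : ¬ (half₂ t : ℝ) ≤ 1 / 2 := by
        have : 0 < (t : ℝ) := unitInterval.pos_iff_ne_zero.2 ht
        rw [coe_half₂]; linarith
      simp only [ContinuousMap.coe_mk, g, this, if_false, p2]

/-! ### A controlled homotopy extension -/

/-- Homotopy extension from the bottom of a cylinder, supported near the bottom,
below the graph of `d`. -/
theorem exists_controlled_hep {Z B : Type*} [TopologicalSpace Z] [TopologicalSpace B]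
    (f h : C(Z × I, B)) (h0 : ∀ z, h (z, 0) = f (z, 0)) (d : C(Z, ℝ))
    (hd : ∀ z, 0 ≤ d z) (hd0 : ∀ z, d z = 0 → ∀ u, h (z, u) = f (z, 0)) :
    ∃ F : C((Z × I) × I, B), (∀ p, F (p, 0) = f p) ∧ (∀ z u, F ((z, 0), u) = h (z, u)) ∧
      (∀ z (x u : I), d z ≤ x → (F ((z, x), u) = f (z, x))) ∧
      ∀ z (x u : I), F ((z, x), u) = f (z, x) ∨
        (x : ℝ) < d z ∧ ((∃ y ≤ x, F ((z, x), u) = f (z, y)) ∨ ∃ v, F ((z, x), u) = h (z, v)) := by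
  let pj : ℝ → I := projIcc 0 1 zero_le_one
  have pjc : Continuous pj := continuous_projIcc
  have pjv : ∀ x : I, pj x = x := projIcc_val zero_le_one
  let y : (Z × I) × I → ℝ := fun p =>
    if d p.1.1 ≤ p.1.2 then p.1.2 else p.1.2 - p.2 * (1 - p.1.2 / d p.1.1)
  have y1 : ∀ p : (Z × I) × I, d p.1.1 ≤ p.1.2 → y p = p.1.2 := fun p hp => if_pos hp
  have y2 : ∀ p : (Z × I) × I, ¬ d p.1.1 ≤ p.1.2 →
      y p = p.1.2 - p.2 * (1 - p.1.2 / d p.1.1) := fun p hp => if_neg hp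
  have yle : ∀ p, y p ≤ p.1.2 := fun p => by
    by_cases hp : d p.1.1 ≤ p.1.2
    · exact (y1 p hp).le
    · rw [y2 p hp]
      have : (p.1.2 : ℝ) / d p.1.1 ≤ 1 := by
        have h1 := p.1.2.2.1
        exact (div_le_one (by linarith)).2 (by linarith)
      have := mul_nonneg p.2.2.1 (sub_nonneg.2 this)
      linarith
  have yd : ∀ p : (Z × I) × I, d p.1.1 ≠ 0 → ContinuousAt y p := fun p hp => by
    have hy : ∀ᶠ q in 𝓝 p, y q = q.1.2 - q.2 * max 0 (1 - q.1.2 / d q.1.1) := by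
      have : ContinuousAt (fun q : (Z × I) × I => d q.1.1) p := by fun_prop
      filter_upwards [this.eventually_ne hp] with q hq
      have hq' : 0 < d q.1.1 := lt_of_le_of_ne (hd _) (Ne.symm hq)
      by_cases hq2 : d q.1.1 ≤ q.1.2
      · rw [y1 q hq2, max_eq_left]
        · ring
        · rw [sub_nonpos, le_div_iff₀ hq']; simpa using hq2
      · rw [y2 q hq2, max_eq_right]
        rw [sub_nonneg, div_le_one hq']; linarith
    refine ContinuousAt.congr_of_eventuallyEq ?_ hy
    have : ContinuousAt (fun q : (Z × I) × I => (q.1.2 : ℝ) / d q.1.1) p :=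
      ContinuousAt.div (by fun_prop) (by fun_prop) hp
    fun_prop
  let F : (Z × I) × I → B := fun p =>
    if 0 ≤ y p then f (p.1.1, pj (y p)) else h (p.1.1, pj (- y p))
  have F1 : ∀ p, 0 ≤ y p → F p = f (p.1.1, pj (y p)) := fun p hp => if_pos hp
  have F2 : ∀ p, y p ≤ 0 → F p = h (p.1.1, pj (- y p)) := fun p hp => by
    by_cases hp' : 0 ≤ y p
    · have : y p = 0 := le_antisymm hp hp'
      rw [F1 p hp', this, neg_zero]
      have : pj 0 = 0 := projIcc_left zero_le_one
      rw [this, h0]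
    · exact if_neg hp'
  have F3 : ∀ p : (Z × I) × I, d p.1.1 ≤ p.1.2 → F p = f p.1 := fun p hp => by
    have := y1 p hp
    rw [F1 p (by rw [this]; exact p.1.2.2.1), this]
    rw [pjv]
  have hF : Continuous F := by
    rw [continuous_iff_continuousAt]
    rintro p
    by_cases hp : d p.1.1 = 0
    · by_cases hx : p.1.2 = 0
      · -- near the corner
        have hFp : F p = f (p.1.1, 0) := by
          rw [F3 p (by rw [hp]; exact p.1.2.2.1), ← hx]
        rw [ContinuousAt, hFp]
        intro U hU
        have hU1 : ∀ᶠ q : Z × I in 𝓝 p.1, f q ∈ U := by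
          have : f p.1 = f (p.1.1, 0) := by rw [← hx]
          exact f.continuous.continuousAt (by rwa [this])
        have hU2 : ∀ᶠ z in 𝓝 p.1.1, ∀ u : I, h (z, u) ∈ U := by
          have h1 : ∀ u ∈ (univ : Set I), ∀ᶠ q : Z × I in 𝓝 p.1.1 ×ˢ 𝓝 u, h q ∈ U := fun u _ => by
            rw [← nhds_prod_eq]
            exact h.continuous.continuousAt (by rwa [hd0 _ hp u])
          have h2 := isCompact_univ.mem_prod_nhdsSet_of_forall h1
          rw [nhdsSet_univ, Filter.prod_top] at h2
          obtain ⟨A, hA, hA'⟩ := h2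
          exact Filter.mem_of_superset hA fun z hz u => hA' (show (z, u).1 ∈ A from hz)
        have hU3 : ∀ᶠ q : Z × I in 𝓝 p.1, ∀ x : I, x ≤ q.2 → f (q.1, x) ∈ U := by
          obtain ⟨A, hA, C, hC, hAC⟩ := mem_nhds_prod_iff.1 hU1
          rw [hx] at hC
          obtain ⟨ε, hε, hεC⟩ := Metric.mem_nhds_iff.1 hC
          have hε' : ∀ᶠ q : Z × I in 𝓝 p.1, (q.2 : ℝ) < ε := by
            have : ContinuousAt (fun q : Z × I => (q.2 : ℝ)) p.1 := by fun_prop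
            exact this.eventually_lt_const (by show (p.1.2 : ℝ) < ε; rw [hx]; simpa using hε)
          filter_upwards [hε', continuous_fst.continuousAt.preimage_mem_nhds hA] with q hq hqA x hxq
          refine hAC ⟨hqA, hεC ?_⟩
          rw [Metric.mem_ball, Subtype.dist_eq, Real.dist_eq]
          have h1 : (x : ℝ) ≤ q.2 := hxq
          have h2 := x.2.1
          rw [Set.Icc.coe_zero, sub_zero, abs_of_nonneg h2]
          linarith
        have e1 := ((continuous_fst (X := Z × I) (Y := I)).tendsto p).eventually hU3
        have e2 := (((continuous_fst (X := Z) (Y := I)).comp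
          (continuous_fst (X := Z × I) (Y := I))).tendsto p).eventually hU2
        show ∀ᶠ q in 𝓝 p, F q ∈ U
        filter_upwards [e1, e2] with q h1 h2
        rcases le_total 0 (y q) with hy | hy
        · rw [F1 q hy]
          refine h1 _ ?_
          have : (y q) ∈ Icc (0 : ℝ) 1 := ⟨hy, (yle q).trans q.1.2.2.2⟩
          rw [show pj (y q) = ⟨y q, this⟩ from projIcc_of_mem _ this]
          exact yle q
        · rw [F2 q hy]
          exact h2 _
      · have h1 : ∀ᶠ q in 𝓝 p, F q = f q.1 := by
          have c1 : ContinuousAt (fun q : (Z × I) × I => d q.1.1) p := by fun_prop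
          have c2 : ContinuousAt (fun q : (Z × I) × I => (q.1.2 : ℝ)) p := by fun_prop
          filter_upwards [c1.eventually_lt c2 (by
            rw [hp]; exact unitInterval.pos_iff_ne_zero.2 hx)] with q hq
          exact F3 q hq.le
        refine ContinuousAt.congr_of_eventuallyEq ?_ h1
        fun_prop
    · have hy := yd p hp
      have c1 : ContinuousAt (fun q : (Z × I) × I => f (q.1.1, pj (y q))) p :=
        f.continuous.continuousAt.comp (by fun_prop)
      have c2 : ContinuousAt (fun q : (Z × I) × I => h (q.1.1, pj (-y q))) p :=
        h.continuous.continuousAt.comp (by fun_prop)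
      rcases lt_trichotomy (y p) 0 with h1 | h1 | h1
      · exact c2.congr_of_eventuallyEq ((hy.eventually_lt_const h1).mono fun q hq => F2 q hq.le)
      · have v1 : F p = f (p.1.1, pj (y p)) := F1 p h1.ge
        have v2 : F p = h (p.1.1, pj (-y p)) := F2 p h1.le
        intro U hU
        have a1 : ∀ᶠ q in 𝓝 p, f (q.1.1, pj (y q)) ∈ U := c1 (by rwa [v1] at hU)
        have a2 : ∀ᶠ q in 𝓝 p, h (q.1.1, pj (-y q)) ∈ U := c2 (by rwa [v2] at hU)
        show ∀ᶠ q in 𝓝 p, F q ∈ U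
        filter_upwards [a1, a2] with q hq1 hq2
        rcases le_total 0 (y q) with h | h
        · rwa [F1 q h]
        · rwa [F2 q h]
      · exact c1.congr_of_eventuallyEq ((hy.eventually_const_lt h1).mono fun q hq => F1 q hq.le)
  refine ⟨⟨F, hF⟩, fun p => ?_, fun z u => ?_, fun z x u hx => F3 _ hx, fun z x u => ?_⟩
  · change F (p, 0) = f p
    have : y (p, 0) = p.2 := by
      by_cases hp : d p.1 ≤ p.2
      · exact y1 _ hp
      · rw [y2 _ hp]; simp
    rw [F1 _ (by rw [this]; exact p.2.2.1), this]
    rw [pjv]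
  · change F ((z, 0), u) = h (z, u)
    by_cases hz : d z = 0
    · rw [F3 _ (by simp [hz]), hd0 z hz]
    · have : y ((z, 0), u) = - u := by
        rw [y2]
        · simp
        · simpa using lt_of_le_of_ne (hd z) (Ne.symm hz)
      rw [F2 _ (by rw [this]; simpa using u.2.1), this, neg_neg]
      rw [pjv]
  · by_cases hx : d z ≤ x
    · exact Or.inl (F3 _ hx)
    · refine Or.inr ⟨not_le.1 hx, ?_⟩
      rcases le_total 0 (y ((z, x), u)) with hy | hy
      · left
        have : y ((z, x), u) ∈ Icc (0 : ℝ) 1 := ⟨hy, (yle _).trans x.2.2⟩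
        exact ⟨⟨_, this⟩, yle ((z, x), u), (F1 _ hy).trans (by
          rw [show pj (y _) = ⟨_, this⟩ from projIcc_of_mem _ this])⟩
      · right
        exact ⟨_, F2 _ hy⟩

/-! ### Lifting over a box, up to controlled homotopy -/

section BoxLift

variable {E B α : Type*} [TopologicalSpace E] [TopologicalSpace B]
  {Q : Type} [TopologicalSpace Q]

/-- An admissible homotopy of a map on a box: it is relative to the open box and at each point
satisfies the constraints imposed at this point. -/
structure IsAdmissible (N : α → Set B) (bd : Set Q) (c : Q × I → Set α) (β : C(Q × I, B))
    (Φ : C((Q × I) × I, B)) : Prop where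
  zero : ∀ q, Φ (q, 0) = β q
  rel : ∀ q ∈ boxJ bd, ∀ v, Φ (q, v) = β q
  mem : ∀ q v, ∀ a ∈ c q, Φ (q, v) ∈ N a

/-- After an admissible homotopy, the map `β` lifts, extending a given lift on the open box. -/
def Liftable (p : C(E, B)) (N : α → Set B) (bd : Set Q) (c : Q × I → Set α) (β : C(Q × I, B))
    (l : Q × I → E) : Prop :=
  ∃ (Φ : C((Q × I) × I, B)) (Λ : C(Q × I, E)), IsAdmissible N bd c β Φ ∧ EqOn Λ l (boxJ bd) ∧
    ∀ q, p (Λ q) = Φ (q, 1)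

/-- All maps satisfying the constraints are liftable. -/
def BoxLift (p : C(E, B)) (N : α → Set B) (bd : Set Q) (c : Q × I → Set α) : Prop :=
  ∀ β : C(Q × I, B), (∀ q, ∀ a ∈ c q, β q ∈ N a) → ∀ l : Q × I → E,
    ContinuousOn l (boxJ bd) → (∀ q ∈ boxJ bd, p (l q) = β q) → Liftable p N bd c β l

variable {p : C(E, B)} {N : α → Set B} {bd : Set Q} {c : Q × I → Set α}

theorem Liftable.of_admissible {β β' : C(Q × I, B)} {Φ : C((Q × I) × I, B)} {l : Q × I → E}
    (hΦ : IsAdmissible N bd c β Φ) (hβ' : ∀ q, β' q = Φ (q, 1)) (h : Liftable p N bd c β' l) :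
    Liftable p N bd c β l := by
  obtain ⟨Φ', Λ, h', hl, hp⟩ := h
  obtain ⟨Ψ, h1, h2⟩ := exists_glue_half Φ Φ' fun q => by rw [h'.zero, hβ']
  refine ⟨Ψ, Λ, ⟨fun q => ?_, fun q hq v => ?_, fun q v a ha => ?_⟩, hl, fun q => ?_⟩
  · rw [← half₁_zero, h1, hΦ.zero]
  · obtain ⟨v, rfl⟩ | ⟨v, rfl⟩ := exists_half v
    · rw [h1, hΦ.rel q hq]
    · rw [h2, h'.rel q hq, hβ', hΦ.rel q hq]
  · obtain ⟨v, rfl⟩ | ⟨v, rfl⟩ := exists_half v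
    · rw [h1]; exact hΦ.mem q v a ha
    · rw [h2]; exact h'.mem q v a ha
  · rw [hp, ← h2, half₂_one]

theorem BoxLift.mono {c' : Q × I → Set α} (h : BoxLift p N bd c') (h1 : ∀ q, c' q ⊆ c q)
    (h2 : ∀ q ∉ boxJ bd, c q ⊆ c' q) : BoxLift p N bd c := by
  intro β hβ l hl hpl
  obtain ⟨Φ, Λ, hΦ, hΛ, hp⟩ := h β (fun q a ha => hβ q a (h1 q ha)) l hl hpl
  refine ⟨Φ, Λ, ⟨hΦ.zero, hΦ.rel, fun q v a ha => ?_⟩, hΛ, hp⟩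
  by_cases hq : q ∈ boxJ bd
  · rw [hΦ.rel q hq]; exact hβ q a ha
  · exact hΦ.mem q v a (h2 q hq ha)

theorem BoxLift.of_homeomorph {Q' : Type} [TopologicalSpace Q'] {bd' : Set Q'} (e : Q ≃ₜ Q')
    (he : ∀ q, e q ∈ bd' ↔ q ∈ bd) {c' : Q' × I → Set α} (h : BoxLift p N bd' c')
    (hc : ∀ q t, c (q, t) = c' (e q, t)) : BoxLift p N bd c := by
  intro β hβ l hl hpl
  have hs : ∀ q t, (q, t) ∈ boxJ bd' ↔ (e.symm q, t) ∈ boxJ bd := fun q t => by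
    simp only [boxJ, Set.mem_ofPred_eq, ← he, e.apply_symm_apply]
  have hs' : ∀ q t, (e q, t) ∈ boxJ bd' ↔ (q, t) ∈ boxJ bd := fun q t => by
    simp only [boxJ, Set.mem_ofPred_eq, ← he]
  obtain ⟨Φ, Λ, hΦ, hΛ, hp⟩ := h ⟨fun q => β (e.symm q.1, q.2), by fun_prop⟩
    (fun q a ha => hβ _ a (by rw [hc, e.apply_symm_apply]; exact ha))
    (fun q => l (e.symm q.1, q.2))
    (hl.comp (by fun_prop) fun q hq => (hs q.1 q.2).1 hq) fun q hq => hpl _ ((hs q.1 q.2).1 hq)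
  refine ⟨⟨fun q => Φ ((e q.1.1, q.1.2), q.2), by fun_prop⟩, ⟨fun q => Λ (e q.1, q.2), by fun_prop⟩,
    ⟨fun q => ?_, fun q hq v => ?_, fun q v a ha => ?_⟩, fun q hq => ?_, fun q => ?_⟩
  · simp [hΦ.zero]
  · simp [hΦ.rel _ ((hs' q.1 q.2).2 hq)]
  · exact hΦ.mem _ v a (by rw [← hc]; exact ha)
  · simp [hΛ ((hs' q.1 q.2).2 hq)]
  · exact hp _

theorem half₁_mem_boxJ {R : Type} {b : Set R} {q : R × I} (hq : q ∈ boxJ b) :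
    (q.1, half₁ q.2) ∈ boxJ b := by
  rcases hq with hq | hq
  · left; show half₁ q.2 = 0; rw [hq, half₁_zero]
  · exact Or.inr hq

/-- Splitting a box in the vertical direction. -/
theorem BoxLift.split_time (hQ : IsCube bd) {μ : ℝ} (hμ : 0 < μ)
    (hc : ∀ q (x y : I), y ≤ x → (x : ℝ) < μ → c (q, half₂ x) ⊆ c (q, half₂ y))
    (h1 : BoxLift p N bd fun q => c (q.1, half₁ q.2))
    (h2 : BoxLift p N bd fun q => c (q.1, half₂ q.2)) : BoxLift p N bd c := by
  intro β hβ l hl hpl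
  obtain ⟨Φ₁, Λ₁, hΦ₁, hΛ₁, hp₁⟩ := h1 ⟨fun q => β (q.1, half₁ q.2), by fun_prop⟩
    (fun q a ha => hβ _ a ha) (fun q => l (q.1, half₁ q.2))
    (hl.comp (by fun_prop) fun q hq => half₁_mem_boxJ hq)
    (fun q hq => hpl _ (half₁_mem_boxJ hq))
  obtain ⟨d, hd, hdμ, hd0⟩ := hQ.exists_bd_function hμ
  obtain ⟨F, F0, Fb, Fd, Fc⟩ := exists_controlled_hep
    ⟨fun q : Q × I => β (q.1, half₂ q.2), by fun_prop⟩
    ⟨fun q : Q × I => Φ₁ ((q.1, 1), q.2), by fun_prop⟩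
    (fun z => by simp [hΦ₁.zero, half₁_one_eq_half₂_zero]) d hd
    (fun z hz u => by
      simp [hΦ₁.rel (z, 1) (Or.inr ((hd0 z).1 hz)), half₁_one_eq_half₂_zero])
  simp only [ContinuousMap.coe_mk] at F0 Fb Fd Fc
  obtain ⟨Φ', g1, g2⟩ := exists_glue_half
    ⟨fun z : (Q × I) × I => Φ₁ ((z.1.1, z.2), z.1.2), by fun_prop⟩
    ⟨fun z : (Q × I) × I => F ((z.1.1, z.2), z.1.2), by fun_prop⟩ fun z => by simp [Fb]
  simp only [ContinuousMap.coe_mk] at g1 g2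
  have of_half₁ : ∀ {q : Q} {t : I}, (q, half₁ t) ∈ boxJ bd → (q, t) ∈ boxJ bd := fun hq => by
    rcases hq with hq | hq
    · left; ext; simpa [coe_half₁] using congrArg Subtype.val hq
    · exact Or.inr hq
  have of_half₂' : ∀ {q : Q} {t : I}, (q, half₂ t) ∈ boxJ bd → q ∈ bd := fun {q t} hq => by
    rcases hq with hq | hq
    · have : (1 + (t : ℝ)) / 2 = 0 := congrArg Subtype.val hq
      have := t.2.1
      linarith
    · exact hq
  have of_half₂ : ∀ {q : Q} {t : I}, (q, half₂ t) ∈ boxJ bd → (q, t) ∈ boxJ bd :=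
    fun hq => Or.inr (of_half₂' hq)
  let l₂ : Q × I → E := fun q => if q.2 = 0 then Λ₁ (q.1, 1) else l (q.1, half₂ q.2)
  have l₂0 : ∀ q, l₂ (q, 0) = Λ₁ (q, 1) := fun q => if_pos rfl
  have l₂b : ∀ {q} t, q ∈ bd → l₂ (q, t) = l (q, half₂ t) := fun {q} t hq => by
    by_cases ht : t = 0
    · subst ht
      rw [l₂0, hΛ₁ (Or.inr hq), ← half₁_one_eq_half₂_zero]
    · exact if_neg ht
  have l₂c : ContinuousOn l₂ (boxJ bd) := by
    refine ContinuousOn.union_of_isClosed (s := {q : Q × I | q.2 = 0}) (t := {q | q.1 ∈ bd})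
      (((by fun_prop : Continuous fun q : Q × I => Λ₁ (q.1, 1))).continuousOn.congr ?_)
      ((hl.comp (f := fun q : Q × I => (q.1, half₂ q.2)) (by fun_prop)
        fun q hq => Or.inr hq).congr ?_) (isClosed_eq (by fun_prop) (by fun_prop))
        (hQ.isClosed.preimage continuous_fst)
    · rintro ⟨q, t⟩ ht
      obtain rfl : t = 0 := ht
      exact l₂0 q
    · rintro ⟨q, t⟩ hq
      exact l₂b t hq
  have l₂p : ∀ q ∈ boxJ bd, p (l₂ q) = F (q, 1) := by
    rintro ⟨q, t⟩ (hq | hq)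
    · obtain rfl : t = 0 := hq
      rw [l₂0, hp₁, Fb]
    · rw [l₂b _ hq, hpl (q, half₂ t) (Or.inr hq),
        Fd _ _ _ (by rw [(hd0 q).2 hq]; exact t.2.1)]
  have FN : ∀ q t v, ∀ a ∈ c (q, half₂ t), F ((q, t), v) ∈ N a := by
    intro q t v a ha
    rcases Fc q t v with h | ⟨hlt, ⟨y, hy, h⟩ | ⟨v, h⟩⟩
    · rw [h]; exact hβ _ a ha
    · rw [h]; exact hβ _ a (hc _ _ _ hy (hlt.trans_le (hdμ _)) ha)
    · rw [h]
      refine hΦ₁.mem _ _ _ ?_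
      show a ∈ c (q, half₁ 1)
      rw [half₁_one_eq_half₂_zero]
      exact hc _ _ _ t.2.1 (hlt.trans_le (hdμ _)) ha
  refine Liftable.of_admissible (β' := ⟨fun q => Φ' ((q.1, 1), q.2), by fun_prop⟩)
    (Φ := ⟨fun q => Φ' ((q.1.1, q.2), q.1.2), by fun_prop⟩) ⟨?_, ?_, ?_⟩ (fun _ => rfl) ?_
  · rintro ⟨q, t⟩
    obtain ⟨t, rfl⟩ | ⟨t, rfl⟩ := exists_half t
    · simp [g1, hΦ₁.zero]
    · simp [g2, F0]
  · rintro ⟨q, t⟩ hq v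
    have hb : ∀ t v, q ∈ bd → F ((q, t), v) = β (q, half₂ t) := fun t v hq =>
      Fd _ _ _ (by rw [(hd0 q).2 hq]; exact t.2.1)
    obtain ⟨t, rfl⟩ | ⟨t, rfl⟩ := exists_half t
    · simp only [ContinuousMap.coe_mk, g1]
      exact hΦ₁.rel _ (of_half₁ hq) _
    · simp only [ContinuousMap.coe_mk, g2]
      exact hb _ _ (of_half₂' hq)
  · rintro ⟨q, t⟩ v a ha
    obtain ⟨t, rfl⟩ | ⟨t, rfl⟩ := exists_half t
    · simp only [ContinuousMap.coe_mk, g1]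
      exact hΦ₁.mem _ _ _ ha
    · simp only [ContinuousMap.coe_mk, g2]
      exact FN _ _ _ _ ha
  · obtain ⟨Φ₂, Λ₂, hΦ₂, hΛ₂, hp₂⟩ := h2 ⟨fun q => F (q, 1), by fun_prop⟩
      (fun q a ha => FN _ _ _ _ ha) l₂ l₂c l₂p
    obtain ⟨Φ'', e1, e2⟩ := exists_glue_half
      ⟨fun z : (Q × I) × I => Φ₁ ((z.1.1, z.2), 1), by fun_prop⟩
      ⟨fun z : (Q × I) × I => Φ₂ ((z.1.1, z.2), z.1.2), by fun_prop⟩ fun z => by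
        simp [hΦ₂.rel (z.1, 0) (Or.inl rfl), Fb]
    obtain ⟨Λ, k1, k2⟩ := exists_glue_half Λ₁ Λ₂ fun q => by
      rw [hΛ₂ (Or.inl rfl), l₂0]
    simp only [ContinuousMap.coe_mk] at e1 e2
    refine ⟨⟨fun q => Φ'' ((q.1.1, q.2), q.1.2), by fun_prop⟩, Λ, ⟨?_, ?_, ?_⟩, ?_, ?_⟩
    · rintro ⟨q, t⟩
      obtain ⟨t, rfl⟩ | ⟨t, rfl⟩ := exists_half t
      · simp [e1, g1]
      · simp [e2, g2, hΦ₂.zero]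
    · rintro ⟨q, t⟩ hq v
      obtain ⟨t, rfl⟩ | ⟨t, rfl⟩ := exists_half t
      · simp [e1, g1]
      · simp only [ContinuousMap.coe_mk, e2, g2]
        exact hΦ₂.rel _ (of_half₂ hq) _
    · rintro ⟨q, t⟩ v a ha
      obtain ⟨t, rfl⟩ | ⟨t, rfl⟩ := exists_half t
      · simp only [ContinuousMap.coe_mk, e1]
        exact hΦ₁.mem _ _ _ ha
      · simp only [ContinuousMap.coe_mk, e2]
        exact hΦ₂.mem _ _ _ ha
    · rintro ⟨q, t⟩ hq
      obtain ⟨t, rfl⟩ | ⟨t, rfl⟩ := exists_half t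
      · rw [k1, hΛ₁ (of_half₁ hq)]
      · rw [k2, hΛ₂ (of_half₂ hq), l₂b _ (of_half₂' hq)]
    · rintro ⟨q, t⟩
      obtain ⟨t, rfl⟩ | ⟨t, rfl⟩ := exists_half t
      · simp [k1, e1, hp₁]
      · simp [k2, e2, hp₂]

/-- Splitting a box in a horizontal direction. -/
theorem BoxLift.split_wall {R : Type} [TopologicalSpace R] {b : Set R} (hR : IsCube b)
    {c : (R × I) × I → Set α} {μ : ℝ} (hμ : 0 < μ) (hμ1 : μ ≤ 1)
    (hc₁ : ∀ r t (x y : I), y ≤ x → (x : ℝ) < μ →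
      c ((r, half₁ (unitInterval.symm x)), t) ⊆ c ((r, half₁ (unitInterval.symm y)), t))
    (hc₂ : ∀ r t (x y : I), y ≤ x → (x : ℝ) < μ → c ((r, half₂ x), t) ⊆ c ((r, half₂ y), t))
    (hw : BoxLift p N b fun q => c ((q.1, half₂ 0), q.2))
    (h1 : BoxLift p N (prodBd b) fun q => c ((q.1.1, half₁ q.1.2), q.2))
    (h2 : BoxLift p N (prodBd b) fun q => c ((q.1.1, half₂ q.1.2), q.2)) :
    BoxLift p N (prodBd b) c := by
  intro β hβ l hl hpl
  have hwJ : ∀ {r : R} {x t : I}, (r, t) ∈ boxJ b → ((r, x), t) ∈ boxJ (prodBd b) := fun h => by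
    rcases h with h | h
    exacts [Or.inl h, Or.inr (Or.inl h)]
  obtain ⟨Φw, Λw, hΦw, hΛw, hpw⟩ := hw ⟨fun q => β ((q.1, half₂ 0), q.2), by fun_prop⟩
    (fun q a ha => hβ _ a ha) (fun q => l ((q.1, half₂ 0), q.2))
    (hl.comp (by fun_prop) fun q hq => hwJ hq) (fun q hq => hpl _ (hwJ hq))
  obtain ⟨d, hd, hdμ, hd0⟩ := hR.exists_bd_function hμ
  have key : ∀ s : C(I, I), s 0 = half₂ 0 →
      (∀ r t (x y : I), y ≤ x → (x : ℝ) < μ → c ((r, s x), t) ⊆ c ((r, s y), t)) →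
      ∃ F : C(((R × I) × I) × I, B), (∀ r t x, F (((r, t), x), 0) = β ((r, s x), t)) ∧
        (∀ r t v, F (((r, t), 0), v) = Φw ((r, t), v)) ∧
        (∀ r t x v, (r, t) ∈ boxJ b ∨ x = 1 → F (((r, t), x), v) = β ((r, s x), t)) ∧
        ∀ r t x v, ∀ a ∈ c ((r, s x), t), F (((r, t), x), v) ∈ N a := by
    intro s s0 hs
    obtain ⟨F, F0, Fb, Fd, Fc⟩ := exists_controlled_hep
      ⟨fun q : (R × I) × I => β ((q.1.1, s q.2), q.1.2), by fun_prop⟩ Φw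
      (fun z => by simp [hΦw.zero, s0]) ⟨fun z => d z.1 * z.2, by fun_prop⟩
      (fun z => mul_nonneg (hd _) z.2.2.1)
      (fun z hz u => by
        have : z ∈ boxJ b := by
          rcases mul_eq_zero.1 hz with h | h
          · exact Or.inr ((hd0 _).1 h)
          · exact Or.inl (Subtype.ext h)
        simp [hΦw.rel z this, s0])
    simp only [ContinuousMap.coe_mk] at F0 Fb Fd Fc
    have hdt : ∀ (r : R) (t : I), d r * t ≤ μ := fun r t =>
      (mul_le_of_le_one_right (hd r) t.2.2).trans (hdμ r)
    refine ⟨F, fun r t x => F0 _, fun r t v => Fb _ _, fun r t x v h => Fd _ _ _ ?_,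
      fun r t x v a ha => ?_⟩
    · rcases h with (h | h) | h
      · obtain rfl : t = 0 := h
        simpa using x.2.1
      · rw [(hd0 r).2 h, zero_mul]; exact x.2.1
      · rw [h]; exact (hdt r t).trans hμ1
    · rcases Fc (r, t) x v with h | ⟨hlt, ⟨y, hy, h⟩ | ⟨v, h⟩⟩
      · rw [h]; exact hβ _ a ha
      · rw [h]; exact hβ _ a (hs _ _ _ _ hy (hlt.trans_le (hdt _ _)) ha)
      · rw [h]
        refine hΦw.mem _ _ _ ?_
        show a ∈ c ((r, half₂ 0), t)
        rw [← s0]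
        exact hs _ _ _ _ x.2.1 (hlt.trans_le (hdt _ _)) ha
  obtain ⟨F₁, F₁0, F₁w, F₁r, F₁N⟩ := key ⟨fun x => half₁ (unitInterval.symm x), by fun_prop⟩
    (by simp [half₁_one_eq_half₂_zero]) hc₁
  obtain ⟨F₂, F₂0, F₂w, F₂r, F₂N⟩ := key half₂ rfl hc₂
  simp only [ContinuousMap.coe_mk] at F₁0 F₁w F₁r F₁N
  obtain ⟨Φ', g1, g2⟩ := exists_glue_half
    ⟨fun z : ((R × I) × I) × I => F₁ ((z.1.1, unitInterval.symm z.2), z.1.2), by fun_prop⟩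
    ⟨fun z : ((R × I) × I) × I => F₂ ((z.1.1, z.2), z.1.2), by fun_prop⟩ fun z => by
      simp [F₁w, F₂w]
  simp only [ContinuousMap.coe_mk] at g1 g2
  have of_half₁ : ∀ {r x t}, ((r, half₁ x), t) ∈ boxJ (prodBd b) → (r, t) ∈ boxJ b ∨ x = 0 := by
    intro r x t h
    rcases h with h | h | h | h
    · exact Or.inl (Or.inl h)
    · exact Or.inl (Or.inr h)
    · right; ext; simpa [coe_half₁] using congrArg Subtype.val h
    · have h : (x : ℝ) / 2 = 1 := congrArg Subtype.val h
      have := x.2.2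
      linarith
  have of_half₂ : ∀ {r x t}, ((r, half₂ x), t) ∈ boxJ (prodBd b) → (r, t) ∈ boxJ b ∨ x = 1 := by
    intro r x t h
    rcases h with h | h | h | h
    · exact Or.inl (Or.inl h)
    · exact Or.inl (Or.inr h)
    · have h : (1 + (x : ℝ)) / 2 = 0 := congrArg Subtype.val h
      have := x.2.1
      linarith
    · right; ext
      have h : (1 + (x : ℝ)) / 2 = 1 := congrArg Subtype.val h
      rw [Set.Icc.coe_one]; linarith
  have mk : ∀ {r x t}, ((r, x), t) ∈ boxJ (prodBd b) ↔ (r, t) ∈ boxJ b ∨ x = 0 ∨ x = 1 := by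
    intro r x t
    simp only [boxJ, prodBd, Set.mem_ofPred_eq]; tauto
  -- the problem on one of the halves
  have side : ∀ (s : C(I, I)) (F : C(((R × I) × I) × I, B)) (e e' : I),
      (e = 0 ∧ e' = 1 ∨ e = 1 ∧ e' = 0) →
      s e = half₂ 0 → s e' = e' →
      BoxLift p N (prodBd b) (fun q => c ((q.1.1, s q.1.2), q.2)) →
      (∀ r t, F (((r, t), e), 1) = Φw ((r, t), 1)) →
      (∀ r t x v, (r, t) ∈ boxJ b ∨ x = e' → F (((r, t), x), v) = β ((r, s x), t)) →
      (∀ r t x v, ∀ a ∈ c ((r, s x), t), F (((r, t), x), v) ∈ N a) →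
      ∃ (Φ : C(((R × I) × I) × I, B)) (Λ : C((R × I) × I, E)),
        IsAdmissible N (prodBd b) (fun q => c ((q.1.1, s q.1.2), q.2))
          ⟨fun q => F (((q.1.1, q.2), q.1.2), 1), by fun_prop⟩ Φ ∧
        (∀ r t, Λ ((r, e), t) = Λw (r, t)) ∧
        (∀ r x t, (r, t) ∈ boxJ b ∨ x = e' → Λ ((r, x), t) = l ((r, s x), t)) ∧
        ∀ q, p (Λ q) = Φ (q, 1) := by
    intro s F e e' hee se se' hB hFw hFr hFN
    have mk' : ∀ {r x t}, ((r, x), t) ∈ boxJ (prodBd b) ↔ x = e ∨ (r, t) ∈ boxJ b ∨ x = e' := by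
      intro r x t
      rw [mk]
      rcases hee with ⟨rfl, rfl⟩ | ⟨rfl, rfl⟩ <;> tauto
    have hs : ∀ {r x t}, (r, t) ∈ boxJ b ∨ x = e' → ((r, s x), t) ∈ boxJ (prodBd b) := by
      intro r x t h
      rcases h with h | h
      · exact mk'.2 (Or.inr (Or.inl h))
      · exact mk'.2 (Or.inr (Or.inr (by rw [h, se'])))
    let l' : (R × I) × I → E := fun q =>
      if q.1.2 = e then Λw (q.1.1, q.2) else l ((q.1.1, s q.1.2), q.2)
    have l'e : ∀ r t, l' ((r, e), t) = Λw (r, t) := fun r t => if_pos rfl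
    have l'r : ∀ r x t, (r, t) ∈ boxJ b ∨ x = e' → l' ((r, x), t) = l ((r, s x), t) := by
      intro r x t h
      by_cases hx : x = e
      · subst hx
        rcases h with h | h
        · rw [l'e, hΛw h, se]
        · rcases hee with ⟨rfl, rfl⟩ | ⟨rfl, rfl⟩
          · exact absurd h zero_ne_one
          · exact absurd h one_ne_zero
      · exact if_neg hx
    have l'c : ContinuousOn l' (boxJ (prodBd b)) := by
      have : boxJ (prodBd b) = {q : (R × I) × I | q.1.2 = e} ∪
          {q | (q.1.1, q.2) ∈ boxJ b ∨ q.1.2 = e'} := by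
        ext ⟨⟨r, x⟩, t⟩; exact mk'
      rw [this]
      refine ContinuousOn.union_of_isClosed
        (((by fun_prop : Continuous fun q : (R × I) × I => Λw (q.1.1, q.2))).continuousOn.congr ?_)
        ((hl.comp (f := fun q : (R × I) × I => ((q.1.1, s q.1.2), q.2)) (by fun_prop)
          fun q hq => hs hq).congr ?_) (isClosed_eq (by fun_prop) (by fun_prop))
        ((hR.isClosed_boxJ.preimage (by fun_prop)).union (isClosed_eq (by fun_prop) (by fun_prop)))
      · rintro ⟨⟨r, x⟩, t⟩ hx
        obtain rfl : x = e := hx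
        exact l'e r t
      · rintro ⟨⟨r, x⟩, t⟩ hx
        exact l'r r x t hx
    have l'p : ∀ q ∈ boxJ (prodBd b), p (l' q) = F (((q.1.1, q.2), q.1.2), 1) := by
      rintro ⟨⟨r, x⟩, t⟩ h
      rcases mk'.1 h with rfl | h
      · rw [l'e, hpw]; exact (hFw r t).symm
      · rw [l'r r x t h, hpl _ (hs h)]; exact (hFr _ _ _ _ h).symm
    obtain ⟨Φ, Λ, hΦ, hΛ, hp⟩ := hB ⟨fun q => F (((q.1.1, q.2), q.1.2), 1), by fun_prop⟩
      (fun q a ha => hFN _ _ _ _ a ha) l' l'c l'p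
    exact ⟨Φ, Λ, hΦ, fun r t => (hΛ (mk'.2 (Or.inl rfl))).trans (l'e r t),
        fun r x t h => (hΛ (mk'.2 (Or.inr h))).trans (l'r r x t h), hp⟩
  obtain ⟨Φ₁, Λ₁, hΦ₁, e₁, r₁, p₁⟩ := side half₁
    ⟨fun z => F₁ ((z.1.1, unitInterval.symm z.1.2), z.2), by fun_prop⟩ 1 0 (Or.inr ⟨rfl, rfl⟩)
    half₁_one_eq_half₂_zero half₁_zero h1 (fun r t => by simp [F₁w])
    (fun r t x v h => by
      simp only [ContinuousMap.coe_mk]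
      rw [F₁r, unitInterval.symm_symm]
      exact h.imp_right fun h => by simp [h])
    (fun r t x v a ha => F₁N _ _ _ _ _ (by rwa [unitInterval.symm_symm]))
  obtain ⟨Φ₂, Λ₂, hΦ₂, e₂, r₂, p₂⟩ := side half₂ F₂ 0 1 (Or.inl ⟨rfl, rfl⟩) rfl half₂_one h2
    (fun r t => by simp [F₂w]) F₂r F₂N
  obtain ⟨Φ'', k1, k2⟩ := exists_glue_half
    ⟨fun z : ((R × I) × I) × I => Φ₁ (((z.1.1.1, z.2), z.1.1.2), z.1.2), by fun_prop⟩
    ⟨fun z : ((R × I) × I) × I => Φ₂ (((z.1.1.1, z.2), z.1.1.2), z.1.2), by fun_prop⟩ fun z => by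
      simp [hΦ₁.rel ((_, 1), _) (mk.2 (Or.inr (Or.inr rfl))),
        hΦ₂.rel ((_, 0), _) (mk.2 (Or.inr (Or.inl rfl))), F₁w, F₂w]
  obtain ⟨Λ, m1, m2⟩ := exists_glue_half
    ⟨fun z : (R × I) × I => Λ₁ ((z.1.1, z.2), z.1.2), by fun_prop⟩
    ⟨fun z : (R × I) × I => Λ₂ ((z.1.1, z.2), z.1.2), by fun_prop⟩ fun z => by simp [e₁, e₂]
  simp only [ContinuousMap.coe_mk] at k1 k2 m1 m2
  refine Liftable.of_admissible
    (β' := ⟨fun q => Φ' (((q.1.1, q.2), 1), q.1.2), by fun_prop⟩)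
    (Φ := ⟨fun q => Φ' (((q.1.1.1, q.1.2), q.2), q.1.1.2), by fun_prop⟩) ⟨?_, ?_, ?_⟩
    (fun _ => rfl)
    ⟨⟨fun q => Φ'' (((q.1.1.1, q.1.2), q.2), q.1.1.2), by fun_prop⟩,
      ⟨fun q => Λ ((q.1.1, q.2), q.1.2), by fun_prop⟩, ⟨?_, ?_, ?_⟩, ?_, ?_⟩
  · rintro ⟨⟨r, x⟩, t⟩
    obtain ⟨x, rfl⟩ | ⟨x, rfl⟩ := exists_half x
    · simp [g1, F₁0]
    · simp [g2, F₂0]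
  · rintro ⟨⟨r, x⟩, t⟩ hq v
    obtain ⟨x, rfl⟩ | ⟨x, rfl⟩ := exists_half x
    · simp only [ContinuousMap.coe_mk, g1]
      rw [F₁r, unitInterval.symm_symm]
      exact (of_half₁ hq).imp_right fun h => by simp [h]
    · simp only [ContinuousMap.coe_mk, g2]
      rw [F₂r _ _ _ _ (of_half₂ hq)]
  · rintro ⟨⟨r, x⟩, t⟩ v a ha
    obtain ⟨x, rfl⟩ | ⟨x, rfl⟩ := exists_half x
    · simp only [ContinuousMap.coe_mk, g1]
      exact F₁N _ _ _ _ _ (by rwa [unitInterval.symm_symm])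
    · simp only [ContinuousMap.coe_mk, g2]
      exact F₂N _ _ _ _ _ ha
  · rintro ⟨⟨r, x⟩, t⟩
    obtain ⟨x, rfl⟩ | ⟨x, rfl⟩ := exists_half x
    · simp [k1, g1, hΦ₁.zero]
    · simp [k2, g2, hΦ₂.zero]
  · rintro ⟨⟨r, x⟩, t⟩ hq v
    obtain ⟨x, rfl⟩ | ⟨x, rfl⟩ := exists_half x
    · simp only [ContinuousMap.coe_mk, k1, g1]
      exact hΦ₁.rel _ (mk.2 ((of_half₁ hq).imp_right Or.inl)) _
    · simp only [ContinuousMap.coe_mk, k2, g2]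
      exact hΦ₂.rel _ (mk.2 ((of_half₂ hq).imp_right Or.inr)) _
  · rintro ⟨⟨r, x⟩, t⟩ v a ha
    obtain ⟨x, rfl⟩ | ⟨x, rfl⟩ := exists_half x
    · simp only [ContinuousMap.coe_mk, k1]
      exact hΦ₁.mem _ _ _ ha
    · simp only [ContinuousMap.coe_mk, k2]
      exact hΦ₂.mem _ _ _ ha
  · rintro ⟨⟨r, x⟩, t⟩ hq
    obtain ⟨x, rfl⟩ | ⟨x, rfl⟩ := exists_half x
    · simp only [ContinuousMap.coe_mk, m1]
      exact r₁ _ _ _ (of_half₁ hq)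
    · simp only [ContinuousMap.coe_mk, m2]
      exact r₂ _ _ _ (of_half₂ hq)
  · rintro ⟨⟨r, x⟩, t⟩
    obtain ⟨x, rfl⟩ | ⟨x, rfl⟩ := exists_half x
    · simp [m1, k1, p₁]
    · simp [m2, k2, p₂]

end BoxLift

section Grid

/-- The union of the sets `A j` attached to the intervals `[j / 2 ^ f, (j + 1) / 2 ^ f]`
containing `x`. -/
def gridUnion {α : Type*} (f : ℕ) (A : ℕ → Set α) (x : I) : Set α :=
  {a | ∃ j : ℕ, (j : ℝ) ≤ 2 ^ f * (x : ℝ) ∧ 2 ^ f * (x : ℝ) ≤ j + 1 ∧ a ∈ A j}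

variable {α : Type*} {f : ℕ} {A : ℕ → Set α}

theorem subset_gridUnion_zero (x : I) : A 0 ⊆ gridUnion 0 A x := fun a ha =>
  ⟨0, by simpa using x.2.1, by simpa using x.2.2, ha⟩

theorem gridUnion_zero_subset {x : I} (hx : x ≠ 1) : gridUnion 0 A x ⊆ A 0 := by
  rintro a ⟨j, h1, -, h3⟩
  have hx' : (x : ℝ) < 1 := unitInterval.lt_one_iff_ne_one.2 hx
  have : (j : ℝ) < 1 := by rw [pow_zero, one_mul] at h1; exact h1.trans_lt hx'
  obtain rfl : j = 0 := by
    have : j < 1 := by exact_mod_cast this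
    omega
  exact h3

theorem gridUnion_zero_one : gridUnion 0 A 1 = A 0 ∪ A 1 := by
  ext a
  constructor
  · rintro ⟨j, h1, h2, h3⟩
    have h1 : j ≤ 1 := by simpa using h1
    interval_cases j
    exacts [Or.inl h3, Or.inr h3]
  · rintro (h | h)
    exacts [⟨0, by simp, by simp, h⟩, ⟨1, by simp, by simp, h⟩]

theorem gridUnion_half₁ (x : I) : gridUnion (f + 1) A (half₁ x) = gridUnion f A x := by
  have : (2 : ℝ) ^ (f + 1) * (half₁ x : ℝ) = 2 ^ f * x := by rw [coe_half₁]; ring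
  simp only [gridUnion, this]

theorem two_pow_mul_half₂ (x : I) :
    (2 : ℝ) ^ (f + 1) * (half₂ x : ℝ) = 2 ^ f + 2 ^ f * x := by rw [coe_half₂]; ring

theorem subset_gridUnion_half₂ (x : I) :
    gridUnion f (fun j => A (j + 2 ^ f)) x ⊆ gridUnion (f + 1) A (half₂ x) := by
  rintro a ⟨j, h1, h2, h3⟩
  refine ⟨j + 2 ^ f, ?_, ?_, h3⟩ <;> rw [two_pow_mul_half₂] <;> push_cast <;> linarith

theorem gridUnion_half₂_subset {x : I} (hx : x ≠ 0) :
    gridUnion (f + 1) A (half₂ x) ⊆ gridUnion f (fun j => A (j + 2 ^ f)) x := by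
  rintro a ⟨j, h1, h2, h3⟩
  have hx' : 0 < (x : ℝ) := unitInterval.pos_iff_ne_zero.2 hx
  rw [two_pow_mul_half₂] at h1 h2
  have : 2 ^ f < j + 1 := by
    have : (2 : ℝ) ^ f < j + 1 := lt_of_lt_of_le (by simp [hx']) h2
    exact_mod_cast this
  obtain ⟨i, rfl⟩ : ∃ i, j = i + 2 ^ f := ⟨j - 2 ^ f, by omega⟩
  push_cast at h1 h2
  exact ⟨i, by linarith, by linarith, h3⟩

theorem gridUnion_half₂_zero :
    gridUnion (f + 1) A (half₂ 0) = A (2 ^ f - 1) ∪ A (2 ^ f - 1 + 1) := by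
  have h2 : 1 ≤ 2 ^ f := Nat.one_le_two_pow
  have h3 : ((2 ^ f - 1 : ℕ) : ℝ) = 2 ^ f - 1 := by push_cast [h2]; ring
  ext a
  simp only [gridUnion, Set.mem_ofPred_eq, two_pow_mul_half₂, Set.Icc.coe_zero, mul_zero, add_zero]
  constructor
  · rintro ⟨j, h1, h2, h3⟩
    have h1 : j ≤ 2 ^ f := by exact_mod_cast h1
    have h2 : 2 ^ f ≤ j + 1 := by exact_mod_cast h2
    obtain rfl | h : j = 2 ^ f - 1 ∨ j = 2 ^ f - 1 + 1 := by omega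
    · exact Or.inl h3
    · exact Or.inr (h ▸ h3)
  · rintro (h | h)
    · exact ⟨_, by rw [h3]; linarith, by rw [h3]; linarith, h⟩
    · exact ⟨_, by push_cast [h3]; linarith, by push_cast [h3]; linarith, h⟩

theorem gridUnion_half₂_anti {x y : I} (hxy : y ≤ x) (hx : (x : ℝ) < (1 / 2) ^ f) :
    gridUnion (f + 1) A (half₂ x) ⊆ gridUnion (f + 1) A (half₂ y) := by
  rintro a ⟨j, h1, h2, h3⟩
  rw [two_pow_mul_half₂] at h1 h2
  have hx : (2 : ℝ) ^ f * x < 1 := by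
    calc (2 : ℝ) ^ f * x < 2 ^ f * (1 / 2) ^ f := by gcongr
      _ = 1 := by rw [← mul_pow]; norm_num
  have hxy : (y : ℝ) ≤ x := hxy
  have h0 : 0 ≤ 2 ^ f * (y : ℝ) := mul_nonneg (by positivity) y.2.1
  have h4 : 2 ^ f * (y : ℝ) ≤ 2 ^ f * x := by gcongr
  have : j ≤ 2 ^ f := by
    have : (j : ℝ) < 2 ^ f + 1 := by linarith
    exact Nat.lt_succ_iff.1 (by exact_mod_cast this)
  have : (j : ℝ) ≤ 2 ^ f := by exact_mod_cast this
  refine ⟨j, ?_, ?_, h3⟩ <;> rw [two_pow_mul_half₂] <;> linarith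

theorem gridUnion_half₁_anti {x y : I} (hxy : y ≤ x) (hx : (x : ℝ) < (1 / 2) ^ f) :
    gridUnion (f + 1) A (half₁ (unitInterval.symm x)) ⊆
      gridUnion (f + 1) A (half₁ (unitInterval.symm y)) := by
  rw [gridUnion_half₁, gridUnion_half₁]
  rintro a ⟨j, h1, h2, h3⟩
  rw [unitInterval.coe_symm_eq] at h1 h2
  have hx : (2 : ℝ) ^ f * x < 1 := by
    calc (2 : ℝ) ^ f * x < 2 ^ f * (1 / 2) ^ f := by gcongr
      _ = 1 := by rw [← mul_pow]; norm_num
  have hxy : (y : ℝ) ≤ x := hxy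
  have h0 : 0 ≤ 2 ^ f * (y : ℝ) := mul_nonneg (by positivity) y.2.1
  have h4 : 2 ^ f * (y : ℝ) ≤ 2 ^ f * x := by gcongr
  have : 2 ^ f ≤ j + 1 := by
    have : (2 : ℝ) ^ f < j + 1 + 1 := by linarith
    exact Nat.lt_succ_iff.1 (by exact_mod_cast this)
  have : (2 : ℝ) ^ f ≤ j + 1 := by exact_mod_cast this
  refine ⟨j, ?_, ?_, h3⟩ <;> rw [unitInterval.coe_symm_eq] <;> linarith

variable {E B : Type*} [TopologicalSpace E] [TopologicalSpace B] {p : C(E, B)} {N : α → Set B}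

theorem BoxLift.grid_wall {R : Type} [TopologicalSpace R] {b : Set R} (hR : IsCube b) (f : ℕ)
    (A : ℕ → R × I → Set α) (hw : ∀ j, BoxLift p N b fun q => A j q ∪ A (j + 1) q)
    (hb : ∀ j, BoxLift p N (prodBd b) fun q => A j (q.1.1, q.2)) :
    BoxLift p N (prodBd b) fun q => gridUnion f (fun j => A j (q.1.1, q.2)) q.1.2 := by
  induction f generalizing A with
  | zero =>
    refine (hb 0).mono (fun q => subset_gridUnion_zero (A := fun j => A j (q.1.1, q.2)) _)
      fun q hq => gridUnion_zero_subset fun h => hq (Or.inr (Or.inr (Or.inr h)))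
  | succ f ih =>
    refine BoxLift.split_wall hR (μ := (1 / 2) ^ f) (by positivity)
      (pow_le_one₀ (by norm_num) (by norm_num)) (fun r t x y => gridUnion_half₁_anti)
      (fun r t x y => gridUnion_half₂_anti) ?_ ?_ ?_
    · simp only [gridUnion_half₂_zero]
      exact hw _
    · simp only [gridUnion_half₁]
      exact ih A hw hb
    · refine (ih (fun j => A (j + 2 ^ f)) (fun j => ?_) fun j => hb _).mono
        (fun q => subset_gridUnion_half₂ (A := fun j => A j (q.1.1, q.2)) _)
        fun q hq => gridUnion_half₂_subset (A := fun j => A j (q.1.1, q.2))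
          fun h => hq (Or.inr (Or.inr (Or.inl h)))
      have := hw (j + 2 ^ f)
      rwa [Nat.add_right_comm] at this

theorem BoxLift.grid_time {Q : Type} [TopologicalSpace Q] {bd : Set Q} (hQ : IsCube bd) (f : ℕ)
    (A : ℕ → Q → Set α) (hb : ∀ j < 2 ^ f, BoxLift p N bd fun q =>
      {a | a ∈ A j q.1 ∨ q.2 = 1 ∧ a ∈ A (j + 1) q.1}) :
    BoxLift p N bd fun q => gridUnion f (fun j => A j q.1) q.2 := by
  induction f generalizing A with
  | zero =>
    have := hb 0 (by simp)
    convert this using 2 with q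
    ext a
    by_cases hq : q.2 = 1
    · simp [hq, gridUnion_zero_one]
    · rw [(gridUnion_zero_subset hq).antisymm (subset_gridUnion_zero _)]
      simp [hq]
  | succ f ih =>
    refine BoxLift.split_time hQ (μ := (1 / 2) ^ f) (by positivity)
      (fun r x y => gridUnion_half₂_anti) ?_ ?_
    · simp only [gridUnion_half₁]
      exact ih A fun j hj => hb j (by rw [pow_succ]; omega)
    · refine (ih (fun j => A (j + 2 ^ f)) (fun j hj => ?_)).mono
        (fun q => subset_gridUnion_half₂ (A := fun j => A j q.1) _)
        fun q hq => gridUnion_half₂_subset (A := fun j => A j q.1) fun h => hq (Or.inl h)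
      have := hb (j + 2 ^ f) (by rw [pow_succ]; omega)
      rwa [Nat.add_right_comm] at this

/-- The union of the sets attached to the dyadic cells of side `1 / 2 ^ e` of the cube
containing `k`. -/
def cellUnion {m : ℕ} (e : ℕ) (S : (Fin m → ℕ) → Set α) (k : Fin m → I) : Set α :=
  {a | ∃ s, (∀ i, (s i : ℝ) ≤ 2 ^ e * (k i : ℝ) ∧ 2 ^ e * (k i : ℝ) ≤ s i + 1) ∧ a ∈ S s}

theorem cellUnion_union {m e : ℕ} (S S' : (Fin m → ℕ) → Set α) (k : Fin m → I) :
    (cellUnion e (fun s => S s ∪ S' s) k) = cellUnion e S k ∪ cellUnion e S' k := by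
  ext a
  simp only [cellUnion, Set.mem_ofPred_eq, mem_union, and_or_left, exists_or]

theorem mem_cellUnion_cons {m e : ℕ} {S : (Fin (m + 1) → ℕ) → Set α} {k : Fin (m + 1) → I}
    {a : α} : a ∈ cellUnion e S k ↔
      a ∈ gridUnion e (fun j => cellUnion e (fun s => S (Fin.cons j s)) fun i => k i.succ) (k 0) := by
  constructor
  · rintro ⟨s, h, ha⟩
    refine ⟨s 0, (h 0).1, (h 0).2, Fin.tail s, fun i => h i.succ, ?_⟩
    change a ∈ S (Fin.cons (s 0) (Fin.tail s))
    rwa [Fin.cons_self_tail]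
  · rintro ⟨j, h1, h2, s, h, ha⟩
    refine ⟨Fin.cons j s, fun i => ?_, ha⟩
    cases i using Fin.cases with
    | zero => exact ⟨h1, h2⟩
    | succ i => simpa using h i

/-- Splitting off the first coordinate of a cube, moving it to the end. -/
def consHomeo (m : ℕ) (Q : Type) [TopologicalSpace Q] :
    (Fin (m + 1) → I) × Q ≃ₜ ((Fin m → I) × Q) × I where
  toFun q := ((fun i => q.1 i.succ, q.2), q.1 0)
  invFun q := (Fin.cons q.2 q.1.1, q.1.2)
  left_inv q := Prod.ext (Fin.cons_self_tail q.1) rfl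
  right_inv q := by simp
  continuous_toFun := by fun_prop
  continuous_invFun := by
    refine Continuous.prodMk (continuous_pi fun i => ?_) (by fun_prop)
    cases i using Fin.cases with
    | zero => simpa using continuous_snd
    | succ i => simp only [Fin.cons_succ]; fun_prop

/-- The boundary of the product of a cube with another cube. -/
def cubeProdBd (m : ℕ) {Q : Type} (bd : Set Q) : Set ((Fin m → I) × Q) :=
  {q | q.1 ∈ Cube.boundary (Fin m) ∨ q.2 ∈ bd}

theorem isCube_cubeProdBd (m : ℕ) {Q : Type} [TopologicalSpace Q] {bd : Set Q} (h : IsCube bd) :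
    IsCube (cubeProdBd m bd) := (isCube_pi (Fin m)).prod h

theorem BoxLift.grid_cell {ok : Set α → Set α → Prop}
    (hok : ∀ V W V' W', ok V W → ok V' W' → ok (V ∪ V') (W ∪ W'))
    (H : ∀ (Q : Type) [TopologicalSpace Q] (bd : Set Q), IsCube bd → ∀ V W, ok V W →
      BoxLift p N bd fun q => {a | a ∈ V ∨ q.2 = 1 ∧ a ∈ W}) (e m : ℕ)
    (S S' : (Fin m → ℕ) → Set α) (hS : ∀ s, ok (S s) (S' s))
    (Q : Type) [TopologicalSpace Q] (bd : Set Q) (hQ : IsCube bd) :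
    BoxLift p N (cubeProdBd m bd) fun q =>
      {a | a ∈ cellUnion e S q.1.1 ∨ q.2 = 1 ∧ a ∈ cellUnion e S' q.1.1} := by
  induction m generalizing Q with
  | zero =>
    refine BoxLift.of_homeomorph (Homeomorph.uniqueProd (Fin 0 → I) Q) (bd' := bd) (fun q => ?_)
      (H Q bd hQ (S fun _ => 0) (S' fun _ => 0) (hS _)) fun q t => ?_
    · simp [cubeProdBd, Cube.boundary, Homeomorph.uniqueProd]
    · ext a
      simp only [cellUnion, IsEmpty.forall_iff, true_and, Unique.exists_iff]
      have h0 (S : (Fin 0 → ℕ) → Set α) (s s') (h : a ∈ S s) : a ∈ S s' :=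
        Subsingleton.elim s s' ▸ h
      simp only [Set.mem_ofPred_eq]
      exact or_congr ⟨h0 S _ _, h0 S _ _⟩ (and_congr_right fun _ => ⟨h0 S' _ _, h0 S' _ _⟩)
  | succ m ih =>
    have key := BoxLift.grid_wall (p := p) (N := N) (isCube_cubeProdBd m hQ) e
      (fun j q => {a | a ∈ cellUnion e (fun s => S (Fin.cons j s)) q.1.1 ∨
        q.2 = 1 ∧ a ∈ cellUnion e (fun s => S' (Fin.cons j s)) q.1.1}) (fun j => ?_) fun j => ?_
    · refine BoxLift.of_homeomorph (consHomeo m Q) (fun q => ?_) key fun q t => ?_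
      · simp only [cubeProdBd, prodBd, consHomeo, Cube.boundary, Homeomorph.homeomorph_mk_coe,
          Equiv.coe_fn_mk, Set.mem_ofPred_eq, Fin.exists_fin_succ]
        generalize (∃ i : Fin m, _) = R
        tauto
      · ext a
        simp only [Set.mem_ofPred_eq, mem_cellUnion_cons]
        simp only [gridUnion, consHomeo, Homeomorph.homeomorph_mk_coe, Equiv.coe_fn_mk,
          Set.mem_ofPred_eq]
        constructor
        · rintro (⟨j, h1, h2, h3⟩ | ⟨ht, j, h1, h2, h3⟩)
          exacts [⟨j, h1, h2, Or.inl h3⟩, ⟨j, h1, h2, Or.inr ⟨ht, h3⟩⟩]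
        · rintro ⟨j, h1, h2, h3 | ⟨ht, h3⟩⟩
          exacts [Or.inl ⟨j, h1, h2, h3⟩, Or.inr ⟨ht, j, h1, h2, h3⟩]
    · convert ih (fun s => S (Fin.cons j s) ∪ S (Fin.cons (j + 1) s))
        (fun s => S' (Fin.cons j s) ∪ S' (Fin.cons (j + 1) s))
        (fun s => hok _ _ _ _ (hS _) (hS _)) Q bd hQ using 2 with q
      ext a
      simp only [cellUnion_union, Set.mem_ofPred_eq, mem_union]
      tauto
    · refine BoxLift.of_homeomorph (Homeomorph.prodAssoc (Fin m → I) Q I) (fun q => ?_)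
        (ih (fun s => S (Fin.cons j s)) (fun s => S' (Fin.cons j s)) (fun s => hS _) (Q × I)
          (prodBd bd) hQ.prod_unitInterval) fun q t => rfl
      simp only [cubeProdBd, prodBd, Homeomorph.prodAssoc, Homeomorph.homeomorph_mk_coe,
        Equiv.prodAssoc_apply, Set.mem_ofPred_eq]
      exact (or_assoc (a := q.1.1 ∈ Cube.boundary (Fin m))).symm

/-- Lifting over a cube with a dyadic grid of constraints. -/
theorem BoxLift.grid {ok : Set α → Set α → Prop}
    (hok : ∀ V W V' W', ok V W → ok V' W' → ok (V ∪ V') (W ∪ W'))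
    (H : ∀ (Q : Type) [TopologicalSpace Q] (bd : Set Q), IsCube bd → ∀ V W, ok V W →
      BoxLift p N bd fun q => {a | a ∈ V ∨ q.2 = 1 ∧ a ∈ W}) (e f m : ℕ)
    (S : ℕ → (Fin m → ℕ) → Set α) (hS : ∀ j < 2 ^ f, ∀ s, ok (S j s) (S j s ∪ S (j + 1) s)) :
    BoxLift p N (Cube.boundary (Fin m)) fun q =>
      gridUnion f (fun j => cellUnion e (S j) q.1) q.2 := by
  refine BoxLift.grid_time (isCube_pi _) f (fun j k => cellUnion e (S j) k) fun j hj => ?_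
  refine BoxLift.of_homeomorph (Homeomorph.prodUnique (Fin m → I) (Fin 0 → I)).symm
    (fun q => ?_) (BoxLift.grid_cell hok H e m (S j) (fun s => S j s ∪ S (j + 1) s) (hS j hj)
      (Fin 0 → I) _ (isCube_pi _)) fun q t => ?_
  · simp [cubeProdBd, Cube.boundary, Homeomorph.prodUnique]
  · ext a
    simp only [cellUnion_union, Set.mem_ofPred_eq, mem_union]
    tauto

end Grid

/-! ### Configurations of labelled particles with a vanishing weight -/

section Cfg

variable {M L : Type*}

/-- Finite configurations of labelled particles in `D` with pairwise distinct positions and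
positive weight; particles disappear when their weight becomes `0`. -/
structure Cfg (w : M × L → ℝ) (D : Set (M × L)) where
  carrier : Set (M × L)
  finite : carrier.Finite
  mem_dom : ∀ y ∈ carrier, y ∈ D
  pos : ∀ y ∈ carrier, 0 < w y
  inj : ∀ y ∈ carrier, ∀ z ∈ carrier, y.1 = z.1 → y = z

namespace Cfg

variable {w w' w₁ w₂ : M × L → ℝ} {D D' D₁ D₂ : Set (M × L)}

instance : Membership (M × L) (Cfg w D) := ⟨fun s y => y ∈ s.carrier⟩

theorem ext {s t : Cfg w D} (h : ∀ y, y ∈ s ↔ y ∈ t) : s = t := by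
  cases s; cases t
  congr
  exact Set.ext h

instance : EmptyCollection (Cfg w D) :=
  ⟨⟨∅, finite_empty, fun _ h => h.elim, fun _ h => h.elim, fun _ h => h.elim⟩⟩

theorem notMem_empty (y : M × L) : y ∉ (∅ : Cfg w D) := fun h => h

/-- `t` is close to `s`: particles of `t` match those of `s` up to light particles. -/
def Near (s : Cfg w D) (N : M × L → Set (M × L)) (δ : ℝ) (t : Cfg w D) : Prop :=
  ∃ φ : M × L → M × L, (∀ y ∈ s, φ y ∈ t ∧ φ y ∈ N y) ∧ InjOn φ s.carrier ∧
    ∀ z ∈ t, z ∉ φ '' s.carrier → w z < δ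

theorem Near.mono {s t : Cfg w D} {N N' : M × L → Set (M × L)} {δ δ' : ℝ} (h : s.Near N δ t)
    (hN : ∀ y ∈ s, N y ⊆ N' y) (hδ : δ ≤ δ') : s.Near N' δ' t := by
  obtain ⟨φ, h1, h2, h3⟩ := h
  exact ⟨φ, fun y hy => ⟨(h1 y hy).1, hN y hy (h1 y hy).2⟩, h2,
    fun z hz hz' => (h3 z hz hz').trans_le hδ⟩

variable [TopologicalSpace M] [TopologicalSpace L]

theorem near_self (s : Cfg w D) {N : M × L → Set (M × L)} (hN : ∀ y ∈ s, N y ∈ 𝓝 y) (δ : ℝ) :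
    s.Near N δ s :=
  ⟨id, fun y hy => ⟨hy, mem_of_mem_nhds (hN y hy)⟩, injOn_id _,
    fun z hz hz' => (hz' ⟨z, hz, rfl⟩).elim⟩

instance : TopologicalSpace (Cfg w D) where
  IsOpen U := ∀ s ∈ U, ∃ N δ, (∀ y ∈ s, N y ∈ 𝓝 y) ∧ 0 < δ ∧ ∀ t : Cfg w D, s.Near N δ t → t ∈ U
  isOpen_univ := fun _ _ => ⟨fun _ => univ, 1, fun _ _ => Filter.univ_mem, one_pos,
    fun _ _ => mem_univ _⟩
  isOpen_inter := by
    rintro U V hU hV s ⟨hsU, hsV⟩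
    obtain ⟨N, δ, hN, hδ, h⟩ := hU s hsU
    obtain ⟨N', δ', hN', hδ', h'⟩ := hV s hsV
    exact ⟨fun y => N y ∩ N' y, min δ δ', fun y hy => Filter.inter_mem (hN y hy) (hN' y hy),
      lt_min hδ hδ', fun t ht => ⟨h t (ht.mono (fun _ _ => inter_subset_left) (min_le_left _ _)),
        h' t (ht.mono (fun _ _ => inter_subset_right) (min_le_right _ _))⟩⟩
  isOpen_sUnion := by
    rintro S hS s ⟨U, hU, hs⟩
    obtain ⟨N, δ, hN, hδ, h⟩ := hS U hU s hs
    exact ⟨N, δ, hN, hδ, fun t ht => ⟨U, hU, h t ht⟩⟩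

theorem near_mem_nhds (hw : Continuous w) {s : Cfg w D} {N : M × L → Set (M × L)} {δ : ℝ}
    (hN : ∀ y ∈ s, N y ∈ 𝓝 y) (hδ : 0 < δ) : ∀ᶠ t in 𝓝 s, s.Near N δ t := by
  refine mem_nhds_iff.2 ⟨{t | s.Near (fun y => interior (N y)) δ t}, fun t ht =>
    ht.mono (fun _ _ => interior_subset) le_rfl, ?_,
    near_self s (fun y hy => interior_mem_nhds.2 (hN y hy)) δ⟩
  rintro t ⟨φ, h1, h2, h3⟩
  refine ⟨fun z => {p | (∀ y ∈ s, φ y = z → p ∈ interior (N y)) ∧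
    (z ∉ φ '' s.carrier → w p < δ)}, δ, fun z hz => ?_, hδ, ?_⟩
  · refine Filter.Eventually.and ?_ ?_
    · refine (Filter.eventually_all_finite s.finite).2 fun y hy => ?_
      by_cases hyz : φ y = z
      · filter_upwards [isOpen_interior.mem_nhds (hyz ▸ (h1 y hy).2)] with p hp _ using hp
      · exact Filter.Eventually.of_forall fun p h => (hyz h).elim
    · by_cases hz' : z ∈ φ '' s.carrier
      · exact Filter.Eventually.of_forall fun p h => (h hz').elim
      · filter_upwards [hw.continuousAt.eventually_lt_const (h3 z hz hz')] with p hp _ using hp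
  · rintro r ⟨ψ, g1, g2, g3⟩
    refine ⟨ψ ∘ φ, fun y hy => ⟨(g1 _ (h1 y hy).1).1, (g1 _ (h1 y hy).1).2.1 y hy rfl⟩,
      g2.comp h2 fun y hy => (h1 y hy).1, fun z hz hz' => ?_⟩
    by_cases hzt : z ∈ ψ '' t.carrier
    · obtain ⟨x, hx, rfl⟩ := hzt
      refine (g1 x hx).2.2 fun hx' => hz' ?_
      obtain ⟨y, hy, rfl⟩ := hx'
      exact ⟨y, hy, rfl⟩
    · exact g3 z hz hzt

theorem tendsto_nhds_of_near {Z : Type*} {l : Filter Z} {g : Z → Cfg w D} {s : Cfg w D}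
    (h : ∀ N δ, (∀ y ∈ s, N y ∈ 𝓝 y) → 0 < δ → ∀ᶠ z in l, s.Near N δ (g z)) :
    Filter.Tendsto g l (𝓝 s) := by
  intro U hU
  obtain ⟨V, hVU, hV, hs⟩ := mem_nhds_iff.1 hU
  obtain ⟨N, δ, hN, hδ, hN'⟩ := hV s hs
  change ∀ᶠ z in l, g z ∈ U
  filter_upwards [h N δ hN hδ] with z hz using hVU (hN' _ hz)

/-- The main criterion for the continuity of operations moving particles. -/
theorem tendsto_map (hw : Continuous w) (hw' : Continuous w') {Z : Type*} {l : Filter Z}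
    {g : Z → Cfg w D} {s : Cfg w D} (hg : Filter.Tendsto g l (𝓝 s)) {h : Z → Cfg w' D'}
    {s' : Cfg w' D'} (θ : Z → M × L → M × L) (θ₀ : M × L → M × L) (R : Set (M × L))
    (hh : ∀ᶠ z in l, ∀ y', y' ∈ h z ↔ 0 < w' y' ∧ ∃ y ∈ g z, y ∈ R ∧ θ z y = y')
    (hs : ∀ y', y' ∈ s' ↔ 0 < w' y' ∧ ∃ y ∈ s, y ∈ R ∧ θ₀ y = y')
    (hθ : ∀ y ∈ s, y ∈ R → Filter.Tendsto (fun q : Z × (M × L) => θ q.1 q.2) (l ×ˢ 𝓝 y)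
      (𝓝 (θ₀ y)))
    (hR : ∀ y ∈ s, ∀ᶠ x in 𝓝 y, x ∈ R ↔ y ∈ R)
    (hsmall : ∀ ε > 0, ∃ δ > 0, ∀ᶠ z in l, ∀ y ∈ g z, y ∈ R → w y < δ → w' (θ z y) < ε)
    (hinj : ∀ᶠ z in l, ∀ y ∈ g z, ∀ x ∈ g z, y ∈ R → x ∈ R → θ z y = θ z x → y = x)
    (hinj₀ : ∀ y ∈ s, ∀ x ∈ s, y ∈ R → x ∈ R → θ₀ y = θ₀ x → y = x) :
    Filter.Tendsto h l (𝓝 s') := by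
  classical
  refine tendsto_nhds_of_near fun N' δ' hN' hδ' => ?_
  obtain ⟨δ, hδ, hsm⟩ := hsmall δ' hδ'
  have key : ∀ y ∈ s, ∃ U ∈ 𝓝 y, ∀ᶠ z in l, ∀ p ∈ U, y ∈ R →
      (0 < w' (θ₀ y) → θ z p ∈ N' (θ₀ y) ∧ 0 < w' (θ z p)) ∧
      (¬ 0 < w' (θ₀ y) → w' (θ z p) < δ') := by
    intro y hy
    by_cases hyR : y ∈ R
    · have : ∀ᶠ x in 𝓝 (θ₀ y), (0 < w' (θ₀ y) → x ∈ N' (θ₀ y) ∧ 0 < w' x) ∧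
          (¬ 0 < w' (θ₀ y) → w' x < δ') := by
        by_cases h0 : 0 < w' (θ₀ y)
        · filter_upwards [hN' _ ((hs _).2 ⟨h0, y, hy, hyR, rfl⟩),
            hw'.continuousAt.eventually_const_lt h0] with x h1 h2
          exact ⟨fun _ => ⟨h1, h2⟩, fun h => (h h0).elim⟩
        · filter_upwards [hw'.continuousAt.eventually_lt_const ((not_lt.1 h0).trans_lt hδ')]
            with x h1
          exact ⟨fun h => (h0 h).elim, fun _ => h1⟩
      obtain ⟨pa, ha, pb, hb, hab⟩ := Filter.eventually_prod_iff.1 ((hθ y hy hyR).eventually this)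
      refine ⟨{x | pb x}, hb, ?_⟩
      filter_upwards [ha] with z hz p hp _ using hab hz hp
    · exact ⟨univ, Filter.univ_mem, Filter.Eventually.of_forall fun z p _ h => (hyR h).elim⟩
  choose! U hU hUl using key
  have hgN := hg.eventually (near_mem_nhds hw (s := s)
    (N := fun y => {x | x ∈ U y ∧ (x ∈ R ↔ y ∈ R)})
    (fun y hy => Filter.inter_mem (hU y hy) (hR y hy)) hδ)
  have hall := (Filter.eventually_all_finite s.finite).2 hUl
  filter_upwards [hgN, hall, hsm, hh, hinj] with z hz hUz hsmz hhz hinjz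
  obtain ⟨φ, h1, h2, h3⟩ := hz
  have hc : ∀ y' ∈ s', ∃ y ∈ s, y ∈ R ∧ θ₀ y = y' := fun y' hy' => ((hs y').1 hy').2
  choose! c hcs hcR hcθ using hc
  have hpos : ∀ y' ∈ s', 0 < w' (θ₀ (c y')) := fun y' hy' => by
    rw [hcθ y' hy']; exact s'.pos y' hy'
  have hφR : ∀ y ∈ s, φ y ∈ R ↔ y ∈ R := fun y hy => (h1 y hy).2.2
  refine ⟨fun y' => θ z (φ (c y')), fun y' hy' => ?_, fun y' hy' x' hx' he => ?_,
    fun x' hx' hx'' => ?_⟩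
  · have hb := (hUz _ (hcs y' hy') _ (h1 _ (hcs y' hy')).2.1 (hcR y' hy')).1 (hpos y' hy')
    rw [hcθ y' hy'] at hb
    exact ⟨(hhz _).2 ⟨hb.2, _, (h1 _ (hcs y' hy')).1, (hφR _ (hcs y' hy')).2 (hcR y' hy'), rfl⟩,
      hb.1⟩
  · have := hinjz _ (h1 _ (hcs y' hy')).1 _ (h1 _ (hcs x' hx')).1
      ((hφR _ (hcs y' hy')).2 (hcR y' hy')) ((hφR _ (hcs x' hx')).2 (hcR x' hx')) he
    rw [← hcθ y' hy', ← hcθ x' hx', h2 (hcs y' hy') (hcs x' hx') this]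
  · obtain ⟨hx0, x, hx, hxR, rfl⟩ := (hhz x').1 hx'
    by_cases hxφ : x ∈ φ '' s.carrier
    · obtain ⟨y, hy, rfl⟩ := hxφ
      have hyR := (hφR y hy).1 hxR
      have hb := hUz y hy _ (h1 y hy).2.1 hyR
      by_cases h0 : 0 < w' (θ₀ y)
      · have hys' : θ₀ y ∈ s' := (hs _).2 ⟨h0, y, hy, hyR, rfl⟩
        refine (hx'' ⟨θ₀ y, hys', ?_⟩).elim
        change θ z (φ (c (θ₀ y))) = _
        rw [hinj₀ _ (hcs _ hys') _ hy (hcR _ hys') hyR (hcθ _ hys')]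
      · exact hb.2 h0
    · exact hsmz x hx hxR (h3 x hx hxφ)

/-- The configuration obtained by moving all particles, dropping those which lose their
weight. -/
def map (w' : M × L → ℝ) (D' : Set (M × L)) (θ : M × L → M × L)
    (hinj : ∀ y x, (θ y).1 = (θ x).1 → y.1 = x.1)
    (hD : ∀ y ∈ D, 0 < w y → 0 < w' (θ y) → θ y ∈ D') (s : Cfg w D) : Cfg w' D' where
  carrier := {y' | 0 < w' y' ∧ ∃ y ∈ s, θ y = y'}
  finite := (s.finite.image θ).subset fun _ h => h.2
  mem_dom := by
    rintro _ ⟨h, y, hy, rfl⟩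
    exact hD y (s.mem_dom y hy) (s.pos y hy) h
  pos := fun _ h => h.1
  inj := by
    rintro _ ⟨h, y, hy, rfl⟩ _ ⟨h', x, hx, rfl⟩ he
    rw [s.inj y hy x hx (hinj y x he)]

/-- A family of operations moving all particles is continuous. -/
theorem continuous_map (hw : Continuous w) (hw' : Continuous w') {Z : Type*} [TopologicalSpace Z]
    (θ : Z → M × L → M × L) (hθ : Continuous fun q : Z × (M × L) => θ q.1 q.2)
    (hinj : ∀ z y x, (θ z y).1 = (θ z x).1 → y.1 = x.1)
    (hD : ∀ z, ∀ y ∈ D, 0 < w y → 0 < w' (θ z y) → θ z y ∈ D')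
    (hsmall : ∀ z y, y ∈ D → w' (θ z y) ≤ w y) :
    Continuous fun q : Cfg w D × Z => q.1.map w' D' (θ q.2) (hinj q.2) (hD q.2) := by
  refine continuous_iff_continuousAt.2 fun ⟨s, z⟩ => ?_
  refine tendsto_map hw hw' (g := Prod.fst) continuous_fst.continuousAt
    (fun q => θ q.2) (θ z) univ (Filter.Eventually.of_forall fun q y' => ?_) (fun y' => ?_)
    (fun y _ _ => ?_) (fun _ _ => by simp) (fun ε hε => ⟨ε, hε, Filter.Eventually.of_forall
      fun q y hy _ h => (hsmall q.2 y (q.1.mem_dom y hy)).trans_lt h⟩)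
    (Filter.Eventually.of_forall fun q y hy x hx _ _ he => ?_) fun y hy x hx _ _ he => ?_
  · simp only [mem_univ, true_and]; rfl
  · simp only [mem_univ, true_and]; rfl
  · have h1 : ContinuousAt (fun q : (Cfg w D × Z) × (M × L) => θ q.1.2 q.2) ((s, z), y) :=
      (hθ.comp (by fun_prop : Continuous fun q : (Cfg w D × Z) × (M × L) =>
        (q.1.2, q.2))).continuousAt
    rwa [ContinuousAt, nhds_prod_eq] at h1
  · exact q.1.inj y hy x hx (hinj _ _ _ (congrArg Prod.fst he))
  · exact s.inj y hy x hx (hinj _ _ _ (congrArg Prod.fst he))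

/-- The particles of a configuration lying in a region. -/
def cut (w' : M × L → ℝ) (D' R : Set (M × L)) (h : ∀ y ∈ D, y ∈ R → 0 < w' y → y ∈ D')
    (s : Cfg w D) : Cfg w' D' where
  carrier := {y | 0 < w' y ∧ y ∈ s ∧ y ∈ R}
  finite := s.finite.subset fun _ h => h.2.1
  mem_dom := fun y hy => h y (s.mem_dom y hy.2.1) hy.2.2 hy.1
  pos := fun _ h => h.1
  inj := fun y hy x hx => s.inj y hy.2.1 x hx.2.1

theorem tendsto_cut (hw : Continuous w) (hw' : Continuous w') {Z : Type*} {l : Filter Z}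
    {g : Z → Cfg w D} {s : Cfg w D} (hg : Filter.Tendsto g l (𝓝 s)) (R : Set (M × L))
    (h : ∀ y ∈ D, y ∈ R → 0 < w' y → y ∈ D')
    (hR : ∀ y ∈ s, ∀ᶠ x in 𝓝 y, x ∈ R ↔ y ∈ R)
    (hsmall : ∀ ε > 0, ∃ δ > 0, ∀ y ∈ D, y ∈ R → w y < δ → w' y < ε) :
    Filter.Tendsto (fun z => (g z).cut w' D' R h) l (𝓝 (s.cut w' D' R h)) := by
  refine tendsto_map hw hw' hg (fun _ => id) id R (Filter.Eventually.of_forall fun q y' => ?_)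
    (fun y' => ?_) (fun y _ _ => Filter.tendsto_snd) hR (fun ε hε => ?_)
    (Filter.Eventually.of_forall fun q y hy x hx _ _ he => he) fun y hy x hx _ _ he => he
  · exact ⟨fun h => ⟨h.1, y', h.2.1, h.2.2, rfl⟩,
      by rintro ⟨h, y, hy, hyR, rfl⟩; exact ⟨h, hy, hyR⟩⟩
  · exact ⟨fun h => ⟨h.1, y', h.2.1, h.2.2, rfl⟩,
      by rintro ⟨h, y, hy, hyR, rfl⟩; exact ⟨h, hy, hyR⟩⟩
  · obtain ⟨δ, hδ, h⟩ := hsmall ε hε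
    exact ⟨δ, hδ, Filter.Eventually.of_forall fun z y hy => h y ((g z).mem_dom y hy)⟩

/-- The union of configurations with disjoint positions. -/
def union (w : M × L → ℝ) (D : Set (M × L)) (h₁ : ∀ y ∈ D₁, 0 < w₁ y → 0 < w y ∧ y ∈ D)
    (h₂ : ∀ y ∈ D₂, 0 < w₂ y → 0 < w y ∧ y ∈ D) (h : ∀ y ∈ D₁, ∀ x ∈ D₂, y.1 ≠ x.1)
    (s : Cfg w₁ D₁) (t : Cfg w₂ D₂) : Cfg w D where
  carrier := {y | y ∈ s ∨ y ∈ t}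
  finite := s.finite.union t.finite
  mem_dom := by
    rintro y (hy | hy)
    exacts [(h₁ y (s.mem_dom y hy) (s.pos y hy)).2, (h₂ y (t.mem_dom y hy) (t.pos y hy)).2]
  pos := by
    rintro y (hy | hy)
    exacts [(h₁ y (s.mem_dom y hy) (s.pos y hy)).1, (h₂ y (t.mem_dom y hy) (t.pos y hy)).1]
  inj := by
    rintro y (hy | hy) x (hx | hx) he
    exacts [s.inj y hy x hx he, (h y (s.mem_dom y hy) x (t.mem_dom x hx) he).elim,
      (h x (s.mem_dom x hx) y (t.mem_dom y hy) he.symm).elim, t.inj y hy x hx he]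

theorem continuous_union (hw₁ : Continuous w₁) (hw₂ : Continuous w₂)
    (h₁ : ∀ y ∈ D₁, 0 < w₁ y → 0 < w y ∧ y ∈ D)
    (h₂ : ∀ y ∈ D₂, 0 < w₂ y → 0 < w y ∧ y ∈ D) (h : ∀ y ∈ D₁, ∀ x ∈ D₂, y.1 ≠ x.1)
    (h₁' : ∀ y ∈ D₁, w y ≤ w₁ y) (h₂' : ∀ y ∈ D₂, w y ≤ w₂ y) :
    Continuous fun q : Cfg w₁ D₁ × Cfg w₂ D₂ => union w D h₁ h₂ h q.1 q.2 := by
  classical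
  refine continuous_iff_continuousAt.2 fun ⟨s, t⟩ => ?_
  refine tendsto_nhds_of_near fun N δ hN hδ => ?_
  have e1 := (continuous_fst.tendsto (s, t)).eventually
    (near_mem_nhds hw₁ (s := s) (N := N) (fun y hy => hN y (Or.inl hy)) hδ)
  have e2 := (continuous_snd.tendsto (s, t)).eventually
    (near_mem_nhds hw₂ (s := t) (N := N) (fun y hy => hN y (Or.inr hy)) hδ)
  filter_upwards [e1, e2] with q hq1 hq2
  obtain ⟨φ, a1, a2, a3⟩ := hq1
  obtain ⟨ψ, b1, b2, b3⟩ := hq2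
  have hst : ∀ y ∈ s, y ∉ t := fun y hy hy' => h y (s.mem_dom y hy) y (t.mem_dom y hy') rfl
  have hne : ∀ y ∈ s, ∀ x ∈ t, φ y ≠ ψ x := fun y hy x hx he =>
    h _ (q.1.mem_dom _ (a1 y hy).1) _ (q.2.mem_dom _ (b1 x hx).1) (congrArg Prod.fst he)
  obtain ⟨χ, e1, e2⟩ : ∃ χ : M × L → M × L, (∀ y ∈ s, χ y = φ y) ∧ ∀ y ∈ t, χ y = ψ y :=
    ⟨fun y => if y ∈ s then φ y else ψ y, fun y hy => if_pos hy,
      fun y hy => if_neg fun h => hst y h hy⟩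
  refine ⟨χ, ?_, ?_, ?_⟩
  · rintro y (hy | hy)
    · rw [e1 y hy]
      exact ⟨Or.inl (a1 y hy).1, (a1 y hy).2⟩
    · rw [e2 y hy]
      exact ⟨Or.inr (b1 y hy).1, (b1 y hy).2⟩
  · rintro y (hy | hy) x (hx | hx) he
    · rw [e1 y hy, e1 x hx] at he
      exact a2 hy hx he
    · rw [e1 y hy, e2 x hx] at he
      exact (hne y hy x hx he).elim
    · rw [e2 y hy, e1 x hx] at he
      exact (hne x hx y hy he.symm).elim
    · rw [e2 y hy, e2 x hx] at he
      exact b2 hy hx he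
  · rintro z (hz | hz) hz'
    · refine (h₁' z (q.1.mem_dom z hz)).trans_lt (a3 z hz fun ⟨y, hy, he⟩ => hz' ?_)
      exact ⟨y, Or.inl hy, (e1 y hy).trans he⟩
    · refine (h₂' z (q.2.mem_dom z hz)).trans_lt (b3 z hz fun ⟨y, hy, he⟩ => hz' ?_)
      exact ⟨y, Or.inr hy, (e2 y hy).trans he⟩

/-- The configuration of the particles of a finite family having positive weight. -/
def ofFamily {ι : Type*} [Finite ι] (w : M × L → ℝ) (D : Set (M × L)) (y : ι → M × L)
    (hy : ∀ i j, (y i).1 = (y j).1 → y i = y j) (hD : ∀ i, 0 < w (y i) → y i ∈ D) : Cfg w D where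
  carrier := {x | 0 < w x ∧ ∃ i, y i = x}
  finite := (finite_range y).subset fun _ h => h.2
  mem_dom := by rintro _ ⟨h, i, rfl⟩; exact hD i h
  pos := fun _ h => h.1
  inj := by rintro _ ⟨_, i, rfl⟩ _ ⟨_, j, rfl⟩ he; exact hy i j he

theorem continuous_ofFamily {ι Z : Type*} [Finite ι] [TopologicalSpace Z] (hw : Continuous w)
    (y : Z → ι → M × L) (hc : ∀ i, Continuous fun z => y z i)
    (hy : ∀ z i j, (y z i).1 = (y z j).1 → i = j) (hD : ∀ z i, 0 < w (y z i) → y z i ∈ D) :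
    Continuous fun z => ofFamily w D (y z) (fun i j h => congrArg (y z) (hy z i j h)) (hD z) := by
  refine continuous_iff_continuousAt.2 fun z => tendsto_nhds_of_near fun N δ hN hδ => ?_
  have h1 : ∀ᶠ z' in 𝓝 z, ∀ i, 0 < w (y z i) → y z' i ∈ N (y z i) ∧ 0 < w (y z' i) := by
    refine Filter.eventually_all.2 fun i => ?_
    by_cases h0 : 0 < w (y z i)
    · filter_upwards [(hc i).continuousAt (hN _ ⟨h0, i, rfl⟩),
        (hw.comp (hc i)).continuousAt.eventually_const_lt h0] with z' h1 h2 _ using ⟨h1, h2⟩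
    · exact Filter.Eventually.of_forall fun z' h => (h0 h).elim
  have h2 : ∀ᶠ z' in 𝓝 z, ∀ i, ¬ 0 < w (y z i) → w (y z' i) < δ := by
    refine Filter.eventually_all.2 fun i => ?_
    by_cases h0 : 0 < w (y z i)
    · exact Filter.Eventually.of_forall fun z' h => (h h0).elim
    · filter_upwards [(hw.comp (hc i)).continuousAt.eventually_lt_const
        ((not_lt.1 h0).trans_lt hδ)] with z' h1 _ using h1
  filter_upwards [h1, h2] with z' h1 h2
  have hidx : ∀ x, (∃ i, y z i = x) → ∃ i, y z i = x ∧ ∀ j, y z j = x → j = i := by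
    rintro _ ⟨i, rfl⟩
    exact ⟨i, rfl, fun j hj => hy z j i (congrArg Prod.fst hj)⟩
  by_cases hne : Nonempty ι
  swap
  · exact ⟨id, fun x hx => (hne ⟨hx.2.choose⟩).elim, injOn_id _,
      fun x hx => (hne ⟨hx.2.choose⟩).elim⟩
  choose! c hc1 hc2 using hidx
  have hcy (i : ι) : c (y z i) = i := (hc2 _ ⟨i, rfl⟩ i rfl).symm
  refine ⟨fun x => y z' (c x), ?_, ?_, ?_⟩
  · rintro _ ⟨h0, i, rfl⟩
    simp only [hcy]
    exact ⟨⟨(h1 i h0).2, i, rfl⟩, (h1 i h0).1⟩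
  · rintro _ ⟨h0, i, rfl⟩ _ ⟨h0', j, rfl⟩ he
    simp only [hcy] at he
    rw [hy z' i j (congrArg Prod.fst he)]
  · rintro _ ⟨h0, i, rfl⟩ hx
    refine h2 i fun h => hx ⟨y z i, ⟨h, i, rfl⟩, ?_⟩
    simp only [hcy]

end Cfg

end Cfg

/-- Lifting over a box in the presence of a decomposition of the total space and of the base
space: the top of the lift and of the homotopy is obtained by adding the given part `c`. -/
theorem IsCube.exists_lift_of_decomposition {K : Type} [TopologicalSpace K] {bd : Set K}
    (hK : IsCube bd) {X Y XT YT F : Type*} [TopologicalSpace X] [TopologicalSpace Y]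
    [TopologicalSpace XT] [TopologicalSpace YT] [TopologicalSpace F] (uX : C(XT × F, X))
    (uY : C(YT × F, Y)) (p : C(X, Y)) (pT : C(XT, YT)) (hp : ∀ d c, p (uX (d, c)) = uY (pT d, c))
    (o : F) (hι : HasW (uX.comp ⟨fun d => (d, o), by fun_prop⟩))
    (H : C(I × Y, Y)) (y₀ : Y) (H0 : ∀ y, H (0, y) = y) (H1 : ∀ y, H (1, y) = y₀)
    (HT : C(I × YT, YT)) (yT : YT) (HT0 : ∀ y, HT (0, y) = y) (HT1 : ∀ y, HT (1, y) = yT)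
    (c : C(K × I, F)) (hc : ∀ k, c (k, 1) = o) (β : C(K × I, Y)) (g : K × I → X)
    (hg : ContinuousOn g (boxJ bd)) (hpg : ∀ q ∈ boxJ bd, p (g q) = β q) (b : C(K, YT))
    (hb : ∀ k, β (k, 1) = uY (b k, c (k, 0))) (d : K → XT) (hd : ContinuousOn d bd)
    (hgd : ∀ k ∈ bd, g (k, 1) = uX (d k, c (k, 0))) (hbd : ∀ k ∈ bd, pT (d k) = b k) :
    ∃ (Λ : C(K × I, X)) (Φ : C((K × I) × I, Y)), EqOn Λ g (boxJ bd) ∧ (∀ q, Φ (q, 0) = β q) ∧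
      (∀ q, Φ (q, 1) = p (Λ q)) ∧ (∀ q ∈ boxJ bd, ∀ v, Φ (q, v) = β q) ∧
      ∀ k v, ∃ b', Φ ((k, 1), v) = uY (b', c (k, 0)) := by
  classical
  obtain ⟨Λ', hΛ', -⟩ := hK.exists_extend_box hg
  obtain ⟨N, N0, Nb, -⟩ := hK.hep ⟨fun k => Λ' (k, 1), by fun_prop⟩
    (h := fun q => uX (d q.1, c q)) (uX.continuous.comp_continuousOn
      ((hd.comp continuousOn_fst fun q hq => hq.1).prodMk c.continuous.continuousOn))
    (fun k hk => by simp [← hgd k hk, hΛ' (Or.inr hk : (k, (1 : I)) ∈ boxJ bd)])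
  obtain ⟨D, hD, ⟨R⟩⟩ := hι K bd hK ⟨fun k => N (k, 1), by fun_prop⟩ d hd
    (fun k hk => by simp [Nb k hk, hc])
  have hrel := hK.homotopicRel_of_faces N ⟨fun q => uX (D q.1, c q), by fun_prop⟩
    ⟨fun q => R (q.2, q.1), by fun_prop⟩ ⟨fun k => Λ' (k, 1), by fun_prop⟩
    ⟨fun k => uX (D k, c (k, 0)), by fun_prop⟩ (by simpa using N0) (fun _ => rfl)
    (fun k hk t => by simp [Nb k hk, hD hk]) (fun k hk t => by simp [R.eq_fst t hk])
    (fun k => by simp) (fun k => by simp [hc])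
  obtain ⟨Λ, hΛ, hΛ1⟩ := hK.exists_replace_top Λ' _ _ (fun _ => rfl) hrel
  have hΛg : EqOn Λ g (boxJ bd) := hΛ.trans hΛ'
  obtain ⟨T, T0, T1, Tb⟩ := hK.exists_homotopy_contractible HT yT HT0 HT1 b (pT.comp D)
    (h := fun q => b q.1) (by fun_prop) (fun _ _ => rfl)
    (fun k hk => by simp [hD hk, hbd k hk])
  let h : (K × I) × I → Y := fun q => if q.1.2 = 1 then uY (T (q.1.1, q.2), c (q.1.1, 0)) else β q.1
  have h1 : ∀ k v, h ((k, 1), v) = uY (T (k, v), c (k, 0)) := fun k v => by simp [h]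
  have hJ : ∀ q ∈ boxJ bd, ∀ v, h (q, v) = β q := by
    rintro ⟨k, t⟩ hq v
    by_cases ht : t = 1
    · subst ht
      rcases hq with hq | hq
      · simp at hq
      · rw [h1, Tb k hq, hb]
    · simp [h, ht]
  have hcont : ContinuousOn h (prodBd bd ×ˢ univ) := by
    have e : (prodBd bd ×ˢ univ : Set ((K × I) × I)) =
        (boxJ bd ×ˢ univ) ∪ ((univ : Set K) ×ˢ {(1 : I)}) ×ˢ univ := by
      ext ⟨⟨k, t⟩, v⟩
      simp only [prodBd, boxJ, mem_prod, mem_union, Set.mem_ofPred_eq, mem_univ, and_true,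
        true_and, mem_singleton_iff]
      tauto
    rw [e]
    refine ContinuousOn.union_of_isClosed ?_ ?_ (hK.isClosed_boxJ.prod isClosed_univ)
      ((isClosed_univ.prod isClosed_singleton).prod isClosed_univ)
    · exact (β.continuous.comp continuous_fst).continuousOn.congr fun q hq => hJ q.1 hq.1 q.2
    · refine (by fun_prop : Continuous fun q : (K × I) × I =>
        uY (T (q.1.1, q.2), c (q.1.1, 0))).continuousOn.congr ?_
      rintro ⟨⟨k, t⟩, v⟩ ⟨⟨-, rfl : t = 1⟩, -⟩
      exact h1 k v
  have e0 : ∀ q ∈ prodBd bd, h (q, 0) = β q := fun q hq => by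
    by_cases hq1 : q.2 = 1
    · obtain ⟨k, t⟩ := q
      obtain rfl : t = 1 := hq1
      rw [h1, T0, hb]
    · exact hJ q (hq.elim Or.inr fun h => h.elim Or.inl fun h => (hq1 h).elim) 0
  have e1 : ∀ q ∈ prodBd bd, h (q, 1) = p.comp Λ q := fun q hq => by
    by_cases hq1 : q.2 = 1
    · obtain ⟨k, t⟩ := q
      obtain rfl : t = 1 := hq1
      rw [h1, T1]
      simp [hΛ1, hp]
    · have hqJ : q ∈ boxJ bd := hq.elim Or.inr fun h => h.elim Or.inl fun h => (hq1 h).elim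
      rw [hJ q hqJ]
      simp [hΛg hqJ, hpg q hqJ]
  obtain ⟨Φ, Φ0, Φ1, Φb⟩ := hK.prod_unitInterval.exists_homotopy_contractible H y₀ H0 H1 β
    (p.comp Λ) hcont e0 e1
  refine ⟨Λ, Φ, hΛg, Φ0, Φ1, fun q hq v => ?_, fun k v => ⟨T (k, v), ?_⟩⟩
  · rw [Φb q ?_ v, hJ q hq]
    exact hq.elim (fun h => Or.inr (Or.inl h)) Or.inl
  · rw [Φb _ (Or.inr (Or.inr rfl)) v, h1]

/-! ### Configurations in Euclidean space with a distinguished height coordinate -/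

section Height

variable {n : ℕ} {L : Type*}

/-- Change the height of a particle, i.e. its `k`-th coordinate. -/
def hmap (k : Fin n) (f : ℝ → ℝ) (y : (Fin n → ℝ) × L) : (Fin n → ℝ) × L :=
  (Function.update y.1 k (f (y.1 k)), y.2)

/-- The particles with height in `J` and other coordinates in the unit interval. -/
def slab (L : Type*) (k : Fin n) (J : Set ℝ) : Set ((Fin n → ℝ) × L) :=
  {y | (∀ i ≠ k, y.1 i ∈ Icc (0 : ℝ) 1) ∧ y.1 k ∈ J}

/-- The particles in the unit cube. -/
def cube (n : ℕ) (L : Type*) : Set ((Fin n → ℝ) × L) := {y | ∀ i, y.1 i ∈ Icc (0 : ℝ) 1}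

variable {k : Fin n}

theorem hmap_height (f : ℝ → ℝ) (y : (Fin n → ℝ) × L) : (hmap k f y).1 k = f (y.1 k) := by
  simp [hmap]

theorem hmap_other (f : ℝ → ℝ) (y : (Fin n → ℝ) × L) {i : Fin n} (hi : i ≠ k) :
    (hmap k f y).1 i = y.1 i := by
  simp [hmap, hi]

theorem hmap_of_eq {f : ℝ → ℝ} {y : (Fin n → ℝ) × L} (h : f (y.1 k) = y.1 k) : hmap k f y = y := by
  simp [hmap, h]

theorem hmap_hmap (f g : ℝ → ℝ) (y : (Fin n → ℝ) × L) :
    hmap k f (hmap k g y) = hmap k (fun r => f (g r)) y := by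
  simp [hmap]

theorem hmap_fst_injective {f : ℝ → ℝ} (hf : Function.Injective f) (y x : (Fin n → ℝ) × L)
    (h : (hmap k f y).1 = (hmap k f x).1) : y.1 = x.1 := by
  funext i
  have hi := congrFun h i
  by_cases hik : i = k
  · subst hik
    rw [hmap_height, hmap_height] at hi
    exact hf hi
  · rwa [hmap_other _ _ hik, hmap_other _ _ hik] at hi

theorem hmap_mem_slab {f : ℝ → ℝ} {y : (Fin n → ℝ) × L} {J J' : Set ℝ} (hy : y ∈ slab L k J)
    (h : f (y.1 k) ∈ J') : hmap k f y ∈ slab L k J' :=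
  ⟨fun i hi => by rw [hmap_other _ _ hi]; exact hy.1 i hi, by rwa [hmap_height]⟩

theorem mem_cube_iff (k : Fin n) {y : (Fin n → ℝ) × L} : y ∈ cube n L ↔ y ∈ slab L k (Icc 0 1) :=
  ⟨fun h => ⟨fun i _ => h i, h k⟩, fun h i => by
    by_cases hi : i = k
    · exact hi ▸ h.2
    · exact h.1 i hi⟩

variable {w : (Fin n → ℝ) × L → ℝ}

/-- The weight vanishing at height `1`. -/
def wUp (k : Fin n) (w : (Fin n → ℝ) × L → ℝ) (y : (Fin n → ℝ) × L) : ℝ := min (w y) (1 - y.1 k)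

/-- The weight vanishing at height `0`. -/
def wLow (k : Fin n) (w : (Fin n → ℝ) × L → ℝ) (y : (Fin n → ℝ) × L) : ℝ := min (w y) (y.1 k)

/-- The weight vanishing at heights `0` and `1`. -/
def wBoth (k : Fin n) (w : (Fin n → ℝ) × L → ℝ) (y : (Fin n → ℝ) × L) : ℝ :=
  min (w y) (min (y.1 k) (1 - y.1 k))

theorem wUp_pos {y : (Fin n → ℝ) × L} : 0 < wUp k w y ↔ 0 < w y ∧ y.1 k < 1 := by
  simp [wUp]

theorem wLow_pos {y : (Fin n → ℝ) × L} : 0 < wLow k w y ↔ 0 < w y ∧ 0 < y.1 k := by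
  simp [wLow]

theorem wBoth_pos {y : (Fin n → ℝ) × L} :
    0 < wBoth k w y ↔ 0 < w y ∧ 0 < y.1 k ∧ y.1 k < 1 := by
  simp [wBoth]

variable [TopologicalSpace L]

theorem continuous_hmap {Z : Type*} [TopologicalSpace Z] {f : Z → ℝ → ℝ}
    (hf : Continuous fun q : Z × ℝ => f q.1 q.2) :
    Continuous fun q : Z × ((Fin n → ℝ) × L) => hmap k (f q.1) q.2 := by
  refine Continuous.prodMk (Continuous.update (by fun_prop) k ?_) (by fun_prop)
  exact hf.comp (by fun_prop : Continuous fun q : Z × ((Fin n → ℝ) × L) => (q.1, q.2.1 k))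

theorem eventually_height_lt_iff {a : ℝ} {y : (Fin n → ℝ) × L} (h : y.1 k ≠ a) :
    ∀ᶠ x in 𝓝 y, x ∈ {x : (Fin n → ℝ) × L | x.1 k < a} ↔ y ∈ {x : (Fin n → ℝ) × L | x.1 k < a} := by
  have hc : Continuous fun x : (Fin n → ℝ) × L => x.1 k := by fun_prop
  rcases lt_or_gt_of_ne h with h | h
  · filter_upwards [hc.continuousAt.eventually_lt_const h] with x hx
    exact iff_of_true hx h
  · filter_upwards [hc.continuousAt.eventually_const_lt h] with x hx
    exact iff_of_false (not_lt.2 hx.le) (not_lt.2 h.le)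

theorem eventually_lt_height_iff {a : ℝ} {y : (Fin n → ℝ) × L} (h : y.1 k ≠ a) :
    ∀ᶠ x in 𝓝 y, x ∈ {x : (Fin n → ℝ) × L | a < x.1 k} ↔ y ∈ {x : (Fin n → ℝ) × L | a < x.1 k} := by
  have hc : Continuous fun x : (Fin n → ℝ) × L => x.1 k := by fun_prop
  rcases lt_or_gt_of_ne h with h | h
  · filter_upwards [hc.continuousAt.eventually_lt_const h] with x hx
    exact iff_of_false (not_lt.2 hx.le) (not_lt.2 h.le)
  · filter_upwards [hc.continuousAt.eventually_const_lt h] with x hx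
    exact iff_of_true hx h

/-- A continuous weight not depending on the height. -/
structure IsWeight (k : Fin n) (w : (Fin n → ℝ) × L → ℝ) : Prop where
  cont : Continuous w
  inv : ∀ f y, w (hmap k f y) = w y

theorem IsWeight.continuous_wUp (hw : IsWeight k w) : Continuous (wUp k w) := by
  have := hw.cont
  unfold wUp
  fun_prop

theorem IsWeight.continuous_wLow (hw : IsWeight k w) : Continuous (wLow k w) := by
  have := hw.cont
  unfold wLow
  fun_prop

theorem IsWeight.continuous_wBoth (hw : IsWeight k w) : Continuous (wBoth k w) := by
  have := hw.cont
  unfold wBoth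
  fun_prop

/-- Configurations with positive total height function can be pushed down to the empty
configuration. -/
theorem IsWeight.exists_contraction_low (hw : IsWeight k w) {J : Set ℝ}
    (hJ1 : ∀ r ∈ J, r ≤ 1) (hJ : ∀ r ∈ J, ∀ r', 0 < r' → r' ≤ r → r' ∈ J) :
    ∃ H : C(I × Cfg (wLow k w) (slab L k J), Cfg (wLow k w) (slab L k J)),
      (∀ s, H (0, s) = s) ∧ ∀ s, H (1, s) = ∅ := by
  have hc := Cfg.continuous_map (w := wLow k w) (w' := wLow k w) (D := slab L k J)
    (D' := slab L k J) hw.continuous_wLow hw.continuous_wLow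
    (fun t : I => hmap k fun r => r - (t : ℝ))
    (continuous_hmap (f := fun (t : I) r => r - (t : ℝ)) (by fun_prop))
    (fun t => hmap_fst_injective fun a b h => by simpa using h)
    (fun t y hy _ h => hmap_mem_slab hy (by
      rw [wLow_pos, hmap_height] at h
      exact hJ _ hy.2 _ h.2 (by linarith [t.2.1])))
    (fun t y _ => by
      simp only [wLow, hw.inv, hmap_height]
      exact min_le_min le_rfl (by linarith [t.2.1]))
  refine ⟨⟨_, hc.comp continuous_swap⟩, fun s => Cfg.ext fun y => ?_, fun s => Cfg.ext fun y => ?_⟩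
  · constructor
    · rintro ⟨-, x, hx, rfl⟩
      simpa [hmap] using hx
    · intro hy
      exact ⟨s.pos y hy, y, hy, by simp [hmap]⟩
  · refine iff_of_false ?_ (Cfg.notMem_empty y)
    rintro ⟨h, x, hx, rfl⟩
    have h1 := (wLow_pos.1 h).2
    simp only [Prod.swap_prod_mk, hmap_height, Set.Icc.coe_one] at h1
    linarith [hJ1 _ (s.mem_dom x hx).2]

/-- The inclusion of the configurations of small height is an equivalence. -/
theorem IsWeight.exists_scale (hw : IsWeight k w) {J : Set ℝ}
    (hJ1 : ∀ r ∈ J, -1 ≤ r) (hJ : ∀ r ∈ J, ∀ r', -1 ≤ r' → r' ≤ r → r' ∈ J) :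
    ∃ H : C(Cfg w (slab L k J) × I, Cfg w (slab L k J)), ∀ s t y', y' ∈ H (s, t) ↔ 0 < w y' ∧
      ∃ y ∈ s, hmap k (fun r => -1 + (r + 1) * (1 - t / 2)) y = y' := by
  have hc := Cfg.continuous_map (w := w) (w' := w) (D := slab L k J) (D' := slab L k J)
    hw.cont hw.cont (fun t : I => hmap k fun r => -1 + (r + 1) * (1 - t / 2))
    (continuous_hmap (f := fun (t : I) r => -1 + (r + 1) * (1 - (t : ℝ) / 2)) (by fun_prop))
    (fun t => hmap_fst_injective fun a b h => by
      have : (1 - (t : ℝ) / 2) ≠ 0 := by linarith [t.2.2]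
      simpa [this] using h)
    (fun t y hy _ h => hmap_mem_slab hy (hJ _ hy.2 _
      (by nlinarith [hJ1 _ hy.2, t.2.2]) (by nlinarith [hJ1 _ hy.2, t.2.1])))
    (fun t y _ => (hw.inv _ _).le)
  exact ⟨⟨_, hc⟩, fun s t y' => Iff.rfl⟩

theorem IsWeight.hasW_union_empty (hw : IsWeight k w) {J T : Set ℝ} {D : Set ((Fin n → ℝ) × L)}
    (hJ : ∀ r ∈ J, -1 ≤ r ∧ r ≤ 1) (hJ' : ∀ r ∈ J, ∀ r', -1 ≤ r' → r' ≤ r → r' ∈ J)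
    (hT : ∀ r ∈ T, ∀ r', -1 ≤ r' → r' ≤ r → r' ∈ T) (hTJ : T ⊆ J) (h0 : Icc (-1) 0 ⊆ T)
    (u : C(Cfg w (slab L k T) × Cfg w D, Cfg w (slab L k J)))
    (hu : ∀ s t y, y ∈ u (s, t) ↔ y ∈ s ∨ y ∈ t) :
    HasW (u.comp ⟨fun d => (d, ∅), by fun_prop⟩) := by
  obtain ⟨H, hH⟩ := hw.exists_scale (fun r hr => (hJ r hr).1) hJ'
  obtain ⟨H', hH'⟩ := hw.exists_scale (fun r hr => (hJ r (hTJ hr)).1) hT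
  have hc := Cfg.continuous_map (w := w) (w' := w) (D := slab L k J) (D' := slab L k T)
    hw.cont hw.cont (fun _ : Unit => hmap k fun r => -1 + (r + 1) * (1 - (1 : I) / 2))
    (continuous_hmap (f := fun (_ : Unit) r => -1 + (r + 1) * (1 - ((1 : I) : ℝ) / 2))
      (by fun_prop))
    (fun t => hmap_fst_injective fun a b h => by
      simp only [Set.Icc.coe_one] at h
      linarith)
    (fun t y hy _ h => hmap_mem_slab hy (h0 (by
      simp only [Set.Icc.coe_one, mem_Icc]
      constructor <;> linarith [(hJ _ hy.2).1, (hJ _ hy.2).2])))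
    (fun t y _ => (hw.inv _ _).le)
  have hi : ∀ (D' : Set ((Fin n → ℝ) × L)) (s : Cfg w D') y, (0 < w y ∧
      ∃ x ∈ s, hmap k (fun r => -1 + (r + 1) * (1 - ((0 : I) : ℝ) / 2)) x = y) ↔ y ∈ s := by
    intro D' s y
    simp only [Set.Icc.coe_zero, zero_div, sub_zero, mul_one, neg_add_cancel_comm_assoc]
    constructor
    · rintro ⟨-, x, hx, rfl⟩
      rwa [hmap_of_eq rfl]
    · exact fun hy => ⟨s.pos y hy, y, hy, hmap_of_eq rfl⟩
  refine HasW.of_homotopy_inverse (g := ⟨_, hc.comp (Continuous.prodMk_left ())⟩)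
    (ContinuousMap.Homotopic.symm ⟨⟨⟨fun q => H' (q.2, q.1), by fun_prop⟩, fun s => ?_, fun s => ?_⟩⟩)
    (ContinuousMap.Homotopic.symm ⟨⟨⟨fun q => H (q.2, q.1), by fun_prop⟩, fun s => ?_, fun s => ?_⟩⟩)
  · exact Cfg.ext fun y => (hH' s 0 y).trans (hi _ s y)
  · refine Cfg.ext fun y => (hH' s 1 y).trans (and_congr_right fun _ => exists_congr fun x => ?_)
    refine and_congr_left fun _ => ?_
    change _ ↔ x ∈ u (s, ∅)
    rw [hu]
    exact (or_iff_left (Cfg.notMem_empty x)).symm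
  · exact Cfg.ext fun y => (hH s 0 y).trans (hi _ s y)
  · refine Cfg.ext fun y => (hH s 1 y).trans ?_
    refine Iff.trans ?_ (hu _ ∅ y).symm
    rw [or_iff_left (Cfg.notMem_empty y)]
    rfl

/-- A family of configurations indexed by a contractible space can be deformed to the empty
configuration, keeping the positions in place, by moving the labels. -/
theorem IsWeight.exists_nullhomotopy (hw : IsWeight k w) [PathConnectedSpace L] {l₀ : L}
    (hl₀ : ∀ m, w (m, l₀) ≤ 0) {K : Type} [TopologicalSpace K]
    (R : C(I × K, K)) (R0 : ∀ z, R (0, z) = z) {z₀ : K}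
    (R1 : ∀ z, R (1, z) = z₀) {J : Set ℝ}
    (c : C(K, Cfg w (slab L k J))) :
    ∃ C : C(K × I, Cfg w (slab L k J)), (∀ z, C (z, 0) = c z) ∧ ∀ z, C (z, 1) = ∅ := by
  let s := c z₀
  have : Finite s.carrier := s.finite
  let P (y : s.carrier) : Path y.1.2 l₀ := PathConnectedSpace.somePath _ _
  let Y (t : I) (y : s.carrier) : (Fin n → ℝ) × L := (y.1.1, P y t)
  have hY : ∀ t (i j : s.carrier), (Y t i).1 = (Y t j).1 → i = j := fun t i j h =>
    Subtype.ext (s.inj i i.2 j j.2 h)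
  have hc := Cfg.continuous_ofFamily (D := slab L k J) hw.cont Y (fun i => by fun_prop) hY
    fun t i _ => s.mem_dom i i.2
  let G : C(I, Cfg w (slab L k J)) := ⟨_, hc⟩
  have G0 : G 0 = s := Cfg.ext fun y => by
    constructor
    · rintro ⟨-, i, rfl⟩
      change (i.1.1, P i 0) ∈ s
      rw [(P i).source]
      exact i.2
    · exact fun hy => ⟨s.pos y hy, ⟨y, hy⟩, by simp [Y]⟩
  have G1 : G 1 = ∅ := Cfg.ext fun y => by
    refine iff_of_false ?_ (Cfg.notMem_empty y)
    rintro ⟨h, i, rfl⟩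
    simp only [Y, Path.target] at h
    exact (hl₀ _).not_gt h
  obtain ⟨F, F1, F2⟩ := exists_glue_half (Z := K) ⟨fun q => c (R (q.2, q.1)), by fun_prop⟩
    ⟨fun q => G q.2, by fun_prop⟩ fun z => by simp [G0, s, R1]
  refine ⟨F, fun z => ?_, fun z => ?_⟩
  · rw [← half₁_zero, F1]
    simp [R0]
  · rw [← half₂_one, F2]
    simp [G1]

end Height

section Core

variable {n : ℕ} {L : Type*} [TopologicalSpace L] {k : Fin n} {w : (Fin n → ℝ) × L → ℝ}

/-- Lifting over a box for configurations without particles at height `a`. -/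
theorem IsWeight.exists_lift (hw : IsWeight k w) [PathConnectedSpace L] {l₀ : L}
    (hl₀ : ∀ m, w (m, l₀) ≤ 0)
    (p : C(Cfg (wUp k w) (slab L k (Ici (-1))), Cfg (wBoth k w) (cube n L)))
    (hp : ∀ s y, y ∈ p s ↔ 0 < wBoth k w y ∧ y ∈ s)
    {K : Type} [TopologicalSpace K] {bd : Set K} (hK : IsCube bd) {a : ℝ} (ha : a ∈ Ioo (0 : ℝ) 1)
    {T : Set ℝ} (hT0 : Icc (-1) 0 ⊆ T) (hTa : T ⊆ Ico (-1) a)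
    (hT : ∀ r ∈ T, ∀ r', -1 ≤ r' → r' ≤ r → r' ∈ T)
    (β : C(K × I, Cfg (wBoth k w) (cube n L))) (hβ : ∀ q, ∀ y ∈ β q, y.1 k ≠ a)
    (l : K × I → Cfg (wUp k w) (slab L k (Ici (-1)))) (hl : ContinuousOn l (boxJ bd))
    (hpl : ∀ q ∈ boxJ bd, p (l q) = β q)
    (c : C(K, Cfg w (slab L k {r | 0 < r ∧ r < a ∧ r ∉ T})))
    (b : C(K, Cfg (wLow k w) (slab L k (T ∩ Ici 0))))
    (hbc : ∀ z y, y ∈ β (z, 1) ∧ y.1 k < a ↔ y ∈ b z ∨ y ∈ c z)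
    (d : K → Cfg w (slab L k T)) (hd : ContinuousOn d bd)
    (hdc : ∀ z ∈ bd, ∀ y, y ∈ l (z, 1) ∧ y.1 k < a ↔ y ∈ d z ∨ y ∈ c z) :
    ∃ (Φ : C((K × I) × I, Cfg (wBoth k w) (cube n L)))
      (Λ : C(K × I, Cfg (wUp k w) (slab L k (Ici (-1))))),
      (∀ q, Φ (q, 0) = β q) ∧ (∀ q ∈ boxJ bd, ∀ v, Φ (q, v) = β q) ∧ EqOn Λ l (boxJ bd) ∧
      (∀ q, p (Λ q) = Φ (q, 1)) ∧ (∀ q v, ∀ y ∈ Φ (q, v), y ∈ β q ∨ y.1 k < a) ∧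
      ∀ z v, ∀ y ∈ Φ ((z, 1), v), y ∈ β (z, 1) ∨ y.1 k ∈ T := by
  have cUp := hw.continuous_wUp
  have cLow := hw.continuous_wLow
  have cBoth := hw.continuous_wBoth
  have hlne : ∀ q ∈ boxJ bd, ∀ y ∈ l q, y.1 k ≠ a := fun q hq y hy he => by
    have h1 := wUp_pos.1 ((l q).pos y hy)
    have h2 : y ∈ p (l q) := (hp _ _).2 ⟨wBoth_pos.2 ⟨h1.1, he ▸ ha.1, h1.2⟩, hy⟩
    rw [hpl q hq] at h2
    exact hβ q y h2 he
  -- the parts below and above height `a`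
  let belβ : C(K × I, Cfg (wLow k w) (slab L k (Ico 0 a))) :=
    ⟨fun q => Cfg.cut (D := cube n L) (wLow k w) (slab L k (Ico 0 a)) {y | y.1 k < a}
        (fun y hy hya h => ⟨fun i _ => hy i, (hy k).1, hya⟩) (β q),
      continuous_iff_continuousAt.2 fun q => Cfg.tendsto_cut cBoth cLow β.continuous.continuousAt _
        _ (fun y hy => eventually_height_lt_iff (hβ q y hy)) fun ε hε =>
        ⟨min ε (1 - a), lt_min hε (by linarith [ha.2]), fun y _ hya h => by
          rw [← not_le] at h ⊢
          refine fun h' => h ?_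
          simp only [wBoth, wLow, Set.mem_ofPred_eq, le_min_iff, min_le_iff] at h' hya ⊢
          exact ⟨Or.inl h'.1, Or.inl h'.2, Or.inr (by linarith)⟩⟩⟩
  let abvβ : C(K × I, Cfg (wUp k w) (slab L k (Ioc a 1))) :=
    ⟨fun q => Cfg.cut (D := cube n L) (wUp k w) (slab L k (Ioc a 1)) {y | a < y.1 k}
        (fun y hy hya h => ⟨fun i _ => hy i, hya, (hy k).2⟩) (β q),
      continuous_iff_continuousAt.2 fun q => Cfg.tendsto_cut cBoth cUp β.continuous.continuousAt _
        _ (fun y hy => eventually_lt_height_iff (hβ q y hy)) fun ε hε =>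
        ⟨min ε a, lt_min hε ha.1, fun y _ hya h => by
          rw [← not_le] at h ⊢
          refine fun h' => h ?_
          simp only [wBoth, wUp, Set.mem_ofPred_eq, le_min_iff, min_le_iff] at h' hya ⊢
          exact ⟨Or.inl h'.1, Or.inr hya.le, Or.inl h'.2⟩⟩⟩
  let bell : K × I → Cfg w (slab L k (Ico (-1) a)) := fun q =>
    Cfg.cut (D := slab L k (Ici (-1))) w (slab L k (Ico (-1) a)) {y | y.1 k < a}
      (fun y hy hya h => ⟨hy.1, hy.2, hya⟩) (l q)
  have hbell : ContinuousOn bell (boxJ bd) := fun q hq => Cfg.tendsto_cut cUp hw.cont (hl q hq) _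
    _ (fun y hy => eventually_height_lt_iff (hlne q hq y hy)) fun ε hε =>
    ⟨min ε (1 - a), lt_min hε (by linarith [ha.2]), fun y _ hya h => by
      rw [← not_le] at h ⊢
      refine fun h' => h ?_
      simp only [wUp, Set.mem_ofPred_eq, le_min_iff, min_le_iff] at h' hya ⊢
      exact ⟨Or.inl h', Or.inr (by linarith)⟩⟩
  have mbelβ : ∀ q y, y ∈ belβ q ↔ 0 < wLow k w y ∧ y ∈ β q ∧ y.1 k < a := fun q y => Iff.rfl
  have mabvβ : ∀ q y, y ∈ abvβ q ↔ 0 < wUp k w y ∧ y ∈ β q ∧ a < y.1 k := fun q y => Iff.rfl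
  have mbell : ∀ q y, y ∈ bell q ↔ 0 < w y ∧ y ∈ l q ∧ y.1 k < a := fun q y => Iff.rfl
  -- restrictions and unions
  let pX : C(Cfg w (slab L k (Ico (-1) a)), Cfg (wLow k w) (slab L k (Ico 0 a))) :=
    ⟨_, (Cfg.continuous_map (D := slab L k (Ico (-1) a)) (D' := slab L k (Ico 0 a)) hw.cont cLow
      (fun (_ : Unit) => id) (by fun_prop) (fun _ _ _ h => h)
      (fun _ y hy _ h => ⟨hy.1, (wLow_pos.1 h).2.le, hy.2.2⟩) fun _ _ _ => min_le_left _ _).comp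
      (Continuous.prodMk_left ())⟩
  let pT : C(Cfg w (slab L k T), Cfg (wLow k w) (slab L k (T ∩ Ici 0))) :=
    ⟨_, (Cfg.continuous_map (D := slab L k T) (D' := slab L k (T ∩ Ici 0)) hw.cont cLow
      (fun (_ : Unit) => id) (by fun_prop) (fun _ _ _ h => h)
      (fun _ y hy _ h => ⟨hy.1, hy.2, (wLow_pos.1 h).2.le⟩) fun _ _ _ => min_le_left _ _).comp
      (Continuous.prodMk_left ())⟩
  have mpX : ∀ s y, y ∈ pX s ↔ 0 < wLow k w y ∧ y ∈ s := fun s y =>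
    ⟨fun h => ⟨h.1, by obtain ⟨x, hx, rfl⟩ := h.2; exact hx⟩, fun h => ⟨h.1, y, h.2, rfl⟩⟩
  have mpT : ∀ s y, y ∈ pT s ↔ 0 < wLow k w y ∧ y ∈ s := fun s y =>
    ⟨fun h => ⟨h.1, by obtain ⟨x, hx, rfl⟩ := h.2; exact hx⟩, fun h => ⟨h.1, y, h.2, rfl⟩⟩
  let uX : C(Cfg w (slab L k T) × Cfg w (slab L k {r | 0 < r ∧ r < a ∧ r ∉ T}),
      Cfg w (slab L k (Ico (-1) a))) :=
    ⟨_, Cfg.continuous_union (D₁ := slab L k T) (D₂ := slab L k {r | 0 < r ∧ r < a ∧ r ∉ T})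
      (D := slab L k (Ico (-1) a)) hw.cont hw.cont (fun y hy h => ⟨h, hy.1, hTa hy.2⟩)
      (fun y hy h => ⟨h, hy.1, by linarith [hy.2.1], hy.2.2.1⟩)
      (fun y hy x hx he => hx.2.2.2 (he ▸ hy.2)) (fun _ _ => le_rfl) fun _ _ => le_rfl⟩
  let uY : C(Cfg (wLow k w) (slab L k (T ∩ Ici 0)) ×
      Cfg w (slab L k {r | 0 < r ∧ r < a ∧ r ∉ T}), Cfg (wLow k w) (slab L k (Ico 0 a))) :=
    ⟨_, Cfg.continuous_union (D₁ := slab L k (T ∩ Ici 0))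
      (D₂ := slab L k {r | 0 < r ∧ r < a ∧ r ∉ T}) (D := slab L k (Ico 0 a)) cLow hw.cont
        (fun y hy h => ⟨h, hy.1, hy.2.2, (hTa hy.2.1).2⟩)
      (fun y hy h => ⟨wLow_pos.2 ⟨h, hy.2.1⟩, hy.1, hy.2.1.le, hy.2.2.1⟩)
      (fun y hy x hx he => hx.2.2.2 (he ▸ hy.2.1)) (fun _ _ => le_rfl) fun _ _ => min_le_left _ _⟩
  have muX : ∀ s t y, y ∈ uX (s, t) ↔ y ∈ s ∨ y ∈ t := fun s t y => Iff.rfl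
  have muY : ∀ s t y, y ∈ uY (s, t) ↔ y ∈ s ∨ y ∈ t := fun s t y => Iff.rfl
  let uB : C(Cfg (wLow k w) (slab L k (Ico 0 a)) × Cfg (wUp k w) (slab L k (Ioc a 1)),
      Cfg (wBoth k w) (cube n L)) :=
    ⟨_, Cfg.continuous_union (w := wBoth k w) (D₁ := slab L k (Ico 0 a)) (D₂ := slab L k (Ioc a 1))
      (D := cube n L) cLow cUp
      (fun y hy h => ⟨wBoth_pos.2 ⟨(wLow_pos.1 h).1, (wLow_pos.1 h).2, hy.2.2.trans ha.2⟩,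
        (mem_cube_iff k).2 ⟨hy.1, hy.2.1, (hy.2.2.trans ha.2).le⟩⟩)
      (fun y hy h => ⟨wBoth_pos.2 ⟨(wUp_pos.1 h).1, ha.1.trans hy.2.1, (wUp_pos.1 h).2⟩,
        (mem_cube_iff k).2 ⟨hy.1, (ha.1.trans hy.2.1).le, hy.2.2⟩⟩)
      (fun y hy x hx he => by
        have h1 := hy.2.2
        rw [he] at h1
        exact (h1.trans hx.2.1).false)
      (fun y _ => min_le_min le_rfl (min_le_left _ _))
      fun y _ => min_le_min le_rfl (min_le_right _ _)⟩
  let uE : C(Cfg w (slab L k (Ico (-1) a)) × Cfg (wUp k w) (slab L k (Ioc a 1)),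
      Cfg (wUp k w) (slab L k (Ici (-1)))) :=
    ⟨_, Cfg.continuous_union (w := wUp k w) (D₁ := slab L k (Ico (-1) a))
      (D₂ := slab L k (Ioc a 1)) (D := slab L k (Ici (-1))) hw.cont cUp
      (fun y hy h => ⟨wUp_pos.2 ⟨h, hy.2.2.trans ha.2⟩, hy.1, hy.2.1⟩)
      (fun y hy h => ⟨h, hy.1, by have := hy.2.1; have := ha.1; simp only [mem_Ici]; linarith⟩)
      (fun y hy x hx he => by
        have h1 := hy.2.2
        rw [he] at h1
        exact (h1.trans hx.2.1).false)
      (fun y _ => min_le_left _ _) fun y _ => le_rfl⟩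
  have muB : ∀ s t y, y ∈ uB (s, t) ↔ y ∈ s ∨ y ∈ t := fun s t y => Iff.rfl
  have muE : ∀ s t y, y ∈ uE (s, t) ↔ y ∈ s ∨ y ∈ t := fun s t y => Iff.rfl
  obtain ⟨H, H0, H1⟩ := hw.exists_contraction_low (J := Ico 0 a) (fun r hr => (hr.2.trans ha.2).le)
    fun r hr r' h1 h2 => ⟨h1.le, h2.trans_lt hr.2⟩
  obtain ⟨HT, HT0, HT1⟩ := hw.exists_contraction_low (J := T ∩ Ici 0)
    (fun r hr => ((hTa hr.1).2.trans ha.2).le)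
    fun r hr r' h1 h2 => ⟨hT r hr.1 r' (by linarith) h2, h1.le⟩
  obtain ⟨R, R0, z₀, R1⟩ := hK.contractibleSpace
  obtain ⟨C, C0, C1⟩ := hw.exists_nullhomotopy hl₀ R R0 R1 c
  have hι := hw.hasW_union_empty (J := Ico (-1) a) (T := T)
    (fun r hr => ⟨hr.1, (hr.2.trans ha.2).le⟩) (fun r hr r' h1 h2 => ⟨h1, h2.trans_lt hr.2⟩)
    hT hTa hT0 uX muX
  obtain ⟨Λ, Φ, e1, e2, e3, e4, e5⟩ := hK.exists_lift_of_decomposition uX uY pX pT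
    (fun s t => Cfg.ext fun y => by
      rw [mpX, muX, muY, mpT]
      have : y ∈ t → 0 < wLow k w y := fun h => wLow_pos.2 ⟨t.pos y h, (t.mem_dom y h).2.1⟩
      tauto)
    ∅ hι H ∅ H0 H1 HT ∅ HT0 HT1 C C1 belβ bell hbell
    (fun q hq => Cfg.ext fun y => by
      rw [mpX, mbell, mbelβ, ← hpl q hq, hp]
      have h1 : 0 < wLow k w y → 0 < w y := fun h => (wLow_pos.1 h).1
      have h2 : 0 < wLow k w y → y.1 k < a → 0 < wBoth k w y := fun h h' =>
        wBoth_pos.2 ⟨(wLow_pos.1 h).1, (wLow_pos.1 h).2, h'.trans ha.2⟩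
      tauto) b
    (fun z => Cfg.ext fun y => by
      rw [mbelβ, muY, C0, ← hbc]
      exact and_iff_right_of_imp fun h =>
        have h' := wBoth_pos.1 ((β _).pos y h.1)
        wLow_pos.2 ⟨h'.1, h'.2.1⟩) d hd
    (fun z hz => Cfg.ext fun y => by
      rw [mbell, muX, C0, ← hdc z hz]
      exact and_iff_right_of_imp fun h => (wUp_pos.1 ((l _).pos y h.1)).1)
    (fun z hz => Cfg.ext fun y => by
      have hJ : (z, (1 : I)) ∈ boxJ bd := Or.inr hz
      rw [mpT]
      constructor
      · rintro ⟨h, hy⟩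
        have h1 := (hdc z hz y).2 (Or.inl hy)
        have h2 : y ∈ p (l (z, 1)) := (hp _ _).2
          ⟨wBoth_pos.2 ⟨(wLow_pos.1 h).1, (wLow_pos.1 h).2, h1.2.trans ha.2⟩, h1.1⟩
        rw [hpl _ hJ] at h2
        exact ((hbc z y).1 ⟨h2, h1.2⟩).resolve_right fun h3 =>
          ((c z).mem_dom y h3).2.2.2 ((d z).mem_dom y hy).2
      · intro hy
        have h1 := (hbc z y).2 (Or.inl hy)
        rw [← hpl _ hJ, hp] at h1
        exact ⟨(b z).pos y hy, ((hdc z hz y).1 ⟨h1.1.2, h1.2⟩).resolve_right fun h3 =>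
          ((c z).mem_dom y h3).2.2.2 ((b z).mem_dom y hy).2.1⟩)
  have hsplit : ∀ q, uB (belβ q, abvβ q) = β q := fun q => Cfg.ext fun y => by
    rw [muB, mbelβ, mabvβ]
    constructor
    · rintro (h | h)
      exacts [h.2.1, h.2.1]
    · intro h
      have h' := wBoth_pos.1 ((β q).pos y h)
      rcases lt_or_gt_of_ne (hβ q y h) with h1 | h1
      exacts [Or.inl ⟨wLow_pos.2 ⟨h'.1, h'.2.1⟩, h, h1⟩, Or.inr ⟨wUp_pos.2 ⟨h'.1, h'.2.2⟩, h, h1⟩]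
  refine ⟨⟨fun q => uB (Φ q, abvβ q.1), by fun_prop⟩, ⟨fun q => uE (Λ q, abvβ q), by fun_prop⟩,
    fun q => ?_, fun q hq v => ?_, fun q hq => Cfg.ext fun y => ?_, fun q => Cfg.ext fun y => ?_,
    fun q v y hy => ?_, fun z v y hy => ?_⟩
  · change uB (Φ (q, 0), abvβ q) = _
    rw [e2, hsplit]
  · change uB (Φ (q, v), abvβ q) = _
    rw [e4 q hq, hsplit]
  · change y ∈ uE (Λ q, abvβ q) ↔ _
    rw [muE, e1 hq, mbell, mabvβ, ← hpl q hq, hp]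
    constructor
    · rintro (h | h)
      exacts [h.2.1, h.2.1.2]
    · intro h
      have h' := wUp_pos.1 ((l q).pos y h)
      rcases lt_or_gt_of_ne (hlne q hq y h) with h1 | h1
      · exact Or.inl ⟨h'.1, h, h1⟩
      · exact Or.inr ⟨wUp_pos.2 h', ⟨wBoth_pos.2 ⟨h'.1, ha.1.trans h1, h'.2⟩, h⟩, h1⟩
  · change y ∈ p (uE (Λ q, abvβ q)) ↔ y ∈ uB (Φ (q, 1), abvβ q)
    rw [hp, muE, muB, e3, mpX]
    constructor
    · rintro ⟨h, h1 | h1⟩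
      · exact Or.inl ⟨wLow_pos.2 ⟨(wBoth_pos.1 h).1, (wBoth_pos.1 h).2.1⟩, h1⟩
      · exact Or.inr h1
    · rintro (h | h)
      · have h' := wLow_pos.1 h.1
        exact ⟨wBoth_pos.2 ⟨h'.1, h'.2, (((Λ q).mem_dom y h.2).2.2).trans ha.2⟩, Or.inl h.2⟩
      · have h' := wUp_pos.1 ((abvβ q).pos y h)
        exact ⟨wBoth_pos.2 ⟨h'.1, ha.1.trans ((abvβ q).mem_dom y h).2.1, h'.2⟩, Or.inr h⟩
  · rcases hy with hy | hy
    · exact Or.inr ((Φ (q, v)).mem_dom y hy).2.2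
    · exact Or.inl ((mabvβ _ _).1 hy).2.1
  · rcases hy with hy | hy
    · obtain ⟨b', hb'⟩ := e5 z v
      rw [hb', muY, C0] at hy
      rcases hy with hy | hy
      · exact Or.inr (b'.mem_dom y hy).2.1
      · exact Or.inl ((hbc z y).2 (Or.inr hy)).1
    · exact Or.inl ((mabvβ _ _).1 hy).2.1

end Core

section Lift

variable {n : ℕ} {L : Type*} [TopologicalSpace L] {k : Fin n} {w : (Fin n → ℝ) × L → ℝ}

/-- Configurations without particles at height `a`. -/
def noAt (k : Fin n) (w : (Fin n → ℝ) × L → ℝ) (a : ℝ) : Set (Cfg (wBoth k w) (cube n L)) :=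
  {s | ∀ y ∈ s, y.1 k ≠ a}

theorem IsWeight.liftable_of_univ (hw : IsWeight k w) [PathConnectedSpace L] {l₀ : L}
    (hl₀ : ∀ m, w (m, l₀) ≤ 0)
    (p : C(Cfg (wUp k w) (slab L k (Ici (-1))), Cfg (wBoth k w) (cube n L)))
    (hp : ∀ s y, y ∈ p s ↔ 0 < wBoth k w y ∧ y ∈ s)
    {K : Type} [TopologicalSpace K] {bd : Set K} (hK : IsCube bd) {a : ℝ} (ha : a ∈ Ioo (0 : ℝ) 1)
    (β : C(K × I, Cfg (wBoth k w) (cube n L))) (hβ : ∀ q, ∀ y ∈ β q, y.1 k ≠ a)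
    (hβ1 : ∀ z, β (z, 1) = ∅)
    (l : K × I → Cfg (wUp k w) (slab L k (Ici (-1)))) (hl : ContinuousOn l (boxJ bd))
    (hpl : ∀ q ∈ boxJ bd, p (l q) = β q) :
    ∃ (Φ : C((K × I) × I, Cfg (wBoth k w) (cube n L)))
      (Λ : C(K × I, Cfg (wUp k w) (slab L k (Ici (-1))))),
      (∀ q, Φ (q, 0) = β q) ∧ (∀ q ∈ boxJ bd, ∀ v, Φ (q, v) = β q) ∧ EqOn Λ l (boxJ bd) ∧
      (∀ q, p (Λ q) = Φ (q, 1)) ∧ (∀ q v, ∀ y ∈ Φ (q, v), y ∈ β q ∨ y.1 k < a) ∧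
      ∀ z v, Φ ((z, 1), v) = ∅ := by
  have hle : ∀ z ∈ bd, ∀ y ∈ l (z, 1), y.1 k < a → y.1 k ≤ 0 := fun z hz y hy hya => by
    by_contra! h0
    have h1 : y ∈ p (l (z, 1)) := (hp _ _).2 ⟨wBoth_pos.2
      ⟨(wUp_pos.1 ((l _).pos y hy)).1, h0, hya.trans ha.2⟩, hy⟩
    rw [hpl _ (Or.inr hz), hβ1] at h1
    exact h1
  let d : K → Cfg w (slab L k (Icc (-1) 0)) := fun z =>
    Cfg.cut (D := slab L k (Ici (-1))) w (slab L k (Icc (-1) 0)) {y | y.1 k ≤ 0}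
      (fun y hy hya h => ⟨hy.1, hy.2, hya⟩) (l (z, 1))
  have hdl : ∀ z ∈ bd, ∀ y, y ∈ d z ↔ 0 < w y ∧ y ∈ l (z, 1) ∧ y.1 k < a := fun z hz y =>
    ⟨fun h => ⟨h.1, h.2.1, lt_of_le_of_lt h.2.2 ha.1⟩, fun h => ⟨h.1, h.2.1, hle z hz y h.2.1 h.2.2⟩⟩
  have hd : ContinuousOn d bd := fun z hz => by
    have hl' : Filter.Tendsto (fun z => l (z, 1)) (𝓝[bd] z) (𝓝 (l (z, 1))) :=
      (hl.comp (f := fun z => (z, (1 : I))) (by fun_prop)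
        (fun z (hz : z ∈ bd) => Or.inr hz)) z hz
    refine Cfg.tendsto_map hw.continuous_wUp hw.cont hl' (fun _ => id) id {y | y.1 k < a}
      (Filter.eventually_of_mem self_mem_nhdsWithin fun x hx y => ?_) (fun y => ?_)
      (fun _ _ _ => Filter.tendsto_snd) (fun y hy => eventually_height_lt_iff fun he => ?_)
      (fun ε hε => ⟨min ε (1 - a), lt_min hε (by linarith [ha.2]),
        Filter.Eventually.of_forall fun z y _ hya h => ?_⟩)
      (Filter.Eventually.of_forall fun _ _ _ _ _ _ _ he => he) fun _ _ _ _ _ _ he => he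
    · rw [hdl x hx]
      exact ⟨fun h => ⟨h.1, y, h.2.1, h.2.2, rfl⟩,
        by rintro ⟨h, y, hy, hyR, rfl⟩; exact ⟨h, hy, hyR⟩⟩
    · rw [hdl z hz]
      exact ⟨fun h => ⟨h.1, y, h.2.1, h.2.2, rfl⟩,
        by rintro ⟨h, y, hy, hyR, rfl⟩; exact ⟨h, hy, hyR⟩⟩
    · have h1 : y ∈ p (l (z, 1)) := (hp _ _).2 ⟨wBoth_pos.2
        ⟨(wUp_pos.1 ((l _).pos y hy)).1, he ▸ ha.1, he ▸ ha.2⟩, hy⟩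
      rw [hpl _ (Or.inr hz), hβ1] at h1
      exact h1
    · rw [← not_le] at h ⊢
      refine fun h' => h ?_
      simp only [wUp, Set.mem_ofPred_eq, le_min_iff, min_le_iff] at h' hya ⊢
      exact ⟨Or.inl h', Or.inr (by linarith)⟩
  obtain ⟨Φ, Λ, h1, h2, h3, h4, h5, h6⟩ := hw.exists_lift hl₀ p hp hK ha subset_rfl
    (fun r hr => ⟨hr.1, hr.2.trans_lt ha.1⟩) (fun r hr r' h h' => ⟨h, h'.trans hr.2⟩) β hβ l hl hpl
    (.const K ∅) (.const K ∅) (fun z y => by simp [hβ1, Cfg.notMem_empty]) d hd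
    (fun z hz y => by
      rw [hdl z hz]
      refine Iff.trans ?_ (or_iff_left (Cfg.notMem_empty y)).symm
      exact (and_iff_right_of_imp fun h => (wUp_pos.1 ((l (z, 1)).pos y h.1)).1).symm)
  refine ⟨Φ, Λ, h1, h2, h3, h4, h5, fun z v => Cfg.ext fun y =>
    iff_of_false (fun hy => ?_) (Cfg.notMem_empty y)⟩
  rcases h6 z v y hy with h | h
  · rw [hβ1] at h
    exact h
  · exact (wBoth_pos.1 ((Φ _).pos y hy)).2.1.not_ge h.2

theorem IsWeight.liftable_of_finite (hw : IsWeight k w) [PathConnectedSpace L] {l₀ : L}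
    (hl₀ : ∀ m, w (m, l₀) ≤ 0)
    (p : C(Cfg (wUp k w) (slab L k (Ici (-1))), Cfg (wBoth k w) (cube n L)))
    (hp : ∀ s y, y ∈ p s ↔ 0 < wBoth k w y ∧ y ∈ s)
    {K : Type} [TopologicalSpace K] {bd : Set K} (hK : IsCube bd) {a a' : ℝ} (ha1 : a < 1)
    (ha' : 0 < a') (haa : a' ≤ a)
    (β : C(K × I, Cfg (wBoth k w) (cube n L))) (hβ : ∀ q, ∀ y ∈ β q, y.1 k ≠ a)
    (hβ1 : ∀ z, ∀ y ∈ β (z, 1), y.1 k ≠ a')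
    (l : K × I → Cfg (wUp k w) (slab L k (Ici (-1)))) (hl : ContinuousOn l (boxJ bd))
    (hpl : ∀ q ∈ boxJ bd, p (l q) = β q) :
    ∃ (Φ : C((K × I) × I, Cfg (wBoth k w) (cube n L)))
      (Λ : C(K × I, Cfg (wUp k w) (slab L k (Ici (-1))))),
      (∀ q, Φ (q, 0) = β q) ∧ (∀ q ∈ boxJ bd, ∀ v, Φ (q, v) = β q) ∧ EqOn Λ l (boxJ bd) ∧
      (∀ q, p (Λ q) = Φ (q, 1)) ∧ (∀ q v, ∀ y ∈ Φ (q, v), y ∈ β q ∨ y.1 k < a) ∧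
      ∀ z v, ∀ y ∈ Φ ((z, 1), v), y ∈ β (z, 1) ∨ y.1 k < a' := by
  have cβ : Continuous fun z => β (z, 1) := by fun_prop
  let c : C(K, Cfg w (slab L k {r | 0 < r ∧ r < a ∧ r ∉ Ico (-1) a'})) :=
    ⟨fun z => Cfg.cut (D := cube n L) w _ ({y | a' < y.1 k} ∩ {y | y.1 k < a})
      (fun y hy hya h => ⟨fun i _ => hy i, ha'.trans hya.1, hya.2, fun h' => h'.2.not_gt hya.1⟩)
      (β (z, 1)),
      continuous_iff_continuousAt.2 fun z => Cfg.tendsto_cut hw.continuous_wBoth hw.cont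
        cβ.continuousAt _ _ (fun y hy => by
          filter_upwards [eventually_height_lt_iff (hβ _ y hy),
            eventually_lt_height_iff (hβ1 z y hy)] with x h1 h2
          exact and_congr h2 h1) fun ε hε =>
        ⟨min ε (min a' (1 - a)), lt_min hε (lt_min ha' (by linarith)), fun y _ hya h => by
          rw [← not_le] at h ⊢
          refine fun h' => h ?_
          simp only [wBoth, mem_inter_iff, Set.mem_ofPred_eq, le_min_iff, min_le_iff] at h' hya ⊢
          exact ⟨Or.inl h', Or.inr (Or.inl hya.1.le), Or.inr (Or.inr (by linarith))⟩⟩⟩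
  let b : C(K, Cfg (wLow k w) (slab L k (Ico (-1) a' ∩ Ici 0))) :=
    ⟨fun z => Cfg.cut (D := cube n L) (wLow k w) _ {y | y.1 k < a'}
      (fun y hy hya h => ⟨fun i _ => hy i, ⟨by linarith [(hy k).1], hya⟩, (hy k).1⟩) (β (z, 1)),
      continuous_iff_continuousAt.2 fun z => Cfg.tendsto_cut hw.continuous_wBoth hw.continuous_wLow
        cβ.continuousAt _ _ (fun y hy => eventually_height_lt_iff (hβ1 z y hy)) fun ε hε =>
        ⟨min ε (1 - a), lt_min hε (by linarith), fun y _ hya h => by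
          rw [← not_le] at h ⊢
          refine fun h' => h ?_
          simp only [wBoth, wLow, Set.mem_ofPred_eq, le_min_iff, min_le_iff] at h' hya ⊢
          exact ⟨Or.inl h'.1, Or.inl h'.2, Or.inr (by linarith)⟩⟩⟩
  let d : K → Cfg w (slab L k (Ico (-1) a')) := fun z =>
    Cfg.cut (D := slab L k (Ici (-1))) w _ {y | y.1 k < a'}
      (fun y hy hya h => ⟨hy.1, hy.2, hya⟩) (l (z, 1))
  have mc : ∀ z y, y ∈ c z ↔ 0 < w y ∧ y ∈ β (z, 1) ∧ a' < y.1 k ∧ y.1 k < a := fun _ _ => Iff.rfl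
  have mb : ∀ z y, y ∈ b z ↔ 0 < wLow k w y ∧ y ∈ β (z, 1) ∧ y.1 k < a' := fun _ _ => Iff.rfl
  have md : ∀ z y, y ∈ d z ↔ 0 < w y ∧ y ∈ l (z, 1) ∧ y.1 k < a' := fun _ _ => Iff.rfl
  have hlne : ∀ z ∈ bd, ∀ y ∈ l (z, 1), y.1 k ≠ a' := fun z hz y hy he => by
    have h1 : y ∈ p (l (z, 1)) := (hp _ _).2 ⟨wBoth_pos.2
      ⟨(wUp_pos.1 ((l _).pos y hy)).1, he ▸ ha', he ▸ haa.trans_lt ha1⟩, hy⟩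
    rw [hpl _ (Or.inr hz)] at h1
    exact hβ1 z y h1 he
  have hd : ContinuousOn d bd := fun z hz => by
    have hl' : Filter.Tendsto (fun z => l (z, 1)) (𝓝[bd] z) (𝓝 (l (z, 1))) :=
      (hl.comp (f := fun z => (z, (1 : I))) (by fun_prop)
        (fun z (hz : z ∈ bd) => Or.inr hz)) z hz
    refine Cfg.tendsto_cut hw.continuous_wUp hw.cont hl' _ _
      (fun y hy => eventually_height_lt_iff (hlne z hz y hy)) fun ε hε =>
      ⟨min ε (1 - a), lt_min hε (by linarith), fun y _ hya h => ?_⟩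
    rw [← not_le] at h ⊢
    refine fun h' => h ?_
    simp only [wUp, Set.mem_ofPred_eq, le_min_iff, min_le_iff] at h' hya ⊢
    exact ⟨Or.inl h', Or.inr (by linarith)⟩
  obtain ⟨Φ, Λ, h1, h2, h3, h4, h5, h6⟩ := hw.exists_lift hl₀ p hp hK ⟨ha'.trans_le haa, ha1⟩
    (T := Ico (-1) a') (fun r hr => ⟨hr.1, hr.2.trans_lt ha'⟩) (Ico_subset_Ico_right haa)
    (fun r hr r' h h' => ⟨h, h'.trans_lt hr.2⟩) β hβ l hl hpl c b
    (fun z y => by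
      rw [mb, mc]
      constructor
      · rintro ⟨h, h'⟩
        have h0 := wBoth_pos.1 ((β _).pos y h)
        rcases lt_or_gt_of_ne (hβ1 z y h) with h1 | h1
        · exact Or.inl ⟨wLow_pos.2 ⟨h0.1, h0.2.1⟩, h, h1⟩
        · exact Or.inr ⟨h0.1, h, h1, h'⟩
      · rintro (h | h)
        exacts [⟨h.2.1, h.2.2.trans_le haa⟩, ⟨h.2.1, h.2.2.2⟩]) d hd
    (fun z hz y => by
      rw [md, mc, ← hpl (z, 1) (Or.inr hz), hp]
      constructor
      · rintro ⟨h, h'⟩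
        have h0 := wUp_pos.1 ((l _).pos y h)
        rcases lt_or_gt_of_ne (hlne z hz y h) with h1 | h1
        · exact Or.inl ⟨h0.1, h, h1⟩
        · exact Or.inr ⟨h0.1, ⟨wBoth_pos.2 ⟨h0.1, ha'.trans h1, h0.2⟩, h⟩, h1, h'⟩
      · rintro (h | h)
        exacts [⟨h.2.1, h.2.2.trans_le haa⟩, ⟨h.2.1.2, h.2.2.2⟩])
  exact ⟨Φ, Λ, h1, h2, h3, h4, h5, fun z v y hy => (h6 z v y hy).imp_right fun h => h.2⟩

theorem IsWeight.boxLift (hw : IsWeight k w) [PathConnectedSpace L] {l₀ : L}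
    (hl₀ : ∀ m, w (m, l₀) ≤ 0)
    (p : C(Cfg (wUp k w) (slab L k (Ici (-1))), Cfg (wBoth k w) (cube n L)))
    (hp : ∀ s y, y ∈ p s ↔ 0 < wBoth k w y ∧ y ∈ s)
    {K : Type} [TopologicalSpace K] {bd : Set K} (hK : IsCube bd) {V W : Set ℝ} (hVf : V.Finite)
    (hVn : V.Nonempty) (hV : V ⊆ Ioo 0 1) (hVW : V ⊆ W) (hW : W = univ ∨ W.Finite ∧ W ⊆ Ioo 0 1) :
    BoxLift p (noAt k w) bd fun q => {a | a ∈ V ∨ q.2 = 1 ∧ a ∈ W} := by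
  intro β hβ l hl hpl
  obtain ⟨a, haV, hamin⟩ := Set.exists_min_image V id hVf hVn
  have ha : ∀ q, ∀ y ∈ β q, y.1 k ≠ a := fun q => hβ q a (Or.inl haV)
  rcases hW with rfl | ⟨hWf, hW⟩
  · have hβ1 : ∀ z, β (z, 1) = ∅ := fun z => Cfg.ext fun y =>
      iff_of_false (fun hy => hβ (z, 1) (y.1 k) (Or.inr ⟨rfl, mem_univ _⟩) y hy rfl)
        (Cfg.notMem_empty y)
    obtain ⟨Φ, Λ, h1, h2, h3, h4, h5, h6⟩ := hw.liftable_of_univ hl₀ p hp hK (hV haV) β ha hβ1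
      l hl hpl
    refine ⟨Φ, Λ, ⟨h1, h2, ?_⟩, h3, h4⟩
    rintro ⟨z, t⟩ v r (hr | ⟨rfl, -⟩) y hy
    · rcases h5 _ v y hy with h | h
      · exact hβ _ r (Or.inl hr) y h
      · exact (h.trans_le (hamin r hr)).ne
    · rw [h6] at hy
      exact hy.elim
  · obtain ⟨a', haW, hamin'⟩ := Set.exists_min_image W id hWf ⟨a, hVW haV⟩
    obtain ⟨Φ, Λ, h1, h2, h3, h4, h5, h6⟩ := hw.liftable_of_finite hl₀ p hp hK (hV haV).2
      (hW haW).1 (hamin' a (hVW haV)) β ha (fun z => hβ (z, 1) a' (Or.inr ⟨rfl, haW⟩)) l hl hpl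
    refine ⟨Φ, Λ, ⟨h1, h2, ?_⟩, h3, h4⟩
    rintro ⟨z, t⟩ v r (hr | ⟨rfl, hr⟩) y hy
    · rcases h5 _ v y hy with h | h
      · exact hβ _ r (Or.inl hr) y h
      · exact (h.trans_le (hamin r hr)).ne
    · rcases h6 _ v y hy with h | h
      · exact hβ _ r (Or.inr ⟨rfl, hr⟩) y h
      · exact (h.trans_le (hamin' r hr)).ne

end Lift

section Grid

theorem abs_sub_le_of_same_cell {e j : ℕ} {x y : ℝ} (h1 : (j : ℝ) ≤ 2 ^ e * x)
    (h2 : 2 ^ e * x ≤ j + 1) (h3 : (j : ℝ) ≤ 2 ^ e * y) (h4 : 2 ^ e * y ≤ j + 1) :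
    |x - y| ≤ (1 / 2) ^ e := by
  have hp : (0 : ℝ) < 2 ^ e := by positivity
  have he : ((1 : ℝ) / 2) ^ e = 1 / 2 ^ e := by rw [div_pow, one_pow]
  rw [he, abs_le]
  constructor
  · rw [neg_le, neg_sub, le_div_iff₀ hp]
    nlinarith
  · rw [le_div_iff₀ hp]
    nlinarith

/-- Over the cells of a fine dyadic grid one member of an open cover suffices. -/
theorem exists_dyadic_cells {m : ℕ} {P : ℝ → Set ((Fin m → I) × I)} {R : Set ℝ}
    (hP : ∀ a ∈ R, IsOpen (P a)) (hc : ∀ q, ∃ a ∈ R, q ∈ P a) :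
    ∃ (e : ℕ) (A : ℕ → (Fin m → ℕ) → ℝ), (∀ j s, A j s ∈ R) ∧
      ∀ (q : (Fin m → I) × I) (j : ℕ) (s : Fin m → ℕ), (j : ℝ) ≤ 2 ^ e * (q.2 : ℝ) →
        2 ^ e * (q.2 : ℝ) ≤ j + 1 →
        (∀ i, (s i : ℝ) ≤ 2 ^ e * (q.1 i : ℝ) ∧ 2 ^ e * (q.1 i : ℝ) ≤ s i + 1) → q ∈ P (A j s) := by
  obtain ⟨δ, hδ, H⟩ := lebesgue_number_lemma_of_metric (isCompact_univ : IsCompact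
    (univ : Set ((Fin m → I) × I))) (c := fun a : R => P a) (fun a => hP a a.2)
    (fun q _ => mem_iUnion.2 (by obtain ⟨a, ha, hq⟩ := hc q; exact ⟨⟨a, ha⟩, hq⟩))
  obtain ⟨e, he⟩ := exists_pow_lt_of_lt_one hδ (by norm_num : (1 / 2 : ℝ) < 1)
  have key : ∀ (j : ℕ) (s : Fin m → ℕ), ∃ a ∈ R, ∀ q : (Fin m → I) × I,
      (j : ℝ) ≤ 2 ^ e * (q.2 : ℝ) → 2 ^ e * (q.2 : ℝ) ≤ j + 1 →
      (∀ i, (s i : ℝ) ≤ 2 ^ e * (q.1 i : ℝ) ∧ 2 ^ e * (q.1 i : ℝ) ≤ s i + 1) → q ∈ P a := by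
    intro j s
    by_cases h : ∃ q₀ : (Fin m → I) × I, (j : ℝ) ≤ 2 ^ e * (q₀.2 : ℝ) ∧
      2 ^ e * (q₀.2 : ℝ) ≤ j + 1 ∧
      ∀ i, (s i : ℝ) ≤ 2 ^ e * (q₀.1 i : ℝ) ∧ 2 ^ e * (q₀.1 i : ℝ) ≤ s i + 1
    · obtain ⟨q₀, h1, h2, h3⟩ := h
      obtain ⟨a, ha⟩ := H q₀ (mem_univ _)
      refine ⟨a, a.2, fun q g1 g2 g3 => ha ?_⟩
      rw [mem_ball]
      refine lt_of_le_of_lt ?_ he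
      rw [Prod.dist_eq, max_le_iff, dist_pi_le_iff (by positivity)]
      exact ⟨fun i => abs_sub_le_of_same_cell (g3 i).1 (g3 i).2 (h3 i).1 (h3 i).2,
        abs_sub_le_of_same_cell g1 g2 h1 h2⟩
    · obtain ⟨a, ha, -⟩ := hc (fun _ => 0, 0)
      exact ⟨a, ha, fun q g1 g2 g3 => (h ⟨q, g1, g2, g3⟩).elim⟩
  choose A hA hA' using key
  exact ⟨e, A, hA, fun q j s => hA' j s q⟩

variable {n : ℕ} {L : Type*} {k : Fin n} {w : (Fin n → ℝ) × L → ℝ}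

/-- Configurations all of whose particles at height `a` have small weight. -/
def lightAt (k : Fin n) (w : (Fin n → ℝ) × L → ℝ) (a : ℝ) : Set (Cfg (wBoth k w) (cube n L)) :=
  {s | ∀ y ∈ s, y.1 k = a → w y < 1 / 4}

theorem exists_lightAt (s : Cfg (wBoth k w) (cube n L)) :
    ∃ a ∈ Ioo (0 : ℝ) 1, s ∈ lightAt k w a := by
  have hf : ((fun y : (Fin n → ℝ) × L => y.1 k) '' s.carrier).Finite := s.finite.image _
  obtain ⟨a, ha, ha'⟩ := ((Ioo_infinite (zero_lt_one (α := ℝ))).sdiff hf).nonempty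
  exact ⟨a, ha, fun y hy hya => (ha' ⟨y, hy, hya⟩).elim⟩

variable [TopologicalSpace L]

theorem IsWeight.isOpen_lightAt (hw : IsWeight k w) {a : ℝ} (ha : a ∈ Ioo (0 : ℝ) 1) :
    IsOpen (lightAt k w a) := by
  classical
  refine isOpen_iff_mem_nhds.2 fun s hs => ?_
  have hδ : 0 < min (1 / 4) (min a (1 - a)) :=
    lt_min (by norm_num) (lt_min ha.1 (by linarith [ha.2]))
  have hck : Continuous fun x : (Fin n → ℝ) × L => x.1 k := by fun_prop
  have hN : ∀ y ∈ s, {x : (Fin n → ℝ) × L | x.1 k = a → w x < 1 / 4} ∈ 𝓝 y := fun y hy => by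
    change ∀ᶠ x in 𝓝 y, x.1 k = a → w x < 1 / 4
    by_cases hya : y.1 k = a
    · filter_upwards [hw.cont.continuousAt.eventually_lt_const (hs y hy hya)] with x hx _ using hx
    · filter_upwards [hck.continuousAt.eventually_ne hya] with x hx h using (hx h).elim
  filter_upwards [Cfg.near_mem_nhds hw.continuous_wBoth hN hδ] with t ht
  obtain ⟨φ, h1, -, h3⟩ := ht
  intro z hz hza
  by_cases h : z ∈ φ '' s.carrier
  · obtain ⟨y, hy, rfl⟩ := h
    exact (h1 y hy).2 hza
  · have h4 := h3 z hz h
    rw [wBoth, hza, min_lt_iff] at h4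
    rcases h4 with h4 | h4
    · exact h4.trans_le (min_le_left _ _)
    · exact (h4.not_ge (min_le_right _ _)).elim

/-- Lifting over a box for maps which can be thinned out locally. -/
theorem IsWeight.exists_lift_cube (hw : IsWeight k w) [PathConnectedSpace L] {l₀ : L}
    (hl₀ : ∀ m, w (m, l₀) ≤ 0)
    (p : C(Cfg (wUp k w) (slab L k (Ici (-1))), Cfg (wBoth k w) (cube n L)))
    (hp : ∀ s y, y ∈ p s ↔ 0 < wBoth k w y ∧ y ∈ s) {m : ℕ}
    (β β' : C((Fin m → I) × I, Cfg (wBoth k w) (cube n L)))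
    (hβ : ∀ a ∈ Ioo (0 : ℝ) 1, ∀ q, β q ∈ lightAt k w a → β' q ∈ noAt k w a)
    (hβ1 : ∀ z, β' (z, 1) = ∅) (l : (Fin m → I) × I → Cfg (wUp k w) (slab L k (Ici (-1))))
    (hl : ContinuousOn l (boxJ (Cube.boundary (Fin m))))
    (hpl : ∀ q ∈ boxJ (Cube.boundary (Fin m)), p (l q) = β' q) :
    ∃ (Φ : C(((Fin m → I) × I) × I, Cfg (wBoth k w) (cube n L)))
      (Λ : C((Fin m → I) × I, Cfg (wUp k w) (slab L k (Ici (-1))))),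
      (∀ q, Φ (q, 0) = β' q) ∧ (∀ q ∈ boxJ (Cube.boundary (Fin m)), ∀ v, Φ (q, v) = β' q) ∧
      EqOn Λ l (boxJ (Cube.boundary (Fin m))) ∧ (∀ q, p (Λ q) = Φ (q, 1)) ∧
      ∀ z v, Φ ((z, 1), v) = ∅ := by
  obtain ⟨e, A, hA, hA'⟩ := exists_dyadic_cells (P := fun a => β ⁻¹' lightAt k w a)
    (fun a ha => (hw.isOpen_lightAt ha).preimage β.continuous) fun q => exists_lightAt (β q)
  let S : ℕ → (Fin m → ℕ) → Set ℝ := fun j s => {a | j < 2 ^ e → a = A j s}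
  have hS : ∀ j s, j < 2 ^ e → S j s = {A j s} := fun j s hj => by
    ext a
    simp [S, hj]
  have hS' : ∀ j s, ¬ j < 2 ^ e → S j s = univ := fun j s hj => by
    ext a
    simp [S, hj]
  have hB := BoxLift.grid (p := p) (N := noAt k w) (ok := fun V W => V.Finite ∧ V.Nonempty ∧
      V ⊆ Ioo 0 1 ∧ V ⊆ W ∧ (W = univ ∨ W.Finite ∧ W ⊆ Ioo 0 1))
    (fun V W V' W' h h' => ⟨h.1.union h'.1, h.2.1.inl, union_subset h.2.2.1 h'.2.2.1,
      union_subset_union h.2.2.2.1 h'.2.2.2.1, by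
        rcases h.2.2.2.2 with rfl | h1
        · exact Or.inl (univ_union _)
        rcases h'.2.2.2.2 with rfl | h2
        · exact Or.inl (union_univ _)
        exact Or.inr ⟨h1.1.union h2.1, union_subset h1.2 h2.2⟩⟩)
    (fun Q _ bd hQ V W h => hw.boxLift hl₀ p hp hQ h.1 h.2.1 h.2.2.1 h.2.2.2.1 h.2.2.2.2) e e m S
    fun j hj s => by
      rw [hS j s hj]
      refine ⟨finite_singleton _, singleton_nonempty _, singleton_subset_iff.2 (hA j s),
        subset_union_left, ?_⟩
      by_cases hj' : j + 1 < 2 ^ e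
      · rw [hS _ s hj']
        exact Or.inr ⟨(finite_singleton _).union (finite_singleton _),
          union_subset (singleton_subset_iff.2 (hA j s)) (singleton_subset_iff.2 (hA _ s))⟩
      · rw [hS' _ s hj']
        exact Or.inl (union_univ _)
  obtain ⟨Φ, Λ, h1, h2, h3⟩ := hB β' (fun q a ha => by
    obtain ⟨j, hj1, hj2, s, hs, haS⟩ := ha
    by_cases hj : j < 2 ^ e
    · rw [haS hj]
      exact hβ _ (hA j s) q (hA' q j s hj1 hj2 hs)
    · have hq : q.2 = 1 := by
        have : (2 : ℝ) ^ e ≤ j := by exact_mod_cast not_lt.1 hj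
        have hp : (0 : ℝ) < 2 ^ e := by positivity
        exact Subtype.ext (le_antisymm q.2.2.2 (by
          change (1 : ℝ) ≤ q.2
          by_contra! hlt
          nlinarith))
      obtain ⟨z, t⟩ := q
      subst hq
      rw [hβ1]
      exact fun y hy => hy.elim) l hl hpl
  refine ⟨Φ, Λ, h1.zero, h1.rel, h2, h3, fun z v => Cfg.ext fun y =>
    iff_of_false (fun hy => ?_) (Cfg.notMem_empty y)⟩
  refine h1.mem (z, 1) v (y.1 k) ⟨2 ^ e, by simp, by simp, fun i => ⌊2 ^ e * (z i : ℝ)⌋₊,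
    fun i => ⟨Nat.floor_le (mul_nonneg (by positivity) (z i).2.1), (Nat.lt_floor_add_one _).le⟩,
    fun h => (lt_irrefl _ h).elim⟩ y hy rfl

end Grid

/-- A family of loops from a continuous map. -/
def LoopAt.curry {P Z : Type*} [TopologicalSpace P] [TopologicalSpace Z] {z₀ : Z}
    (F : C(P × I, Z)) (h0 : ∀ x, F (x, 0) = z₀) (h1 : ∀ x, F (x, 1) = z₀) : C(P, LoopAt Z z₀) :=
  ⟨fun x => ⟨F.curry x, h0 x, h1 x⟩, Continuous.subtype_mk F.curry.continuous _⟩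

section Scan

variable {n : ℕ} {L : Type*}

theorem hmap_add_add (k : Fin n) (a b : ℝ) (y : (Fin n → ℝ) × L) :
    hmap k (fun r => r + a) (hmap k (fun r => r + b) y) = hmap k (fun r => r + (b + a)) y := by
  rw [hmap_hmap]
  simp only [add_assoc]

variable {k : Fin n} {w : (Fin n → ℝ) × L → ℝ}

theorem hmap_add_injective (a : ℝ) (y x : (Fin n → ℝ) × L)
    (h : (hmap k (fun r => r + a) y).1 = (hmap k (fun r => r + a) x).1) : y.1 = x.1 :=
  hmap_fst_injective (add_left_injective a) y x h

theorem hmap_add_zero (y : (Fin n → ℝ) × L) : hmap k (fun r => r + 0) y = y :=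
  hmap_of_eq (by simp)

variable [TopologicalSpace L]

theorem IsWeight.exists_shift_cube (hw : IsWeight k w) :
    ∃ S : C(Cfg w (cube n L) × I, Cfg (wBoth k w) (cube n L)), ∀ s t y', y' ∈ S (s, t) ↔
      0 < wBoth k w y' ∧ ∃ y ∈ s, hmap k (fun r => r + (3 - 4 * t)) y = y' :=
  ⟨⟨_, Cfg.continuous_map (D := cube n L) (D' := cube n L) hw.cont hw.continuous_wBoth
    (fun t : I => hmap k (fun r => r + (3 - 4 * t)))
    (continuous_hmap (f := fun (t : I) r => r + (3 - 4 * (t : ℝ))) (by fun_prop))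
    (fun t => hmap_add_injective _)
    (fun t y hy _ h => (mem_cube_iff k).2 (hmap_mem_slab ((mem_cube_iff k).1 hy) (by
      have := (wBoth_pos.1 h).2
      rw [hmap_height] at this
      exact ⟨this.1.le, this.2.le⟩)))
    (fun t y _ => (min_le_left _ _).trans (hw.inv _ _).le)⟩, fun _ _ _ => Iff.rfl⟩

theorem IsWeight.exists_shift_slab (hw : IsWeight k w) :
    ∃ S : C(Cfg w (cube n L) × I, Cfg (wUp k w) (slab L k (Ici (-1)))), ∀ s t y', y' ∈ S (s, t) ↔
      0 < wUp k w y' ∧ ∃ y ∈ s, hmap k (fun r => r + (3 - 4 * t)) y = y' :=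
  ⟨⟨_, Cfg.continuous_map (D := cube n L) (D' := slab L k (Ici (-1))) hw.cont hw.continuous_wUp
    (fun t : I => hmap k (fun r => r + (3 - 4 * t)))
    (continuous_hmap (f := fun (t : I) r => r + (3 - 4 * (t : ℝ))) (by fun_prop))
    (fun t => hmap_add_injective _)
    (fun t y hy _ h => hmap_mem_slab ((mem_cube_iff k).1 hy) (by
      simp only [mem_Ici]
      linarith [(hy k).1, t.2.2]))
    (fun t y _ => (min_le_left _ _).trans (hw.inv _ _).le)⟩, fun _ _ _ => Iff.rfl⟩

theorem IsWeight.exists_shift_up (hw : IsWeight k w) :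
    ∃ S : C(Cfg (wUp k w) (slab L k (Ici (-1))) × ℝ, Cfg (wBoth k w) (cube n L)), ∀ s ρ y',
      y' ∈ S (s, ρ) ↔ 0 < wBoth k w y' ∧ ∃ y ∈ s, hmap k (fun r => r + max ρ 0) y = y' :=
  ⟨⟨_, Cfg.continuous_map (D := slab L k (Ici (-1))) (D' := cube n L) hw.continuous_wUp
    hw.continuous_wBoth (fun ρ : ℝ => hmap k (fun r => r + max ρ 0))
    (continuous_hmap (f := fun (ρ : ℝ) r => r + max ρ 0) (by fun_prop))
    (fun t => hmap_add_injective _)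
    (fun t y hy _ h => (mem_cube_iff k).2 (hmap_mem_slab hy (by
      have := (wBoth_pos.1 h).2
      rw [hmap_height] at this
      exact ⟨this.1.le, this.2.le⟩)))
    (fun t y _ => by
      simp only [wBoth, wUp, hw.inv, hmap_height]
      exact min_le_min le_rfl ((min_le_right _ _).trans (by linarith [le_max_right t 0])))⟩,
    fun _ _ _ => Iff.rfl⟩

/-- The starting time of the lift in the homotopy to a scanning map. -/
def scanTime (v t : I) : I :=
  ⟨min (2 * (t : ℝ)) 1 * max (max (t : ℝ) (1 / 2)) v, mul_nonneg
    (le_min (by linarith [t.2.1]) zero_le_one) (le_max_of_le_right v.2.1), mul_le_one₀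
    (min_le_right _ _) (le_max_of_le_right v.2.1)
    (max_le (max_le t.2.2 (by norm_num)) v.2.2)⟩

/-- The shift in the homotopy to a scanning map. -/
def scanShift (v t : I) : ℝ := 4 * max ((v : ℝ) - max (t : ℝ) (1 / 2)) 0

theorem scanShift_nonneg (v t : I) : 0 ≤ scanShift v t :=
  mul_nonneg (by norm_num) (le_max_right _ _)

theorem continuous_scanTime {P : Type*} [TopologicalSpace P] {v t : P → I} (hv : Continuous v)
    (ht : Continuous t) : Continuous fun p => scanTime (v p) (t p) :=
  Continuous.subtype_mk (by fun_prop) _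

theorem continuous_scanShift {P : Type*} [TopologicalSpace P] {v t : P → I} (hv : Continuous v)
    (ht : Continuous t) : Continuous fun p => scanShift (v p) (t p) := by
  unfold scanShift
  fun_prop

theorem scanTime_zero_left (t : I) : scanTime 0 t = t := by
  refine Subtype.ext ?_
  simp only [scanTime, Set.Icc.coe_zero]
  have := t.2.1
  rcases le_total (t : ℝ) (1 / 2) with h | h
  · rw [min_eq_left (by linarith), max_eq_right h, max_eq_left (by norm_num)]
    ring
  · rw [min_eq_right (by linarith), max_eq_left h, max_eq_left this]
    ring

theorem scanShift_zero_left (t : I) : scanShift 0 t = 0 := by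
  have : (0 : ℝ) ≤ max (t : ℝ) (1 / 2) := le_max_of_le_right (by norm_num)
  simp [scanShift]

theorem scanTime_zero_right (v : I) : scanTime v 0 = 0 := by
  refine Subtype.ext ?_
  simp [scanTime]

theorem scanTime_one_right (v : I) : scanTime v 1 = 1 := by
  refine Subtype.ext ?_
  simp only [scanTime, Set.Icc.coe_one]
  rw [min_eq_right (by norm_num), max_eq_left (a := (1 : ℝ)) (by norm_num), max_eq_left v.2.2]
  norm_num

theorem scanShift_one_right (v : I) : scanShift v 1 = 0 := by
  have : (v : ℝ) - max (1 : ℝ) (1 / 2) ≤ 0 := by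
    rw [max_eq_left (by norm_num)]
    linarith [v.2.2]
  simp only [scanShift, Set.Icc.coe_one]
  rw [max_eq_right this, mul_zero]

/-- The total shift is as for the scanning map, or both shifts move everything out of the cube. -/
theorem scan_total (v t : I) : 3 - 4 * (scanTime v t : ℝ) + scanShift v t = 3 - 4 * t ∨
    1 ≤ 3 - 4 * (scanTime v t : ℝ) + scanShift v t ∧ 1 ≤ 3 - 4 * (t : ℝ) := by
  simp only [scanTime, scanShift]
  have h0 := t.2.1
  rcases le_total (t : ℝ) (1 / 2) with h | h
  · rw [min_eq_left (by linarith), max_eq_right h]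
    rcases le_total (v : ℝ) (1 / 2) with h' | h'
    · left
      rw [max_eq_left h', max_eq_right (by linarith)]
      ring
    · right
      rw [max_eq_right h', max_eq_left (by linarith)]
      constructor <;> nlinarith [v.2.1]
  · rw [min_eq_right (by linarith), max_eq_left h]
    left
    rcases le_total (v : ℝ) t with h' | h'
    · rw [max_eq_left h', max_eq_right (by linarith)]
      ring
    · rw [max_eq_right h', max_eq_left (by linarith)]
      ring

theorem scan_total_one (t : I) : scanTime 1 t = 1 ∧ scanShift 1 t = 1 + (3 - 4 * t) ∨
    scanShift 1 t = 2 ∧ 1 ≤ 3 - 4 * (t : ℝ) := by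
  rcases le_total (t : ℝ) (1 / 2) with h | h
  · right
    simp only [scanShift, Set.Icc.coe_one]
    rw [max_eq_right h, max_eq_left (by norm_num)]
    exact ⟨by norm_num, by linarith⟩
  · left
    refine ⟨Subtype.ext ?_, ?_⟩
    · simp only [scanTime, Set.Icc.coe_one]
      rw [min_eq_right (by linarith), max_eq_left h, max_eq_right t.2.2, one_mul]
    · simp only [scanShift, Set.Icc.coe_one]
      rw [max_eq_left h, max_eq_left (by linarith [t.2.2])]
      ring

end Scan

section Step

variable {n : ℕ} {L : Type*} [TopologicalSpace L] {k : Fin n} {w : (Fin n → ℝ) × L → ℝ}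

theorem IsWeight.exists_shift_one (hw : IsWeight k w) {Q : Type*} [TopologicalSpace Q]
    (Λ : C(Q, Cfg (wUp k w) (slab L k (Ici (-1))))) (hΛ : ∀ z, ∀ y ∈ Λ z, y.1 k ≤ 0) :
    ∃ γ : C(Q, Cfg w (cube n L)), ∀ z y', y' ∈ γ z ↔
      ∃ y ∈ Λ z, hmap k (fun r => r + 1) y = y' := by
  let γ : Q → Cfg w (cube n L) := fun z =>
    { carrier := {y' | ∃ y ∈ Λ z, hmap k (fun r => r + 1) y = y'}
      finite := (Λ z).finite.image _
      mem_dom := by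
        rintro _ ⟨y, hy, rfl⟩
        refine (mem_cube_iff k).2 (hmap_mem_slab ((Λ z).mem_dom y hy) ?_)
        have h1 := ((Λ z).mem_dom y hy).2
        have h2 := hΛ z y hy
        simp only [mem_Ici] at h1
        exact ⟨by linarith, by linarith⟩
      pos := by
        rintro _ ⟨y, hy, rfl⟩
        rw [hw.inv]
        exact (wUp_pos.1 ((Λ z).pos y hy)).1
      inj := by
        rintro _ ⟨y, hy, rfl⟩ _ ⟨x, hx, rfl⟩ h
        rw [(Λ z).inj y hy x hx (hmap_add_injective _ _ _ h)] }
  have hγ : ∀ z y', y' ∈ γ z ↔ ∃ y ∈ Λ z, hmap k (fun r => r + 1) y = y' := fun _ _ => Iff.rfl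
  have hγ' : ∀ z y', y' ∈ γ z ↔ 0 < w y' ∧ ∃ y ∈ Λ z, y ∈ univ ∧ hmap k (fun r => r + 1) y = y' :=
    fun z y' => ⟨fun h => ⟨(γ z).pos _ h, by
      obtain ⟨y, hy, h⟩ := h
      exact ⟨y, hy, mem_univ _, h⟩⟩, fun ⟨_, y, hy, _, h⟩ => ⟨y, hy, h⟩⟩
  have hi : ∀ z, ∀ y ∈ Λ z, ∀ x ∈ Λ z, y ∈ univ → x ∈ univ →
      hmap k (fun r => r + 1) y = hmap k (fun r => r + 1) x → y = x := fun z y hy x hx _ _ h =>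
    (Λ z).inj y hy x hx (hmap_add_injective _ _ _ (congrArg Prod.fst h))
  refine ⟨⟨γ, continuous_iff_continuousAt.2 fun z => ?_⟩, hγ⟩
  refine Cfg.tendsto_map (w := wUp k w) (D := slab L k (Ici (-1))) hw.continuous_wUp hw.cont
    Λ.continuous.continuousAt (fun _ => hmap k (fun r => r + 1)) (hmap k (fun r => r + 1)) univ
    (Filter.Eventually.of_forall hγ') (hγ' z) (fun y _ _ => ?_) (fun _ _ => by simp)
    (fun ε hε => ⟨min ε 1, lt_min hε one_pos, Filter.Eventually.of_forall fun z' y hy _ h => ?_⟩)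
    (Filter.Eventually.of_forall hi) (hi z)
  · have : Continuous fun y : (Fin n → ℝ) × L => hmap k (fun r => r + 1) y :=
      (continuous_hmap (Z := Unit) (f := fun _ r => r + 1) (by fun_prop)).comp
        (by fun_prop : Continuous fun y : (Fin n → ℝ) × L => ((), y))
    exact this.continuousAt.tendsto.comp Filter.tendsto_snd
  · rw [hw.inv]
    have := hΛ z' y hy
    rcases min_lt_iff.1 h with h | h
    · exact h.trans_le (min_le_left _ _)
    · linarith [h.trans_le (min_le_right _ _)]

/-- `G` scans configurations through the unit interval in direction `k`. -/
def IsScan (k : Fin n) (w : (Fin n → ℝ) × L → ℝ)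
    (G : C(Cfg w (cube n L), LoopAt (Cfg (wBoth k w) (cube n L)) ∅)) : Prop :=
  ∀ s t y', y' ∈ (G s).1 t ↔
    0 < wBoth k w y' ∧ ∃ y ∈ s, hmap k (fun r => r + (3 - 4 * (t : ℝ))) y = y'

theorem IsWeight.exists_isScan (hw : IsWeight k w) :
    ∃ G : C(Cfg w (cube n L), LoopAt (Cfg (wBoth k w) (cube n L)) ∅), IsScan k w G := by
  obtain ⟨S, hS⟩ := hw.exists_shift_cube
  refine ⟨LoopAt.curry S (fun s => Cfg.ext fun y' => iff_of_false ?_ (Cfg.notMem_empty _))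
    (fun s => Cfg.ext fun y' => iff_of_false ?_ (Cfg.notMem_empty _)), fun s t y' => hS s t y'⟩
  · rw [hS]
    rintro ⟨h, y, hy, rfl⟩
    have h1 := (wBoth_pos.1 h).2.2
    have h2 := (s.mem_dom y hy k).1
    rw [hmap_height, Set.Icc.coe_zero] at h1
    linarith
  · rw [hS]
    rintro ⟨h, y, hy, rfl⟩
    have h1 := (wBoth_pos.1 h).2.1
    have h2 := (s.mem_dom y hy k).2
    rw [hmap_height, Set.Icc.coe_one] at h1
    linarith

theorem IsScan.map_empty {G : C(Cfg w (cube n L), LoopAt (Cfg (wBoth k w) (cube n L)) ∅)}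
    (hG : IsScan k w G) : G ∅ = LoopAt.const ∅ := by
  refine Subtype.ext (ContinuousMap.ext fun t => Cfg.ext fun y' =>
    iff_of_false ?_ (Cfg.notMem_empty _))
  rw [hG]
  rintro ⟨-, y, hy, -⟩
  exact Cfg.notMem_empty y hy

theorem IsScan.exists_lift (hw : IsWeight k w) [PathConnectedSpace L] {l₀ : L}
    (hl₀ : ∀ m, w (m, l₀) ≤ 0)
    {G : C(Cfg w (cube n L), LoopAt (Cfg (wBoth k w) (cube n L)) ∅)} (hG : IsScan k w G) {m : ℕ}
    (b : C(Fin m → I, LoopAt (Cfg (wBoth k w) (cube n L)) ∅))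
    (β : C((Fin m → I) × I, Cfg (wBoth k w) (cube n L)))
    (hβ : ∀ a ∈ Ioo (0 : ℝ) 1, ∀ q, β q ∈ lightAt k w a → (b q.1).1 q.2 ∈ noAt k w a)
    (a : (Fin m → I) → Cfg w (cube n L)) (ha : ContinuousOn a (Cube.boundary (Fin m)))
    (hab : ∀ z ∈ Cube.boundary (Fin m), G (a z) = b z) :
    ∃ γ : C(Fin m → I, Cfg w (cube n L)), EqOn γ a (Cube.boundary (Fin m)) ∧
      b.HomotopicRel (G.comp γ) (Cube.boundary (Fin m)) := by
  classical
  obtain ⟨S, hS⟩ := hw.exists_shift_slab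
  obtain ⟨U, hU⟩ := hw.exists_shift_up
  have hU' : ∀ s (ρ : ℝ), 0 ≤ ρ → ∀ y', y' ∈ U (s, ρ) ↔
      0 < wBoth k w y' ∧ ∃ y ∈ s, hmap k (fun r => r + ρ) y = y' := fun s ρ hρ y' => by
    rw [hU, max_eq_left hρ]
  let p : C(Cfg (wUp k w) (slab L k (Ici (-1))), Cfg (wBoth k w) (cube n L)) :=
    ⟨fun s => U (s, 0), by fun_prop⟩
  have hp : ∀ s y, y ∈ p s ↔ 0 < wBoth k w y ∧ y ∈ s := fun s y => by
    simp only [p, ContinuousMap.coe_mk, hU' _ _ le_rfl, hmap_add_zero, exists_eq_right]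
  have hS0 : ∀ s, S (s, 0) = ∅ := fun s => Cfg.ext fun y' =>
    iff_of_false (fun h => by
      obtain ⟨h, y, hy, rfl⟩ := (hS _ _ _).1 h
      have h1 := (wUp_pos.1 h).2
      have h2 := (s.mem_dom y hy k).1
      rw [hmap_height, Set.Icc.coe_zero] at h1
      linarith) (Cfg.notMem_empty _)
  have hSU : ∀ s t ρ, 0 ≤ ρ → ∀ y', y' ∈ U (S (s, t), ρ) ↔
      0 < wBoth k w y' ∧ ∃ y ∈ s, hmap k (fun r => r + (3 - 4 * (t : ℝ) + ρ)) y = y' := by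
    intro s t ρ hρ y'
    rw [hU' _ _ hρ]
    refine and_congr_right fun h0 => ⟨?_, ?_⟩
    · rintro ⟨y, hy, rfl⟩
      obtain ⟨-, x, hx, rfl⟩ := (hS _ _ _).1 hy
      exact ⟨x, hx, by rw [hmap_add_add]⟩
    · rintro ⟨x, hx, rfl⟩
      refine ⟨hmap k (fun r => r + (3 - 4 * (t : ℝ))) x, (hS _ _ _).2 ⟨wUp_pos.2 ⟨?_, ?_⟩, x, hx, rfl⟩,
        by rw [hmap_add_add]⟩
      · rw [hw.inv]
        exact s.pos x hx
      · have := (wBoth_pos.1 h0).2.2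
        rw [hmap_height] at this ⊢
        linarith
  have hSG : ∀ s t v, U (S (s, scanTime v t), scanShift v t) = (G s).1 t := by
    intro s t v
    refine Cfg.ext fun y' => ?_
    rw [hSU _ _ _ (scanShift_nonneg _ _), hG]
    rcases scan_total v t with h | ⟨h1, h2⟩
    · rw [h]
    · refine iff_of_false ?_ ?_
      · rintro ⟨h, y, hy, rfl⟩
        have h3 := (wBoth_pos.1 h).2.2
        rw [hmap_height] at h3
        linarith [(s.mem_dom y hy k).1]
      · rintro ⟨h, y, hy, rfl⟩
        have h3 := (wBoth_pos.1 h).2.2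
        rw [hmap_height] at h3
        linarith [(s.mem_dom y hy k).1]
  let β' : C((Fin m → I) × I, Cfg (wBoth k w) (cube n L)) :=
    ⟨fun q => (b q.1).1 q.2, (LoopAt.continuous_eval _).comp
      ((b.continuous.comp continuous_fst).prodMk continuous_snd)⟩
  let l : (Fin m → I) × I → Cfg (wUp k w) (slab L k (Ici (-1))) := fun q =>
    if q.1 ∈ Cube.boundary (Fin m) then S (a q.1, q.2) else ∅
  have l0 : ∀ z, l (z, 0) = ∅ := fun z => by
    by_cases hz : z ∈ Cube.boundary (Fin m)
    · simp only [l, if_pos hz, hS0]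
    · simp only [l, if_neg hz]
  have lb : ∀ z ∈ Cube.boundary (Fin m), ∀ t, l (z, t) = S (a z, t) := fun z hz t => by
    simp only [l, if_pos hz]
  have hcl : IsClosed (Cube.boundary (Fin m)) := (isCube_pi (Fin m)).isClosed
  have hl : ContinuousOn l (boxJ (Cube.boundary (Fin m))) := by
    have : boxJ (Cube.boundary (Fin m)) = {q | q.2 = 0} ∪ {q | q.1 ∈ Cube.boundary (Fin m)} := rfl
    rw [this]
    refine ContinuousOn.union_of_isClosed ?_ ?_ (isClosed_singleton.preimage continuous_snd)
      (hcl.preimage continuous_fst)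
    · refine (continuousOn_const (c := ∅)).congr ?_
      rintro ⟨z, t⟩ (rfl : t = 0)
      exact l0 z
    · have : ContinuousOn (fun q : (Fin m → I) × I => S (a q.1, q.2))
          {q | q.1 ∈ Cube.boundary (Fin m)} :=
        S.continuous.comp_continuousOn ((ha.comp continuousOn_fst fun q hq => hq).prodMk
          continuousOn_snd)
      exact this.congr fun q hq => lb q.1 hq q.2
  have hb0 : ∀ z, (b z).1 0 = ∅ := fun z => (b z).2.1
  obtain ⟨Φ, Λ, hΦ0, hΦJ, hΛl, hpΛ, hΦ1⟩ := hw.exists_lift_cube hl₀ p hp β β' hβ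
    (fun z => (b z).2.2) l hl (by
      rintro ⟨z, t⟩ hq
      by_cases hz : z ∈ Cube.boundary (Fin m)
      · rw [lb z hz]
        have := hSG (a z) t 0
        rw [scanTime_zero_left, scanShift_zero_left, hab z hz] at this
        exact this
      · obtain rfl : t = 0 := hq.resolve_right hz
        rw [l0]
        refine Eq.trans ?_ (hb0 z).symm
        exact Cfg.ext fun y => by simp [hp, Cfg.notMem_empty])
  have hΛ0 : ∀ z, Λ (z, 0) = ∅ := fun z => (hΛl (Or.inl rfl)).trans (l0 z)
  have hΛb : ∀ z ∈ Cube.boundary (Fin m), ∀ t, Λ (z, t) = S (a z, t) := fun z hz t =>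
    (hΛl (Or.inr hz)).trans (lb z hz t)
  have hΛ1 : ∀ z, ∀ y ∈ Λ (z, 1), y.1 k ≤ 0 := fun z y hy => by
    by_contra! h
    have h1 := wUp_pos.1 ((Λ (z, 1)).pos y hy)
    have : y ∈ p (Λ (z, 1)) := (hp _ _).2 ⟨wBoth_pos.2 ⟨h1.1, h, h1.2⟩, hy⟩
    rw [hpΛ, hΦ1] at this
    exact Cfg.notMem_empty y this
  obtain ⟨γ, hγ⟩ := hw.exists_shift_one ⟨fun z => Λ (z, 1), by fun_prop⟩ hΛ1
  have hUe : ∀ ρ, U (∅, ρ) = ∅ := fun ρ => Cfg.ext fun y' => by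
    simp [hU, Cfg.notMem_empty]
  let F : C((I × (Fin m → I)) × I, Cfg (wBoth k w) (cube n L)) :=
    ⟨fun q => U (Λ (q.1.2, scanTime q.1.1 q.2), scanShift q.1.1 q.2), by
      have h1 := continuous_scanTime (v := fun q : (I × (Fin m → I)) × I => q.1.1)
        (t := fun q => q.2) (by fun_prop) (by fun_prop)
      have h2 := continuous_scanShift (v := fun q : (I × (Fin m → I)) × I => q.1.1)
        (t := fun q => q.2) (by fun_prop) (by fun_prop)
      fun_prop⟩
  have hF0 : ∀ q, F (q, 0) = ∅ := fun q => by
    simp only [F, ContinuousMap.coe_mk, scanTime_zero_right, hΛ0, hUe]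
  have hF1 : ∀ q, F (q, 1) = ∅ := fun q => by
    simp only [F, ContinuousMap.coe_mk, scanTime_one_right, scanShift_one_right]
    exact (hpΛ (q.2, 1)).trans (hΦ1 _ _)
  let Φ' : C((I × (Fin m → I)) × I, Cfg (wBoth k w) (cube n L)) :=
    ⟨fun q => Φ ((q.1.2, q.2), q.1.1), by fun_prop⟩
  have hΦ'0 : ∀ q, Φ' (q, 0) = ∅ := fun q => (hΦJ _ (Or.inl rfl) _).trans (hb0 _)
  have hΦ'1 : ∀ q, Φ' (q, 1) = ∅ := fun q => hΦ1 _ _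
  have hγG : ∀ z t, U (Λ (z, scanTime 1 t), scanShift 1 t) = (G (γ z)).1 t := by
    intro z t
    refine Cfg.ext fun y' => ?_
    rw [hU' _ _ (scanShift_nonneg _ _), hG]
    rcases scan_total_one t with ⟨h1, h2⟩ | ⟨h1, h2⟩
    · rw [h1, h2]
      refine and_congr_right fun _ => ⟨?_, ?_⟩
      · rintro ⟨y, hy, rfl⟩
        exact ⟨_, (hγ _ _).2 ⟨y, hy, rfl⟩, hmap_add_add _ _ _ _⟩
      · rintro ⟨x, hx, rfl⟩
        obtain ⟨y, hy, rfl⟩ := (hγ _ _).1 hx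
        exact ⟨y, hy, (hmap_add_add _ _ _ _).symm⟩
    · refine iff_of_false ?_ ?_
      · rintro ⟨h, y, hy, rfl⟩
        have h3 := (wBoth_pos.1 h).2.2
        have h4 : (-1 : ℝ) ≤ y.1 k := ((Λ (z, scanTime 1 t)).mem_dom y hy).2
        rw [hmap_height, h1] at h3
        linarith
      · rintro ⟨h, y, hy, rfl⟩
        have h3 := (wBoth_pos.1 h).2.2
        rw [hmap_height] at h3
        linarith [((γ z).mem_dom y hy k).1]
  let c : C(Fin m → I, LoopAt (Cfg (wBoth k w) (cube n L)) ∅) :=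
    ⟨fun z => LoopAt.curry Φ' hΦ'0 hΦ'1 (1, z), by fun_prop⟩
  have hΦF : ∀ z t, Φ' ((1, z), t) = F ((0, z), t) := fun z t => by
    simp only [F, ContinuousMap.coe_mk, scanTime_zero_left, scanShift_zero_left]
    exact (hpΛ (z, t)).symm
  refine ⟨γ, fun z hz => Cfg.ext fun y' => ?_, ContinuousMap.HomotopicRel.trans (g := c) ⟨⟨⟨
    LoopAt.curry Φ' hΦ'0 hΦ'1, fun z => ?_, fun z => rfl⟩, fun v z hz => ?_⟩⟩ ⟨⟨⟨
    LoopAt.curry F hF0 hF1, fun z => ?_, fun z => ?_⟩, fun v z hz => ?_⟩⟩⟩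
  · rw [hγ]
    simp only [ContinuousMap.coe_mk, hΛb z hz]
    constructor
    · rintro ⟨y, hy, rfl⟩
      obtain ⟨-, x, hx, rfl⟩ := (hS _ _ _).1 hy
      rw [hmap_add_add, hmap_of_eq (by rw [Set.Icc.coe_one]; ring)]
      exact hx
    · intro hy
      refine ⟨hmap k (fun r => r + (3 - 4 * ((1 : I) : ℝ))) y', (hS _ _ _).2 ⟨wUp_pos.2 ⟨?_, ?_⟩, y',
        hy, rfl⟩, ?_⟩
      · rw [hw.inv]
        exact (a z).pos y' hy
      · have := ((a z).mem_dom y' hy k).2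
        rw [hmap_height, Set.Icc.coe_one]
        linarith
      · rw [hmap_add_add, hmap_of_eq (by rw [Set.Icc.coe_one]; ring)]
  · exact Subtype.ext (ContinuousMap.ext fun t => hΦ0 (z, t))
  · exact Subtype.ext (ContinuousMap.ext fun t => hΦJ (z, t) (Or.inr hz) v)
  · exact Subtype.ext (ContinuousMap.ext fun t => (hΦF z t).symm)
  · exact Subtype.ext (ContinuousMap.ext fun t => hγG z t)
  · refine Subtype.ext (ContinuousMap.ext fun t => ?_)
    change U (Λ (z, scanTime v t), scanShift v t) = Φ' ((1, z), t)
    rw [hΛb z hz, hSG, hab z hz]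
    exact (hΦJ (z, t) (Or.inr hz) 1).symm

end Step

section Flow

variable {n : ℕ} {L : Type*} [TopologicalSpace L] {k : Fin n} {w : (Fin n → ℝ) × L → ℝ}

/-- A flow decreasing the weight, compatible with changes of height, and killing light
particles. -/
structure IsFlow (k : Fin n) (w : (Fin n → ℝ) × L → ℝ)
    (κ : I → (Fin n → ℝ) × L → (Fin n → ℝ) × L) : Prop where
  cont : Continuous fun q : I × ((Fin n → ℝ) × L) => κ q.1 q.2
  zero : ∀ y, κ 0 y = y
  inj : ∀ t y x, (κ t y).1 = (κ t x).1 → y.1 = x.1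
  height : ∀ t y, (κ t y).1 k = y.1 k
  comm : ∀ t f y, κ t (hmap k f y) = hmap k f (κ t y)
  weight : ∀ t y, w (κ t y) ≤ w y
  kill : ∀ y, w y < 1 / 4 → w (κ 1 y) ≤ 0
  dom : ∀ t y, ∀ i ≠ k, 0 < w (κ t y) → y.1 i ∈ Icc (0 : ℝ) 1 → (κ t y).1 i ∈ Icc (0 : ℝ) 1

theorem IsFlow.mem_cube {κ : I → (Fin n → ℝ) × L → (Fin n → ℝ) × L} (hκ : IsFlow k w κ) {t : I}
    {y : (Fin n → ℝ) × L} (hy : y ∈ cube n L) (h : 0 < w (κ t y)) : κ t y ∈ cube n L := fun i => by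
  by_cases hi : i = k
  · subst hi
    rw [hκ.height]
    exact hy i
  · exact hκ.dom t y i hi h (hy i)

theorem IsFlow.wBoth_le {κ : I → (Fin n → ℝ) × L → (Fin n → ℝ) × L} (hκ : IsFlow k w κ) (t : I)
    (y : (Fin n → ℝ) × L) : wBoth k w (κ t y) ≤ wBoth k w y := by
  simp only [wBoth, hκ.height]
  exact min_le_min (hκ.weight t y) le_rfl

theorem IsFlow.exists_act {κ : I → (Fin n → ℝ) × L → (Fin n → ℝ) × L} (hκ : IsFlow k w κ)
    (hw : IsWeight k w) : ∃ S : C(Cfg w (cube n L) × I, Cfg w (cube n L)), ∀ s t y',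
      y' ∈ S (s, t) ↔ 0 < w y' ∧ ∃ y ∈ s, κ t y = y' :=
  ⟨⟨_, Cfg.continuous_map (D := cube n L) (D' := cube n L) hw.cont hw.cont κ hκ.cont hκ.inj
    (fun _ _ hy _ h => hκ.mem_cube hy h) (fun t y _ => hκ.weight t y)⟩, fun _ _ _ => Iff.rfl⟩

theorem IsFlow.exists_act_both {κ : I → (Fin n → ℝ) × L → (Fin n → ℝ) × L} (hκ : IsFlow k w κ)
    (hw : IsWeight k w) : ∃ S : C(Cfg (wBoth k w) (cube n L) × I, Cfg (wBoth k w) (cube n L)),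
      ∀ s t y', y' ∈ S (s, t) ↔ 0 < wBoth k w y' ∧ ∃ y ∈ s, κ t y = y' :=
  ⟨⟨_, Cfg.continuous_map (D := cube n L) (D' := cube n L) hw.continuous_wBoth hw.continuous_wBoth
    κ hκ.cont hκ.inj (fun _ _ hy _ h => hκ.mem_cube hy (wBoth_pos.1 h).1)
    (fun t y _ => hκ.wBoth_le t y)⟩, fun _ _ _ => Iff.rfl⟩

/-- Scanning in one direction is a weak equivalence. -/
theorem IsScan.hasW (hw : IsWeight k w) [PathConnectedSpace L] {l₀ : L}
    (hl₀ : ∀ m, w (m, l₀) ≤ 0) {κ : I → (Fin n → ℝ) × L → (Fin n → ℝ) × L} (hκ : IsFlow k w κ)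
    {G : C(Cfg w (cube n L), LoopAt (Cfg (wBoth k w) (cube n L)) ∅)} (hG : IsScan k w G) :
    HasW G := by
  obtain ⟨SA, hSA⟩ := hκ.exists_act hw
  obtain ⟨SB, hSB⟩ := hκ.exists_act_both hw
  have hSB0 : ∀ s, SB (s, 0) = s := fun s => Cfg.ext fun y => by
    simp only [hSB, hκ.zero, exists_eq_right, and_iff_right_iff_imp]
    exact s.pos y
  have hSA0 : ∀ s, SA (s, 0) = s := fun s => Cfg.ext fun y => by
    simp only [hSA, hκ.zero, exists_eq_right, and_iff_right_iff_imp]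
    exact s.pos y
  have hSBe : ∀ t, SB (∅, t) = ∅ := fun t => Cfg.ext fun y => by
    simp [hSB, Cfg.notMem_empty]
  have hSG : ∀ s t r, (G (SA (s, t))).1 r = SB ((G s).1 r, t) := fun s t r => Cfg.ext fun y' => by
    rw [hG, hSB]
    refine and_congr_right fun h0 => ⟨?_, ?_⟩
    · rintro ⟨x, hx, rfl⟩
      obtain ⟨-, y, hy, rfl⟩ := (hSA _ _ _).1 hx
      rw [← hκ.comm] at h0 ⊢
      exact ⟨_, (hG _ _ _).2 ⟨h0.trans_le (hκ.wBoth_le _ _), y, hy, rfl⟩, rfl⟩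
    · rintro ⟨x, hx, rfl⟩
      obtain ⟨-, y, hy, rfl⟩ := (hG _ _ _).1 hx
      rw [hκ.comm] at h0 ⊢
      refine ⟨_, (hSA _ _ _).2 ⟨?_, y, hy, rfl⟩, rfl⟩
      have := (wBoth_pos.1 h0).1
      rwa [hw.inv] at this
  refine HasW.of_pi fun m b a ha hab => ?_
  let β : C((Fin m → I) × I, Cfg (wBoth k w) (cube n L)) :=
    ⟨fun q => (b q.1).1 q.2, (LoopAt.continuous_eval _).comp
      ((b.continuous.comp continuous_fst).prodMk continuous_snd)⟩
  let B : C(((Fin m → I) × I) × I, Cfg (wBoth k w) (cube n L)) :=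
    ⟨fun q => SB (β (q.1.1, q.2), q.1.2), by fun_prop⟩
  let b' : C((Fin m → I) × I, LoopAt (Cfg (wBoth k w) (cube n L)) ∅) := LoopAt.curry B
    (fun q => by
      change SB ((b q.1).1 0, q.2) = ∅
      rw [(b q.1).2.1, hSBe])
    (fun q => by
      change SB ((b q.1).1 1, q.2) = ∅
      rw [(b q.1).2.2, hSBe])
  have hb' : ∀ q r, (b' q).1 r = SB ((b q.1).1 r, q.2) := fun _ _ => rfl
  have hGb : ∀ z ∈ Cube.boundary (Fin m), ∀ t, G (SA (a z, t)) = b' (z, t) := fun z hz t =>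
    Subtype.ext (ContinuousMap.ext fun r => by rw [hSG, hb', hab z hz])
  obtain ⟨g, hg, h⟩ := HasW.of_pair_homotopy (f := G) (isCube_pi (Fin m)) b'
    (fun q => SA (a q.1, q.2)) (SA.continuous.comp_continuousOn
      ((ha.comp continuousOn_fst fun q hq => hq.1).prodMk continuousOn_snd))
    (fun z hz t => hGb z hz t) b ⟨fun z => b' (z, 1), by fun_prop⟩
    (fun z => Subtype.ext (ContinuousMap.ext fun r => by rw [hb', hSB0])) (fun z => rfl) (by
      obtain ⟨γ, hγ, h⟩ := hG.exists_lift hw hl₀ ⟨fun z => b' (z, 1), by fun_prop⟩ β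
        (fun c hc q hq y' hy' hyc => by
          obtain ⟨h0, y, hy, rfl⟩ := (hSB _ _ _).1 hy'
          rw [hκ.height] at hyc
          exact ((wBoth_pos.1 h0).1).not_ge (hκ.kill y (hq y hy hyc)))
        (fun z => SA (a z, 1))
        (SA.continuous.comp_continuousOn (ha.prodMk continuousOn_const))
        (fun z hz => hGb z hz 1)
      exact ⟨γ, fun z hz => hγ hz, h⟩)
  exact ⟨g, fun z hz => by rw [hg z hz, hSA0], h⟩

end Flow

/-! ### Adding a whisker to a pointed space -/

/-- The space `X` with an interval attached at `x₀`. -/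
def Whisker (X : Type*) (x₀ : X) : Type _ :=
  Quot fun a b : X ⊕ I => a = Sum.inl x₀ ∧ b = Sum.inr 0

namespace Whisker

variable {X Y : Type*} {x₀ : X}

/-- The inclusion of the space. -/
def inl (x : X) : Whisker X x₀ := Quot.mk _ (Sum.inl x)

/-- The inclusion of the interval. -/
def inr (s : I) : Whisker X x₀ := Quot.mk _ (Sum.inr s)

theorem inl_base : (inl x₀ : Whisker X x₀) = inr 0 := Quot.sound ⟨rfl, rfl⟩

theorem ind {P : Whisker X x₀ → Prop} (h1 : ∀ x, P (inl x)) (h2 : ∀ s, P (inr s)) (a) : P a :=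
  Quot.ind (Sum.rec h1 h2) a

variable [TopologicalSpace X] [TopologicalSpace Y]

instance : TopologicalSpace (Whisker X x₀) :=
  inferInstanceAs (TopologicalSpace (Quot _))

theorem continuous_inl : Continuous (inl : X → Whisker X x₀) :=
  continuous_quot_mk.comp _root_.continuous_inl

theorem continuous_inr : Continuous (inr : I → Whisker X x₀) :=
  continuous_quot_mk.comp _root_.continuous_inr

theorem exists_desc (f : C(X, Y)) (g : C(I, Y)) (h : f x₀ = g 0) :
    ∃ F : C(Whisker X x₀, Y), (∀ x, F (inl x) = f x) ∧ ∀ s, F (inr s) = g s :=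
  ⟨⟨Quot.lift (Sum.elim f g) (by rintro _ _ ⟨rfl, rfl⟩; exact h),
    continuous_quot_lift _ (f.continuous.sumElim g.continuous)⟩, fun _ => rfl, fun _ => rfl⟩

theorem exists_desc_homotopy (f : C(I × X, Y)) (g : C(I × I, Y)) (h : ∀ t, f (t, x₀) = g (t, 0)) :
    ∃ F : C(I × Whisker X x₀, Y),
      (∀ t x, F (t, inl x) = f (t, x)) ∧ ∀ t s, F (t, inr s) = g (t, s) := by
  obtain ⟨F, h1, h2⟩ := exists_desc (x₀ := x₀) (f.comp ⟨Prod.swap, continuous_swap⟩).curry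
    (g.comp ⟨Prod.swap, continuous_swap⟩).curry (ContinuousMap.ext h)
  refine ⟨⟨fun p => F p.2 p.1, by fun_prop⟩, fun t x => ?_, fun t s => ?_⟩
  · simp [h1]
  · simp [h2]

instance [PathConnectedSpace X] : PathConnectedSpace (Whisker X x₀) := by
  have key : ∀ a : Whisker X x₀, Joined (inl x₀) a := by
    refine ind (fun x => ?_) fun s => ?_
    · obtain ⟨p⟩ := PathConnectedSpace.joined x₀ x
      exact ⟨p.map continuous_inl⟩
    · rw [inl_base]
      exact ⟨⟨⟨fun t => inr (t * s), continuous_inr.comp (by fun_prop)⟩, by simp, by simp⟩⟩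
  exact ⟨⟨inl x₀⟩, fun a b => (key a).symm.trans (key b)⟩

end Whisker

/-- The maps on a space with a whisker used to compare different label spaces. -/
structure WhiskerMaps (X : Type*) [TopologicalSpace X] (x₀ : X) where
  /-- the weight of a label -/
  u : C(Whisker X x₀, ℝ)
  /-- the retraction to the original space -/
  r : C(Whisker X x₀, X)
  /-- moving the base point along the whisker -/
  push : C(I × X, Whisker X x₀)
  /-- the extension of `push` to the whisker -/
  pull : C(I × Whisker X x₀, Whisker X x₀)
  /-- expansion of the whisker -/
  flow : C(I × Whisker X x₀, Whisker X x₀)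
  u_end : u (Whisker.inr 1) = 0
  r_eq : ∀ a, u a < 1 → r a = x₀
  push_zero : ∀ x, r (push (0, x)) = x
  push_base : ∀ t, r (push (t, x₀)) = x₀
  push_one_base : u (push (1, x₀)) = 0
  pull_zero : ∀ a, pull (0, a) = a
  pull_one : ∀ a, pull (1, a) = push (1, r a)
  u_pull : ∀ t a, u (pull (t, a)) ≤ u a
  flow_zero : ∀ a, flow (0, a) = a
  u_flow : ∀ t a, u (flow (t, a)) ≤ u a
  flow_one : ∀ a, u a < 1 / 4 → u (flow (1, a)) = 0

theorem IsWellPointed.nonempty_whiskerMaps {X : Type uWP} [TopologicalSpace X] {x₀ : X}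
    (h : IsWellPointed X x₀) : Nonempty (WhiskerMaps X x₀) := by
  obtain ⟨u, u1, u2⟩ := Whisker.exists_desc (x₀ := x₀) (ContinuousMap.const X (1 : ℝ))
    ⟨fun s : I => 1 - (s : ℝ), by fun_prop⟩ (by simp)
  obtain ⟨r, r1, r2⟩ := Whisker.exists_desc (x₀ := x₀) (ContinuousMap.id X)
    (ContinuousMap.const I x₀) (by simp)
  obtain ⟨G, G1, G2⟩ := h (Whisker X x₀) inferInstance ⟨Whisker.inl, Whisker.continuous_inl⟩
    ⟨Whisker.inr, Whisker.continuous_inr⟩ Whisker.inl_base.symm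
  obtain ⟨K, K1, K2⟩ := Whisker.exists_desc_homotopy (x₀ := x₀) G
    ⟨fun p : I × I => Whisker.inr (max p.2 p.1), Whisker.continuous_inr.comp (by fun_prop)⟩
    (fun t => by simp [G2])
  obtain ⟨F, F1, F2⟩ := Whisker.exists_desc_homotopy (x₀ := x₀)
    ⟨fun p : I × X => (Whisker.inl p.2 : Whisker X x₀), Whisker.continuous_inl.comp (by fun_prop)⟩
    ⟨fun p : I × I => Whisker.inr (projIcc 0 1 zero_le_one ((p.2 : ℝ) * (1 + p.1 / 3))),
      Whisker.continuous_inr.comp (continuous_projIcc.comp (by fun_prop))⟩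
    (fun t => by simp [Whisker.inl_base])
  simp only [ContinuousMap.coe_mk, ContinuousMap.const_apply, ContinuousMap.id_apply] at *
  have hu : ∀ a, u a ≤ 1 := by
    refine Whisker.ind (fun x => ?_) fun s => ?_
    · simp [u1]
    · rw [u2]
      linarith [s.2.1]
  refine ⟨⟨u, r, G, K, F, by simp [u2], ?_, fun x => ?_,
    fun t => ?_, ?_, ?_, ?_, ?_, ?_, ?_, ?_⟩⟩
  · refine Whisker.ind (fun x hx => ?_) fun s _ => r2 s
    simp [u1] at hx
  · rw [G1, r1]
  · rw [G2, r2]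
  · rw [G2, u2]
    simp
  · refine Whisker.ind (fun x => ?_) fun s => ?_
    · rw [K1, G1]
    · rw [K2, max_eq_left unitInterval.nonneg']
  · refine Whisker.ind (fun x => ?_) fun s => ?_
    · rw [K1, r1]
    · rw [K2, r2, G2, max_eq_right unitInterval.le_one']
  · intro t
    refine Whisker.ind (fun x => ?_) fun s => ?_
    · rw [u1]
      exact hu _
    · rw [K2, u2, u2]
      have : (s : ℝ) ≤ (max s t : I) := Subtype.coe_le_coe.2 (le_max_left s t)
      linarith
  · refine Whisker.ind (fun x => F1 _ _) fun s => ?_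
    rw [F2]
    simp
  · intro t
    refine Whisker.ind (fun x => ?_) fun s => ?_
    · rw [F1]
    · rw [F2, u2, u2, coe_projIcc]
      have : (s : ℝ) ≤ max 0 (min 1 ((s : ℝ) * (1 + (t : ℝ) / 3))) := by
        refine le_max_of_le_right (le_min s.2.2 ?_)
        nlinarith [s.2.1, t.2.1, mul_nonneg s.2.1 t.2.1]
      linarith
  · refine Whisker.ind (fun x hx => ?_) fun s hs => ?_
    · rw [u1] at hx
      norm_num at hx
    · rw [u2] at hs
      rw [F2, u2, projIcc_of_right_le]
      · simp
      · rw [Set.Icc.coe_one]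
        linarith

/-! ### The weights of the successive scanning steps -/

section Weights

variable {n : ℕ} {L : Type*} {u : L → ℝ}

/-- The weight after scanning in the first `k` directions. -/
def wt (n : ℕ) (u : L → ℝ) : ℕ → (Fin n → ℝ) × L → ℝ
  | 0 => fun y => u y.2
  | k + 1 => if h : k < n then wBoth ⟨k, h⟩ (wt n u k) else wt n u k

theorem wt_succ {k : ℕ} (h : k < n) : wt n u (k + 1) = wBoth ⟨k, h⟩ (wt n u k) := dif_pos h

theorem forall_lt_succ_iff {k : ℕ} (h : k < n) {P : Fin n → Prop} :
    (∀ i : Fin n, (i : ℕ) < k + 1 → P i) ↔ (∀ i : Fin n, (i : ℕ) < k → P i) ∧ P ⟨k, h⟩ := by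
  refine ⟨fun H => ⟨fun i hi => H i (by omega), H _ (Nat.lt_succ_self k)⟩, fun H i hi => ?_⟩
  rcases Nat.lt_succ_iff_lt_or_eq.1 hi with hi | hi
  · exact H.1 i hi
  · exact (Fin.ext hi : i = ⟨k, h⟩) ▸ H.2

theorem le_wt (c : ℝ) (y : (Fin n → ℝ) × L) : ∀ k ≤ n, (c ≤ wt n u k y ↔
    c ≤ u y.2 ∧ ∀ i : Fin n, (i : ℕ) < k → c ≤ y.1 i ∧ c ≤ 1 - y.1 i)
  | 0, _ => by simp [wt]
  | k + 1, hk => by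
    rw [wt_succ hk, forall_lt_succ_iff hk, wBoth, le_min_iff, le_wt c y k (by omega), le_min_iff,
      and_assoc]

theorem wt_pos_iff (y : (Fin n → ℝ) × L) : ∀ k ≤ n, (0 < wt n u k y ↔
    0 < u y.2 ∧ ∀ i : Fin n, (i : ℕ) < k → 0 < y.1 i ∧ y.1 i < 1)
  | 0, _ => by simp [wt]
  | k + 1, hk => by
    rw [wt_succ hk, forall_lt_succ_iff hk, wBoth_pos, wt_pos_iff y k (by omega), and_assoc]

theorem continuous_wt [TopologicalSpace L] (hu : Continuous u) : ∀ k, Continuous (wt n u k)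
  | 0 => by
    unfold wt
    fun_prop
  | k + 1 => by
    have := continuous_wt hu k
    by_cases h : k < n
    · rw [wt_succ h]
      unfold wBoth
      fun_prop
    · rwa [wt, dif_neg h]

theorem isWeight_wt [TopologicalSpace L] (hu : Continuous u) {k : ℕ} (h : k < n) :
    IsWeight ⟨k, h⟩ (wt n u k) := by
  refine ⟨continuous_wt hu k, fun f y => eq_of_forall_le_iff fun c => ?_⟩
  rw [le_wt _ _ _ h.le, le_wt _ _ _ h.le]
  refine and_congr Iff.rfl (forall₂_congr fun i hi => ?_)
  rw [hmap_other]
  rintro rfl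
  exact lt_irrefl _ hi

/-- Expansion of the first `k` coordinates from the center of the cube. -/
def expand (k : ℕ) (t : I) (p : Fin n → ℝ) : Fin n → ℝ := fun i =>
  if (i : ℕ) < k then 1 / 2 + (1 + t) * (p i - 1 / 2) else p i

theorem continuous_expand (k : ℕ) : Continuous fun q : I × (Fin n → ℝ) => expand k q.1 q.2 := by
  refine continuous_pi fun i => ?_
  unfold expand
  split_ifs <;> fun_prop

theorem expand_zero (k : ℕ) (p : Fin n → ℝ) : expand k 0 p = p := by
  funext i
  unfold expand
  split_ifs <;> simp

theorem expand_of_not_lt {k : ℕ} (t : I) (p : Fin n → ℝ) {i : Fin n} (hi : ¬ (i : ℕ) < k) :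
    expand k t p i = p i := if_neg hi

theorem expand_of_lt {k : ℕ} (t : I) (p : Fin n → ℝ) {i : Fin n} (hi : (i : ℕ) < k) :
    expand k t p i = 1 / 2 + (1 + t) * (p i - 1 / 2) := if_pos hi

theorem expand_injective (k : ℕ) (t : I) : Function.Injective (expand k t : (Fin n → ℝ) → _) := by
  intro p q h
  funext i
  have hi := congrFun h i
  by_cases hk : (i : ℕ) < k
  · rw [expand_of_lt _ _ hk, expand_of_lt _ _ hk] at hi
    have : (1 + (t : ℝ)) ≠ 0 := by linarith [t.2.1]
    linarith [mul_left_cancel₀ this (add_left_cancel hi)]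
  · rwa [expand_of_not_lt _ _ hk, expand_of_not_lt _ _ hk] at hi

/-- Expansion decreases the distance to the boundary. -/
theorem le_of_le_expand {k : ℕ} {t : I} {p : Fin n → ℝ} {i : Fin n} {c : ℝ} (hc : c ≤ 1 / 2)
    (h : c ≤ expand k t p i ∧ c ≤ 1 - expand k t p i) : c ≤ p i ∧ c ≤ 1 - p i := by
  by_cases hi : (i : ℕ) < k
  · rw [expand_of_lt _ _ hi] at h
    have ht := t.2.1
    constructor <;> nlinarith
  · rwa [expand_of_not_lt _ _ hi] at h

theorem wt_expand_le {k : ℕ} (hk : k ≤ n) (t : I) (y : (Fin n → ℝ) × L) {a : L}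
    (ha : u a ≤ u y.2) : wt n u k (expand k t y.1, a) ≤ wt n u k y := by
  refine le_of_forall_le fun c hc => ?_
  rw [le_wt _ _ _ hk] at hc ⊢
  exact ⟨hc.1.trans ha, fun i hi => le_of_le_expand (by linarith [(hc.2 i hi).1, (hc.2 i hi).2])
    (hc.2 i hi)⟩

variable {X : Type*} [TopologicalSpace X] {x₀ : X}

theorem WhiskerMaps.isFlow (W : WhiskerMaps X x₀) {k : ℕ} (h : k < n) :
    IsFlow ⟨k, h⟩ (wt n W.u k) (fun t y => (expand k t y.1, W.flow (t, y.2))) where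
  cont := ((continuous_expand k).comp (by fun_prop : Continuous
    fun q : I × ((Fin n → ℝ) × Whisker X x₀) => (q.1, q.2.1))).prodMk (by fun_prop)
  zero y := by simp [expand_zero, W.flow_zero]
  inj t y x hyx := expand_injective k t hyx
  height t y := expand_of_not_lt _ _ (lt_irrefl k)
  comm t f y := by
    refine Prod.ext (funext fun i => ?_) rfl
    by_cases hi : i = ⟨k, h⟩
    · subst hi
      rw [hmap_height]
      simp only [expand, lt_irrefl, if_false, hmap_height]
    · rw [hmap_other _ _ hi]
      simp only [expand, hmap_other _ _ hi]
  weight t y := wt_expand_le h.le t y (W.u_flow t y.2)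
  kill y hy := by
    by_contra! h0
    rw [← not_le] at hy
    refine hy ?_
    rw [wt_pos_iff _ _ h.le] at h0
    rw [le_wt _ _ _ h.le]
    refine ⟨?_, fun i hi => ?_⟩
    · by_contra! hu
      exact h0.1.ne' (W.flow_one _ hu)
    · have := h0.2 i hi
      simp only [expand_of_lt _ _ hi, Set.Icc.coe_one] at this
      constructor <;> linarith
  dom t y i hi h0 hy := by
    by_cases hk : (i : ℕ) < k
    · have := ((wt_pos_iff _ _ h.le).1 h0).2 i hk
      exact ⟨this.1.le, this.2.le⟩
    · simpa only [expand_of_not_lt _ _ hk] using hy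

/-- Iterated scanning. -/
theorem WhiskerMaps.exists_hasW_nLoop [PathConnectedSpace X] (W : WhiskerMaps X x₀) (n : ℕ) :
    ∃ F : C(Cfg (wt n W.u 0) (cube n (Whisker X x₀)),
      NLoop n (Cfg (wt n W.u n) (cube n (Whisker X x₀))) ∅), HasW F := by
  refine _root_.exists_hasW_nLoop (A := fun k => Cfg (wt n W.u k) (cube n (Whisker X x₀)))
    (fun k => ∅) n (fun k hk => ?_) n le_rfl
  have key : ∀ w, w = wBoth ⟨k, hk⟩ (wt n W.u k) →
      ∃ G : C(Cfg (wt n W.u k) (cube n (Whisker X x₀)), LoopAt (Cfg w (cube n (Whisker X x₀))) ∅),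
        G ∅ = LoopAt.const _ ∧ HasW G := by
    rintro _ rfl
    have hw := isWeight_wt W.u.continuous hk
    obtain ⟨G, hG⟩ := hw.exists_isScan
    exact ⟨G, hG.map_empty, hG.hasW hw (l₀ := Whisker.inr 1)
      (fun m => not_lt.1 fun h => ((wt_pos_iff _ _ hk.le).1 h).1.ne' W.u_end) (W.isFlow hk)⟩
  exact key _ (wt_succ hk)

end Weights

/-! ### Labelled configurations are determined by their labels -/

/-- The label of the family `P`, `l` of labelled points at the point `p`. -/
def famLabel {ι E X : Type*} (x₀ : X) (P : ι → E) (l : ι → X) (p : E) : X :=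
  haveI := Classical.propDecidable (∃ i, P i = p)
  if h : ∃ i, P i = p then l h.choose else x₀

section FamLabel

variable {ι ι' E X : Type*} {x₀ : X} {P : ι → E} {l : ι → X} {P' : ι' → E} {l' : ι' → X}

theorem famLabel_apply (hP : Function.Injective P) (i : ι) : famLabel x₀ P l (P i) = l i := by
  have h : ∃ j, P j = P i := ⟨i, rfl⟩
  rw [famLabel, dif_pos h]
  exact congrArg l (hP h.choose_spec)

theorem famLabel_of_notMem {p : E} (h : ∀ i, P i ≠ p) : famLabel x₀ P l p = x₀ :=
  dif_neg fun ⟨i, hi⟩ => h i hi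

theorem famLabel_eq_base {p : E} (h : ∀ i, P i = p → l i = x₀) : famLabel x₀ P l p = x₀ := by
  by_cases h' : ∃ i, P i = p
  · rw [famLabel, dif_pos h']
    exact h _ h'.choose_spec
  · exact dif_neg h'

theorem famLabel_congr {E' : Type*} {Q : ι' → E'} {p : E} {q : E'} (hP : Function.Injective P)
    (hQ : Function.Injective Q) (h : ∀ i, P i = p → l i ≠ x₀ → ∃ j, Q j = q ∧ l' j = l i)
    (h' : ∀ j, Q j = q → l' j ≠ x₀ → ∃ i, P i = p ∧ l i = l' j) :
    famLabel x₀ P l p = famLabel x₀ Q l' q := by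
  by_cases H : ∃ i, P i = p ∧ l i ≠ x₀
  · obtain ⟨i, rfl, hi⟩ := H
    obtain ⟨j, rfl, hj⟩ := h i rfl hi
    rw [famLabel_apply hP, famLabel_apply hQ, hj]
  · push Not at H
    rw [famLabel_eq_base H, famLabel_eq_base fun j hj => by
      by_contra hj'
      obtain ⟨i, hi, hij⟩ := h' j hj hj'
      exact hj' (hij ▸ H i hi)]

end FamLabel

section LabelPre

variable {M X : Type*} [TopologicalSpace M] [TopologicalSpace X] {x₀ : X}

theorem labelAt_eq_famLabel (a : LabelPre M X) (m : M) :
    labelAt x₀ a m = famLabel x₀ a.2.1.1 a.2.2 m := rfl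

theorem labelAt_apply (a : LabelPre M X) (i : Fin a.1) : labelAt x₀ a (a.2.1.1 i) = a.2.2 i :=
  famLabel_apply a.2.1.2 i

theorem LabelRel.labelAt_eq {a b : LabelPre M X} (h : LabelRel M X x₀ a b) (m : M) :
    labelAt x₀ a m = labelAt x₀ b m := by
  rw [labelAt_eq_famLabel, labelAt_eq_famLabel]
  refine famLabel_congr a.2.1.2 b.2.1.2 ?_ ?_
  · cases h with
    | perm c l e =>
      exact fun i hi _ => ⟨e.symm i, by simpa [OrdConfig.perm] using hi, by simp⟩
    | delete c l j hj =>
      intro i hi hl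
      obtain ⟨i', rfl⟩ := Fin.exists_succAbove_eq (show i ≠ j from fun h => hl (h ▸ hj))
      exact ⟨i', hi, rfl⟩
  · cases h with
    | perm c l e => exact fun i hi _ => ⟨e i, hi, rfl⟩
    | delete c l j hj => exact fun i hi _ => ⟨j.succAbove i, hi, rfl⟩

theorem LabelPre.exists_reduced (x₀ : X) : ∀ (k : ℕ) (c : OrdConfig M k) (l : Fin k → X),
    ∃ b : LabelPre M X, (Quot.mk (LabelRel M X x₀) ⟨k, c, l⟩ = Quot.mk _ b) ∧
      (∀ m, labelAt x₀ ⟨k, c, l⟩ m = labelAt x₀ b m) ∧ ∀ i, b.2.2 i ≠ x₀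
  | 0, c, l => ⟨⟨0, c, l⟩, rfl, fun _ => rfl, fun i => i.elim0⟩
  | k + 1, c, l => by
    by_cases h : ∃ i, l i = x₀
    · obtain ⟨i, hi⟩ := h
      obtain ⟨b, h1, h2, h3⟩ := LabelPre.exists_reduced x₀ k
        ⟨c.1 ∘ i.succAbove, c.2.comp Fin.succAbove_right_injective⟩ (l ∘ i.succAbove)
      have := LabelRel.delete (x₀ := x₀) c l i hi
      exact ⟨b, (Quot.sound this).trans h1, fun m => (this.labelAt_eq m).trans (h2 m), h3⟩
    · exact ⟨_, rfl, fun _ => rfl, fun i hi => h ⟨i, hi⟩⟩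

theorem LabelPre.mk_eq_of_reduced {a b : LabelPre M X} (h : ∀ m, labelAt x₀ a m = labelAt x₀ b m)
    (ha : ∀ i, a.2.2 i ≠ x₀) (hb : ∀ i, b.2.2 i ≠ x₀) :
    Quot.mk (LabelRel M X x₀) a = Quot.mk _ b := by
  have key : ∀ a b : LabelPre M X, (∀ m, labelAt x₀ a m = labelAt x₀ b m) →
      (∀ i, a.2.2 i ≠ x₀) → ∀ i, ∃ j, b.2.1.1 j = a.2.1.1 i := by
    intro a b h ha i
    by_contra! hj
    refine ha i ?_
    rw [← labelAt_apply (x₀ := x₀) a i, h]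
    exact famLabel_of_notMem hj
  choose f hf using key a b h ha
  choose g hg using key b a (fun m => (h m).symm) hb
  let e : Fin a.1 ≃ Fin b.1 := ⟨f, g, fun i => a.2.1.2 (by rw [hg, hf]),
    fun i => b.2.1.2 (by rw [hf, hg])⟩
  obtain ⟨k, c, l⟩ := a
  obtain ⟨k', c', l'⟩ := b
  obtain rfl : k = k' := Fin.equiv_iff_eq.1 ⟨e⟩
  refine (Quot.sound (LabelRel.perm c l e.symm)).trans (congrArg _ ?_)
  have h1 : OrdConfig.perm e.symm c = c' := Subtype.ext (funext fun i => hg i)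
  have h2 : l ∘ e.symm = l' := funext fun i => by
    have := h (c'.1 i)
    rw [labelAt_apply ⟨k, c', l'⟩ i, ← hg i, labelAt_apply ⟨k, c, l⟩ (g i)] at this
    exact this
  rw [h1, h2]

theorem LabelPre.mk_eq {a b : LabelPre M X} (h : ∀ m, labelAt x₀ a m = labelAt x₀ b m) :
    Quot.mk (LabelRel M X x₀) a = Quot.mk _ b := by
  obtain ⟨a', h1, h2, h3⟩ := LabelPre.exists_reduced x₀ a.1 a.2.1 a.2.2
  obtain ⟨b', g1, g2, g3⟩ := LabelPre.exists_reduced x₀ b.1 b.2.1 b.2.2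
  exact h1.trans ((LabelPre.mk_eq_of_reduced (fun m => by rw [← h2, ← g2]; exact h m) h3 g3).trans
    g1.symm)

/-- Forgetting nothing is a weak equivalence. -/
theorem LabeledConfig.hasW_toRel {N : Set M} (hN : N = ∅) :
    HasW (⟨Quot.mk _, continuous_quot_mk⟩ : C(LabeledConfig M X x₀, RelConfig M N X x₀)) := by
  subst hN
  refine HasW.of_inverse ⟨Quot.lift id ?_, continuous_quot_lift _ continuous_id⟩ (fun _ => rfl)
    (Quot.ind fun _ => rfl)
  rintro _ _ ⟨a, b, rfl, rfl, h⟩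
  exact LabelPre.mk_eq fun m => h m (notMem_empty m)

/-- The class of a representative in the relative labelled configuration space. -/
def RelConfig.mk (N : Set M) (x₀ : X) (a : LabelPre M X) : RelConfig M N X x₀ :=
  Quot.mk _ (Quot.mk _ a : LabeledConfig M X x₀)

theorem RelConfig.continuous_mk (N : Set M) : Continuous (RelConfig.mk N x₀) :=
  continuous_quot_mk.comp continuous_quot_mk

theorem RelConfig.mk_eq {N : Set M} {a b : LabelPre M X}
    (h : ∀ m ∉ N, labelAt x₀ a m = labelAt x₀ b m) : RelConfig.mk N x₀ a = RelConfig.mk N x₀ b :=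
  Quot.sound ⟨a, b, rfl, rfl, h⟩

theorem RelConfig.ind {N : Set M} {P : RelConfig M N X x₀ → Prop}
    (h : ∀ a, P (RelConfig.mk N x₀ a)) (q) : P q :=
  Quot.ind (Quot.ind h) q

/-- Functions on the relative labelled configuration space are functions of the labels. -/
theorem RelConfig.exists_desc {N : Set M} {Y : Type*} [TopologicalSpace Y] {f : LabelPre M X → Y}
    (hf : Continuous f)
    (h : ∀ a b, (∀ m ∉ N, labelAt x₀ a m = labelAt x₀ b m) → f a = f b) :
    ∃ F : C(RelConfig M N X x₀, Y), ∀ a, F (RelConfig.mk N x₀ a) = f a := by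
  let f' : LabeledConfig M X x₀ → Y := Quot.lift f fun a b hab =>
    h a b fun m _ => hab.labelAt_eq m
  have hf' : Continuous f' := continuous_quot_lift _ hf
  exact ⟨⟨Quot.lift f' (by
    rintro _ _ ⟨a, b, rfl, rfl, hab⟩
    exact h a b hab), continuous_quot_lift _ hf'⟩, fun _ => rfl⟩

theorem LabelPre.continuous_of_forall {Y : Type*} [TopologicalSpace Y] {f : LabelPre M X → Y}
    (h : ∀ k, Continuous fun p : OrdConfig M k × (Fin k → X) => f ⟨k, p⟩) : Continuous f :=
  continuous_sigma h

theorem RelConfig.exists_desc_homotopy {N : Set M} {Y : Type*} [TopologicalSpace Y]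
    {f : I × LabelPre M X → Y}
    (hf : ∀ k, Continuous fun p : I × (OrdConfig M k × (Fin k → X)) => f (p.1, ⟨k, p.2⟩))
    (h : ∀ t a b, (∀ m ∉ N, labelAt x₀ a m = labelAt x₀ b m) → f (t, a) = f (t, b)) :
    ∃ F : C(I × RelConfig M N X x₀, Y), ∀ t a, F (t, RelConfig.mk N x₀ a) = f (t, a) := by
  let f' : LabelPre M X → C(I, Y) := fun a =>
    ⟨fun t => f (t, a), (hf a.1).comp (by fun_prop : Continuous fun t : I => (t, a.2))⟩
  have hf' : Continuous f' := LabelPre.continuous_of_forall fun k =>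
    (⟨fun q => f (q.2, ⟨k, q.1⟩), (hf k).comp continuous_swap⟩ :
      C((OrdConfig M k × (Fin k → X)) × I, Y)).curry.continuous
  obtain ⟨F, hF⟩ := RelConfig.exists_desc (x₀ := x₀) (N := N) hf' fun a b hab =>
    ContinuousMap.ext fun t => h t a b hab
  exact ⟨⟨fun p => F p.2 p.1, by fun_prop⟩, fun t a => DFunLike.congr_fun (hF a) t⟩

end LabelPre

/-! ### Families of labelled points and relative labelled configurations of the cube -/

/-- The points of the cube on a face in one of the first `k` directions. -/
def faces (n k : ℕ) : Set (NCube n) := {m | ∃ i : Fin n, (i : ℕ) < k ∧ (m i = 0 ∨ m i = 1)}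

/-- The coordinates of a point of the cube. -/
def coords {n : ℕ} (m : NCube n) : Fin n → ℝ := fun i => (m i : I)

/-- The projection onto the cube. -/
def clamp {n : ℕ} (p : Fin n → ℝ) : NCube n := fun i => projIcc 0 1 zero_le_one (p i)

section Families

variable {n k : ℕ}

theorem coords_injective : Function.Injective (coords : NCube n → Fin n → ℝ) := fun _ _ h =>
  funext fun i => Subtype.ext (congrFun h i)

theorem continuous_coords : Continuous (coords : NCube n → Fin n → ℝ) :=
  continuous_pi fun i => continuous_subtype_val.comp (continuous_apply (A := fun _ => I) i)

theorem continuous_clamp : Continuous (clamp : (Fin n → ℝ) → NCube n) :=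
  continuous_pi fun i => continuous_projIcc.comp (continuous_apply i)

theorem coords_mem (m : NCube n) (i : Fin n) : coords m i ∈ Icc (0 : ℝ) 1 := (m i : I).2

theorem coords_clamp {p : Fin n → ℝ} (hp : ∀ i, p i ∈ Icc (0 : ℝ) 1) : coords (clamp p) = p :=
  funext fun i => by
    simp only [coords, clamp, projIcc_of_mem zero_le_one (hp i)]

theorem clamp_coords (m : NCube n) : clamp (coords m) = m :=
  coords_injective (coords_clamp (coords_mem m))

theorem mem_faces_iff {m : NCube n} :
    m ∈ faces n k ↔ ∃ i : Fin n, (i : ℕ) < k ∧ (coords m i = 0 ∨ coords m i = 1) := by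
  refine exists_congr fun i => and_congr_right fun _ => or_congr ?_ ?_
  · exact Subtype.ext_iff
  · exact Subtype.ext_iff

theorem notMem_faces_iff {m : NCube n} :
    m ∉ faces n k ↔ ∀ i : Fin n, (i : ℕ) < k → 0 < coords m i ∧ coords m i < 1 := by
  rw [mem_faces_iff]
  push Not
  refine forall₂_congr fun i _ => and_congr ?_ ?_
  · exact (coords_mem m i).1.lt_iff_ne'.symm
  · exact (coords_mem m i).2.lt_iff_ne.symm

theorem clamp_mem_faces {p : Fin n → ℝ} (hp : ¬ ∀ i, p i ∈ Icc (0 : ℝ) 1)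
    (hk : ∀ i : Fin n, ¬ (i : ℕ) < k → p i ∈ Icc (0 : ℝ) 1) : clamp p ∈ faces n k := by
  push Not at hp
  obtain ⟨i, hi⟩ := hp
  refine ⟨i, by_contra fun h => hi (hk i h), ?_⟩
  rw [mem_Icc, not_and_or, not_le, not_le] at hi
  exact hi.imp (fun h => projIcc_of_le_left _ h.le) fun h => projIcc_of_right_le _ h.le

variable {X : Type*} [TopologicalSpace X] {x₀ : X}

open Classical in
/-- The relative configuration with prescribed labels. -/
def relOf (k : ℕ) (x₀ : X) (f : (Fin n → ℝ) → X) : RelConfig (NCube n) (faces n k) X x₀ :=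
  if h : ∃ a : LabelPre (NCube n) X, ∀ m ∉ faces n k, labelAt x₀ a m = f (coords m) then
    RelConfig.mk _ x₀ h.choose else RelConfig.mk _ x₀ (LabelPre.empty _ X)

theorem relOf_eq {f : (Fin n → ℝ) → X} {a : LabelPre (NCube n) X}
    (h : ∀ m ∉ faces n k, labelAt x₀ a m = f (coords m)) : relOf k x₀ f = RelConfig.mk _ x₀ a := by
  have h' : ∃ a : LabelPre (NCube n) X, ∀ m ∉ faces n k, labelAt x₀ a m = f (coords m) := ⟨a, h⟩
  rw [relOf, dif_pos h']
  exact RelConfig.mk_eq fun m hm => (h'.choose_spec m hm).trans (h m hm).symm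

theorem relOf_congr {f g : (Fin n → ℝ) → X} (h : ∀ m ∉ faces n k, f (coords m) = g (coords m)) :
    relOf k x₀ f = relOf k x₀ g := by
  by_cases hf : ∃ a : LabelPre (NCube n) X, ∀ m ∉ faces n k, labelAt x₀ a m = f (coords m)
  · obtain ⟨a, ha⟩ := hf
    rw [relOf_eq ha, relOf_eq fun m hm => (ha m hm).trans (h m hm)]
  · have hg : ¬ ∃ a : LabelPre (NCube n) X, ∀ m ∉ faces n k, labelAt x₀ a m = g (coords m) :=
      fun ⟨a, ha⟩ => hf ⟨a, fun m hm => (ha m hm).trans (h m hm).symm⟩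
    rw [relOf, relOf, dif_neg hf, dif_neg hg]

variable {ι : Type*} {p : ι → Fin n → ℝ} {l : ι → X}

theorem labelAt_clamp {K : ℕ} (e : Fin K → ι) (hp : Function.Injective p)
    (hk : ∀ i, ∀ j : Fin n, ¬ (j : ℕ) < k → p i j ∈ Icc (0 : ℝ) 1)
    (he : ∀ i, (∀ j, p i j ∈ Icc (0 : ℝ) 1) → ∃ j, e j = i)
    (hc : Function.Injective fun j => clamp (p (e j))) :
    ∀ m ∉ faces n k, labelAt x₀ (⟨K, ⟨_, hc⟩, fun j => l (e j)⟩ : LabelPre (NCube n) X) m =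
      famLabel x₀ p l (coords m) := by
  intro m hm
  refine (labelAt_eq_famLabel _ m).trans (famLabel_congr hc hp
    (fun j hj _ => ⟨e j, ?_, rfl⟩) fun i hi _ => ?_)
  · change clamp (p (e j)) = m at hj
    rw [← hj]
    refine (coords_clamp ?_).symm
    by_contra h
    exact hm (hj ▸ clamp_mem_faces h (hk _))
  · obtain ⟨j, rfl⟩ := he i fun j => hi ▸ coords_mem m j
    exact ⟨j, by change clamp (p (e j)) = m; rw [hi, clamp_coords], rfl⟩

theorem exists_enum [Finite ι] (hp : Function.Injective p) :
    ∃ (K : ℕ) (e : Fin K → ι), (∀ i, (∀ j, p i j ∈ Icc (0 : ℝ) 1) → ∃ j, e j = i) ∧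
      Function.Injective fun j => clamp (p (e j)) := by
  obtain ⟨K, ⟨e'⟩⟩ := Finite.exists_equiv_fin {i // ∀ j, p i j ∈ Icc (0 : ℝ) 1}
  have he0 : ∀ j, coords (clamp (p (e'.symm j))) = p (e'.symm j) := fun j =>
    coords_clamp (e'.symm j).2
  refine ⟨K, fun j => e'.symm j, fun i hi => ⟨e' ⟨i, hi⟩, by simp⟩, fun i j hij => ?_⟩
  have := congrArg coords hij
  simp only [he0] at this
  exact e'.symm.injective (Subtype.ext (hp this))

theorem exists_labelAt_eq [Finite ι] (hp : Function.Injective p)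
    (hk : ∀ i, ∀ j : Fin n, ¬ (j : ℕ) < k → p i j ∈ Icc (0 : ℝ) 1) :
    ∃ a : LabelPre (NCube n) X, ∀ m ∉ faces n k, labelAt x₀ a m = famLabel x₀ p l (coords m) := by
  obtain ⟨K, e, he, hc⟩ := exists_enum hp
  exact ⟨_, labelAt_clamp e hp hk he hc⟩

theorem tendsto_relOf [Finite ι] {Z : Type*} {F : Filter Z} {P : Z → ι → Fin n → ℝ}
    {Λ : Z → ι → X} (hp : Function.Injective p)
    (hk : ∀ i, ∀ j : Fin n, ¬ (j : ℕ) < k → p i j ∈ Icc (0 : ℝ) 1)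
    (hP : ∀ᶠ z in F, Function.Injective (P z))
    (hPk : ∀ᶠ z in F, ∀ i, ∀ j : Fin n, ¬ (j : ℕ) < k → P z i j ∈ Icc (0 : ℝ) 1)
    (hPp : ∀ i, Filter.Tendsto (fun z => P z i) F (𝓝 (p i)))
    (hΛ : ∀ i, Filter.Tendsto (fun z => Λ z i) F (𝓝 (l i))) :
    Filter.Tendsto (fun z => relOf k x₀ (famLabel x₀ (P z) (Λ z))) F
      (𝓝 (relOf k x₀ (famLabel x₀ p l))) := by
  classical
  obtain ⟨K, e, he, hc⟩ := exists_enum hp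
  have hcl : IsClosed {q : Fin n → ℝ | ∀ j, q j ∈ Icc (0 : ℝ) 1} := by
    simp only [ofPred_forall]
    exact isClosed_iInter fun j => isClosed_Icc.preimage (continuous_apply j)
  have hPe : ∀ᶠ z in F, ∀ i, (∀ j, P z i j ∈ Icc (0 : ℝ) 1) → ∃ j, e j = i := by
    refine Filter.eventually_all.2 fun i => ?_
    by_cases hi : ∀ j, p i j ∈ Icc (0 : ℝ) 1
    · exact Filter.Eventually.of_forall fun z _ => he i hi
    · filter_upwards [(hPp i).eventually (hcl.isOpen_compl.mem_nhds hi)] with z hz hz'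
      exact (hz hz').elim
  have hcP : ∀ j, Filter.Tendsto (fun z => clamp (P z (e j))) F (𝓝 (clamp (p (e j)))) := fun j =>
    (continuous_clamp.tendsto _).comp (hPp (e j))
  have hPc : ∀ᶠ z in F, Function.Injective fun j => clamp (P z (e j)) := by
    have : ∀ᶠ z in F, ∀ i j, i ≠ j → clamp (P z (e i)) ≠ clamp (P z (e j)) := by
      refine Filter.eventually_all.2 fun i => Filter.eventually_all.2 fun j => ?_
      by_cases hij : i = j
      · exact Filter.Eventually.of_forall fun z h => (h hij).elim
      · filter_upwards [((hcP i).prodMk_nhds (hcP j)).eventually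
          ((isClosed_diagonal (X := NCube n)).isOpen_compl.mem_nhds fun h => hij (hc h))]
          with z hz _ using hz
    filter_upwards [this] with z hz i j hij
    by_contra h
    exact hz i j h hij
  let C : Z → OrdConfig (NCube n) K := fun z =>
    if h : Function.Injective fun j => clamp (P z (e j)) then ⟨_, h⟩ else ⟨_, hc⟩
  have hC : Filter.Tendsto C F (𝓝 ⟨_, hc⟩) := by
    refine (Topology.IsEmbedding.subtypeVal.tendsto_nhds_iff
      (Y := {p : Fin K → NCube n // Function.Injective p})).2 ?_
    have : Filter.Tendsto (fun z j => clamp (P z (e j))) F (𝓝 fun j => clamp (p (e j))) :=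
      tendsto_pi_nhds.2 hcP
    refine this.congr' ?_
    filter_upwards [hPc] with z hz
    have hCz : C z = ⟨_, hz⟩ := dif_pos hz
    exact (congrArg Subtype.val hCz).symm
  have hmk : Continuous fun q : OrdConfig (NCube n) K × (Fin K → X) =>
      RelConfig.mk (faces n k) x₀ ⟨K, q⟩ := (RelConfig.continuous_mk _).comp continuous_sigmaMk
  have := (hmk.tendsto (⟨_, hc⟩, fun j => l (e j))).comp
    (hC.prodMk_nhds (tendsto_pi_nhds.2 fun j => hΛ (e j)))
  rw [relOf_eq (labelAt_clamp e hp hk he hc)]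
  refine this.congr' ?_
  filter_upwards [hP, hPk, hPe, hPc] with z h1 h2 h3 h4
  rw [relOf_eq (labelAt_clamp e h1 h2 h3 h4)]
  have hCz : C z = ⟨_, h4⟩ := dif_pos h4
  exact congrArg (fun c => RelConfig.mk (faces n k) x₀ ⟨K, c, fun j => Λ z (e j)⟩) hCz

end Families

/-! ### Labelled configurations and configurations of weighted particles -/

section Comparison

variable {n k : ℕ} {X : Type*} [TopologicalSpace X] {x₀ : X}

theorem expand_pos_lt {t : I} {p : Fin n → ℝ} {i : Fin n}
    (h : 0 < expand k t p i ∧ expand k t p i < 1) : 0 < p i ∧ p i < 1 := by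
  by_cases hi : (i : ℕ) < k
  · rw [expand_of_lt _ _ hi] at h
    have ht := t.2.1
    constructor <;> nlinarith
  · rwa [expand_of_not_lt _ _ hi] at h

namespace WhiskerMaps

variable (W : WhiskerMaps X x₀)

theorem one_le_u {a : Whisker X x₀} (h : W.r a ≠ x₀) : 1 ≤ W.u a := by
  by_contra! h'
  exact h (W.r_eq a h')

theorem exists_family_iff (hk : k ≤ n) (a : LabelPre (NCube n) X)
    (y : (Fin n → ℝ) × Whisker X x₀) :
    (0 < wt n W.u k y ∧ ∃ i, (coords (a.2.1.1 i), W.push (1, a.2.2 i)) = y) ↔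
      0 < wt n W.u k y ∧ ∃ m ∉ faces n k, coords m = y.1 ∧ W.push (1, labelAt x₀ a m) = y.2 := by
  refine and_congr_right fun hy => ⟨?_, ?_⟩
  · rintro ⟨i, rfl⟩
    exact ⟨a.2.1.1 i, notMem_faces_iff.2 ((wt_pos_iff _ _ hk).1 hy).2, rfl, by rw [labelAt_apply]⟩
  · rintro ⟨m, -, hm, hl⟩
    by_cases h : ∃ i, a.2.1.1 i = m
    · obtain ⟨i, rfl⟩ := h
      exact ⟨i, Prod.ext hm (by rwa [labelAt_apply] at hl)⟩
    · push Not at h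
      rw [labelAt_eq_famLabel, famLabel_of_notMem h] at hl
      have := ((wt_pos_iff _ _ hk).1 hy).1
      rw [← hl, W.push_one_base] at this
      exact (lt_irrefl _ this).elim

theorem exists_toCfg (hk : k ≤ n) :
    ∃ F : C(RelConfig (NCube n) (faces n k) X x₀, Cfg (wt n W.u k) (cube n (Whisker X x₀))),
      ∀ a y, y ∈ F (RelConfig.mk _ x₀ a) ↔
        0 < wt n W.u k y ∧ ∃ i, (coords (a.2.1.1 i), W.push (1, a.2.2 i)) = y := by
  have hinj : ∀ (K : ℕ) (q : OrdConfig (NCube n) K × (Fin K → X)) (i j : Fin K),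
      coords (q.1.1 i) = coords (q.1.1 j) → i = j := fun K q i j h =>
    q.1.2 (coords_injective h)
  let f : LabelPre (NCube n) X → Cfg (wt n W.u k) (cube n (Whisker X x₀)) := fun a =>
    Cfg.ofFamily _ _ (fun i => (coords (a.2.1.1 i), W.push (1, a.2.2 i)))
      (fun i j h => by rw [hinj _ _ i j h]) fun i _ => coords_mem (a.2.1.1 i)
  have hf : Continuous f := LabelPre.continuous_of_forall fun K =>
    Cfg.continuous_ofFamily (D := cube n (Whisker X x₀)) (continuous_wt W.u.continuous k)
      (fun (q : OrdConfig (NCube n) K × (Fin K → X)) i =>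
        ((coords (q.1.1 i), W.push (1, q.2 i)) : (Fin n → ℝ) × Whisker X x₀))
      (fun i => (continuous_coords.comp ((continuous_apply i).comp
        (continuous_subtype_val.comp continuous_fst))).prodMk
        (W.push.continuous.comp (continuous_const.prodMk
          ((continuous_apply i).comp continuous_snd))))
      (hinj K) fun q i _ => coords_mem (q.1.1 i)
  obtain ⟨F, hF⟩ := RelConfig.exists_desc (x₀ := x₀) (N := faces n k) hf fun a b hab => by
    refine Cfg.ext fun y => (W.exists_family_iff hk a y).trans
      (Iff.trans ?_ (W.exists_family_iff hk b y).symm)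
    exact and_congr_right fun _ => exists_congr fun m => and_congr_right fun hm => by
      rw [hab m hm]
  exact ⟨F, fun a y => by rw [hF]; exact Iff.rfl⟩

/-- The relative labelled configuration of a configuration of weighted particles. -/
def fromCfg (s : Cfg (wt n W.u k) (cube n (Whisker X x₀))) :
    RelConfig (NCube n) (faces n k) X x₀ :=
  relOf k x₀ (famLabel x₀ (fun y : s.carrier => expand k 1 y.1.1) fun y => W.r y.1.2)

theorem injective_expand (s : Cfg (wt n W.u k) (cube n (Whisker X x₀))) (t : I) :
    Function.Injective fun y : s.carrier => expand k t y.1.1 := fun y z h =>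
  Subtype.ext (s.inj _ y.2 _ z.2 (expand_injective k t h))

theorem continuous_fromCfg (hk : k ≤ n) : Continuous (W.fromCfg (n := n) (k := k)) := by
  refine continuous_iff_continuousAt.2 fun s => ?_
  have : Finite s.carrier := s.finite.to_subtype
  let G : Set (s.carrier → (Fin n → ℝ) × Whisker X x₀) :=
    {z | (∀ i, z i ∈ cube n (Whisker X x₀)) ∧ Function.Injective fun i => (z i).1}
  have hT : Filter.Tendsto (fun z : s.carrier → (Fin n → ℝ) × Whisker X x₀ =>
      relOf k x₀ (famLabel x₀ (fun i => expand k 1 (z i).1) fun i => W.r (z i).2))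
      (𝓝[G] fun y => y.1) (𝓝 (W.fromCfg s)) := by
    refine tendsto_relOf (W.injective_expand s 1) (fun i j hj => ?_) ?_ ?_ (fun i => ?_) fun i => ?_
    · rw [expand_of_not_lt _ _ hj]
      exact s.mem_dom _ i.2 j
    · filter_upwards [self_mem_nhdsWithin] with z hz
      exact (expand_injective k 1).comp hz.2
    · filter_upwards [self_mem_nhdsWithin] with z hz i j hj
      rw [expand_of_not_lt _ _ hj]
      exact hz.1 i j
    · have : Continuous fun z : s.carrier → (Fin n → ℝ) × Whisker X x₀ =>
          expand k 1 (z i).1 := (continuous_expand k).comp (by fun_prop :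
            Continuous fun z : s.carrier → (Fin n → ℝ) × Whisker X x₀ => ((1 : I), (z i).1))
      exact (this.tendsto _).mono_left nhdsWithin_le_nhds
    · have : Continuous fun z : s.carrier → (Fin n → ℝ) × Whisker X x₀ => W.r (z i).2 := by
        fun_prop
      exact (this.tendsto _).mono_left nhdsWithin_le_nhds
  intro U hU
  have hU' := eventually_nhdsWithin_iff.1 (hT.eventually hU)
  rw [nhds_pi, Filter.eventually_iff, Filter.mem_pi] at hU'
  obtain ⟨J, -, T, hTn, hTU⟩ := hU'
  have hw : Continuous (wt n W.u k) := continuous_wt W.u.continuous k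
  let N : (Fin n → ℝ) × Whisker X x₀ → Set ((Fin n → ℝ) × Whisker X x₀) := fun y =>
    {z | ∀ h : y ∈ s.carrier, z ∈ T ⟨y, h⟩}
  have hN : ∀ y ∈ s, N y ∈ 𝓝 y := fun y hy =>
    Filter.mem_of_superset (hTn ⟨y, hy⟩) fun z hz _ => hz
  have hnear := Cfg.near_mem_nhds hw hN (by norm_num : (0 : ℝ) < 1 / 4)
  change ∀ᶠ t in 𝓝 s, W.fromCfg t ∈ U
  filter_upwards [hnear] with t ht
  obtain ⟨φ, h1, h2, h3⟩ := ht
  have hz := hTU (a := fun i => φ i.1) (fun i _ => (h1 i.1 i.2).2 i.2)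
    ⟨fun i => t.mem_dom _ (h1 i.1 i.2).1, fun i j hij => Subtype.ext (h2 i.2 j.2
      (t.inj _ (h1 i.1 i.2).1 _ (h1 j.1 j.2).1 hij))⟩
  have hi : Function.Injective fun i : s.carrier => expand k 1 (φ i.1).1 := fun i j hij =>
    Subtype.ext (h2 i.2 j.2 (t.inj _ (h1 i.1 i.2).1 _ (h1 j.1 j.2).1 (expand_injective k 1 hij)))
  suffices he : W.fromCfg t = relOf k x₀ (famLabel x₀ (fun i : s.carrier => expand k 1 (φ i.1).1)
      fun i => W.r (φ i.1).2) by
    rw [he]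
    exact hz
  refine relOf_congr fun m hm => famLabel_congr (W.injective_expand t 1) hi ?_ ?_
  · rintro ⟨y, hy⟩ hym hyx
    by_cases hyφ : y ∈ φ '' s.carrier
    · obtain ⟨x, hx, rfl⟩ := hyφ
      exact ⟨⟨x, hx⟩, hym, rfl⟩
    · refine absurd (h3 y hy hyφ) (not_lt.2 ((le_wt _ _ _ hk).2 ⟨?_, fun i hik => ?_⟩))
      · linarith [W.one_le_u hyx]
      · have := notMem_faces_iff.1 hm i hik
        rw [← hym, expand_of_lt _ _ hik, Set.Icc.coe_one] at this
        constructor <;> linarith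
  · rintro ⟨x, hx⟩ hxm _
    exact ⟨⟨φ x, (h1 x hx).1⟩, hxm, rfl⟩

theorem fromCfg_empty : W.fromCfg (∅ : Cfg (wt n W.u k) (cube n (Whisker X x₀))) =
    RelConfig.mk _ x₀ (LabelPre.empty _ X) := by
  refine relOf_eq fun m _ => ?_
  rw [famLabel_of_notMem fun y => (Cfg.notMem_empty _ y.2).elim, labelAt_eq_famLabel,
    famLabel_of_notMem fun i => i.elim0]

theorem mem_fromCfg (hk : k ≤ n)
    {F : C(RelConfig (NCube n) (faces n k) X x₀, Cfg (wt n W.u k) (cube n (Whisker X x₀)))}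
    (hF : ∀ a y, y ∈ F (RelConfig.mk _ x₀ a) ↔
        0 < wt n W.u k y ∧ ∃ i, (coords (a.2.1.1 i), W.push (1, a.2.2 i)) = y)
    (s : Cfg (wt n W.u k) (cube n (Whisker X x₀))) (y : (Fin n → ℝ) × Whisker X x₀) :
    y ∈ F (W.fromCfg s) ↔
      0 < wt n W.u k y ∧ ∃ x ∈ s, (expand k 1 x.1, W.pull (1, x.2)) = y := by
  have : Finite s.carrier := s.finite.to_subtype
  have hcube : ∀ x ∈ s, ∀ j : Fin n, ¬ (j : ℕ) < k → expand k 1 x.1 j ∈ Icc (0 : ℝ) 1 :=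
    fun x hx j hj => by
      rw [expand_of_not_lt _ _ hj]
      exact s.mem_dom _ hx j
  obtain ⟨a, ha⟩ := exists_labelAt_eq (x₀ := x₀) (l := fun y : s.carrier => W.r y.1.2)
    (W.injective_expand s 1) fun i => hcube i.1 i.2
  rw [fromCfg, relOf_eq ha, hF, W.exists_family_iff hk]
  refine and_congr_right fun hy => ⟨?_, ?_⟩
  · rintro ⟨m, hm, hmy, hl⟩
    rw [ha m hm] at hl
    by_cases h : ∃ x : s.carrier, expand k 1 x.1.1 = coords m
    · obtain ⟨x, hx⟩ := h
      refine ⟨x.1, x.2, Prod.ext (hx.trans hmy) ?_⟩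
      rw [← hl, ← hx, famLabel_apply (W.injective_expand s 1), W.pull_one]
    · push Not at h
      rw [famLabel_of_notMem h] at hl
      have := ((wt_pos_iff _ _ hk).1 hy).1
      rw [← hl, W.push_one_base] at this
      exact (lt_irrefl _ this).elim
  · rintro ⟨x, hx, rfl⟩
    have hpos := ((wt_pos_iff _ _ hk).1 hy).2
    have hc : coords (clamp (expand k 1 x.1)) = expand k 1 x.1 := coords_clamp fun i => by
      by_cases hi : (i : ℕ) < k
      · exact ⟨(hpos i hi).1.le, (hpos i hi).2.le⟩
      · exact hcube x hx i hi
    have hm : clamp (expand k 1 x.1) ∉ faces n k := notMem_faces_iff.2 (by rwa [hc])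
    refine ⟨_, hm, hc, ?_⟩
    rw [ha _ hm, hc, W.pull_one]
    exact congrArg (fun l => W.push (1, l)) (famLabel_apply (W.injective_expand s 1) ⟨x, hx⟩)

theorem exists_homotopy_toCfg (hk : k ≤ n) :
    ∃ S : C(I × Cfg (wt n W.u k) (cube n (Whisker X x₀)),
      Cfg (wt n W.u k) (cube n (Whisker X x₀))), ∀ t s y, y ∈ S (t, s) ↔
        0 < wt n W.u k y ∧ ∃ x ∈ s, (expand k t x.1, W.pull (t, x.2)) = y := by
  have hw : Continuous (wt n W.u k) := continuous_wt W.u.continuous k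
  have hθ : Continuous fun q : I × ((Fin n → ℝ) × Whisker X x₀) =>
      (expand k q.1 q.2.1, W.pull (q.1, q.2.2)) :=
    ((continuous_expand k).comp (by fun_prop : Continuous
      fun q : I × ((Fin n → ℝ) × Whisker X x₀) => (q.1, q.2.1))).prodMk (by fun_prop)
  have := Cfg.continuous_map (D := cube n (Whisker X x₀)) (D' := cube n (Whisker X x₀)) hw hw
    (fun (t : I) y => (expand k t y.1, W.pull (t, y.2))) hθ
    (fun t y x h => expand_injective k t h) (fun t y hy h h' i => by
      by_cases hi : (i : ℕ) < k
      · have := ((wt_pos_iff _ _ hk).1 h').2 i hi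
        exact ⟨this.1.le, this.2.le⟩
      · simpa only [expand_of_not_lt _ _ hi] using hy i)
    fun t y _ => wt_expand_le hk t y (W.u_pull t y.2)
  exact ⟨⟨_, this.comp continuous_swap⟩, fun _ _ _ => Iff.rfl⟩

theorem exists_homotopy_fromCfg (k : ℕ) :
    ∃ H : C(I × RelConfig (NCube n) (faces n k) X x₀, RelConfig (NCube n) (faces n k) X x₀),
      ∀ t a, H (t, RelConfig.mk _ x₀ a) = relOf k x₀ (famLabel x₀
        (fun i => expand k t (coords (a.2.1.1 i))) fun i => W.r (W.push (t, a.2.2 i))) := by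
  have hinj : ∀ (t : I) (a : LabelPre (NCube n) X),
      Function.Injective fun i => expand k t (coords (a.2.1.1 i)) := fun t a =>
    (expand_injective k t).comp (coords_injective.comp a.2.1.2)
  refine RelConfig.exists_desc_homotopy (f := fun p : I × LabelPre (NCube n) X =>
    relOf k x₀ (famLabel x₀ (fun i => expand k p.1 (coords (p.2.2.1.1 i)))
      fun i => W.r (W.push (p.1, p.2.2.2 i)))) (fun K => ?_) ?_
  · refine continuous_iff_continuousAt.2 fun p => ?_
    refine tendsto_relOf (P := fun (p : I × (OrdConfig (NCube n) K × (Fin K → X))) i =>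
      expand k p.1 (coords (p.2.1.1 i))) (Λ := fun p i => W.r (W.push (p.1, p.2.2 i)))
      (hinj p.1 ⟨K, p.2⟩) (fun i j hj => ?_)
        (Filter.Eventually.of_forall fun p => hinj p.1 ⟨K, p.2⟩)
      (Filter.Eventually.of_forall fun p i j hj => ?_) (fun i => ?_) fun i => ?_
    · rw [expand_of_not_lt _ _ hj]
      exact coords_mem _ j
    · rw [expand_of_not_lt _ _ hj]
      exact coords_mem _ j
    · have : Continuous fun p : I × (OrdConfig (NCube n) K × (Fin K → X)) =>
          expand k p.1 (coords (p.2.1.1 i)) :=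
        (continuous_expand k).comp (continuous_fst.prodMk (continuous_coords.comp
          ((continuous_apply i).comp (continuous_subtype_val.comp
            (continuous_fst.comp continuous_snd)))))
      exact this.tendsto p
    · have : Continuous fun p : I × (OrdConfig (NCube n) K × (Fin K → X)) =>
          W.r (W.push (p.1, p.2.2 i)) := by fun_prop
      exact this.tendsto p
  · intro t a b hab
    have key : ∀ a b : LabelPre (NCube n) X,
        (∀ m ∉ faces n k, labelAt x₀ a m = labelAt x₀ b m) → ∀ m ∉ faces n k, ∀ i,
        expand k t (coords (a.2.1.1 i)) = coords m → W.r (W.push (t, a.2.2 i)) ≠ x₀ →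
        ∃ j, expand k t (coords (b.2.1.1 j)) = coords m ∧
          W.r (W.push (t, b.2.2 j)) = W.r (W.push (t, a.2.2 i)) := by
      intro a b hab m hm i him hi
      have hf : a.2.1.1 i ∉ faces n k := notMem_faces_iff.2 fun j hj => by
        have := notMem_faces_iff.1 hm j hj
        rw [← him] at this
        exact expand_pos_lt this
      have hl := hab _ hf
      rw [labelAt_apply] at hl
      by_cases h : ∃ j, b.2.1.1 j = a.2.1.1 i
      · obtain ⟨j, hj⟩ := h
        rw [← hj, labelAt_apply] at hl
        exact ⟨j, by rw [hj, him], by rw [hl]⟩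
      · push Not at h
        rw [labelAt_eq_famLabel, famLabel_of_notMem h] at hl
        rw [hl, W.push_base] at hi
        exact (hi rfl).elim
    exact relOf_congr fun m hm => famLabel_congr (hinj t a) (hinj t b) (key a b hab m hm)
      (key b a (fun m hm => (hab m hm).symm) m hm)

/-- Relative labelled configurations are weakly equivalent to configurations of weighted
particles. -/
theorem exists_hasW (hk : k ≤ n) :
    ∃ (F : C(RelConfig (NCube n) (faces n k) X x₀, Cfg (wt n W.u k) (cube n (Whisker X x₀))))
      (G : C(Cfg (wt n W.u k) (cube n (Whisker X x₀)), RelConfig (NCube n) (faces n k) X x₀)),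
      HasW F ∧ HasW G ∧ G ∅ = RelConfig.mk _ x₀ (LabelPre.empty _ X) := by
  obtain ⟨F, hF⟩ := W.exists_toCfg hk
  let G : C(Cfg (wt n W.u k) (cube n (Whisker X x₀)), RelConfig (NCube n) (faces n k) X x₀) :=
    ⟨_, W.continuous_fromCfg hk⟩
  have hGF : (G.comp F).Homotopic (ContinuousMap.id _) := by
    obtain ⟨H, hH⟩ := W.exists_homotopy_fromCfg (n := n) k
    refine ContinuousMap.Homotopic.symm ⟨⟨H, RelConfig.ind fun a => ?_, RelConfig.ind fun a => ?_⟩⟩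
    · change H (0, _) = RelConfig.mk _ x₀ a
      rw [hH]
      refine relOf_eq fun m _ => (labelAt_eq_famLabel a m).trans (famLabel_congr a.2.1.2 ?_
        (fun i hi _ => ⟨i, ?_, W.push_zero _⟩) fun i hi _ => ⟨i, ?_, (W.push_zero _).symm⟩)
      · exact (expand_injective k 0).comp (coords_injective.comp a.2.1.2)
      · rw [expand_zero, hi]
      · rw [expand_zero] at hi
        exact coords_injective hi
    · change H (1, _) = W.fromCfg (F _)
      rw [hH]
      refine relOf_congr fun m hm => famLabel_congr ?_ (W.injective_expand _ 1) ?_ ?_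
      · exact (expand_injective k 1).comp (coords_injective.comp a.2.1.2)
      · intro i him hi
        refine ⟨⟨(coords (a.2.1.1 i), W.push (1, a.2.2 i)), (hF a _).2 ⟨?_, i, rfl⟩⟩, him, rfl⟩
        refine (wt_pos_iff _ _ hk).2 ⟨zero_lt_one.trans_le (W.one_le_u hi), fun j hj => ?_⟩
        have := notMem_faces_iff.1 hm j hj
        rw [← him] at this
        exact expand_pos_lt this
      · rintro ⟨y, hy⟩ hym _
        obtain ⟨-, i, rfl⟩ := (hF a _).1 hy
        exact ⟨i, hym, rfl⟩
  have hFG : (F.comp G).Homotopic (ContinuousMap.id _) := by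
    obtain ⟨S, hS⟩ := W.exists_homotopy_toCfg hk
    refine ContinuousMap.Homotopic.symm ⟨⟨S, fun s => Cfg.ext fun y => ?_,
      fun s => Cfg.ext fun y => ?_⟩⟩
    · refine (hS 0 s y).trans ?_
      simp only [expand_zero, W.pull_zero, exists_eq_right]
      exact ⟨fun h => h.2, fun h => ⟨s.pos y h, h⟩⟩
    · exact (hS 1 s y).trans (W.mem_fromCfg hk hF s y).symm
  exact ⟨F, G, HasW.of_homotopy_inverse hGF hFG, HasW.of_homotopy_inverse hFG hGF,
    W.fromCfg_empty⟩

end WhiskerMaps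

end Comparison

theorem faces_zero (n : ℕ) : faces n 0 = ∅ :=
  eq_empty_of_forall_notMem fun _ ⟨_, h, _⟩ => absurd h (Nat.not_lt_zero _)

theorem faces_self (n : ℕ) : faces n n = NCube.boundary n :=
  ext fun _ => exists_congr fun i => and_iff_right i.2

/-- For `n ≥ 1` and a well-pointed path-connected space `(X,x₀)`, there is a
weak homotopy equivalence from `C⁰(Iⁿ;X)` to `Ωⁿ C⁰(Iⁿ,∂Iⁿ;X)`: the relative labelled
configuration space `C⁰(Iⁿ,∂Iⁿ;X)` is an `n`-fold delooping of `C⁰(Iⁿ;X)`. -/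
theorem labeledConfig_cube_weakEquiv_loop_relConfig (n : ℕ) (hn : 1 ≤ n)
    (X : Type*) [TopologicalSpace X] (x₀ : X) (hwp : IsWellPointed X x₀)
    [PathConnectedSpace X] :
    ∃ f : C(LabeledConfig (NCube n) X x₀,
        NLoop n (RelConfig (NCube n) (NCube.boundary n) X x₀)
          (RelConfig.base (NCube n) (NCube.boundary n) X x₀)),
      IsWeakHomotopyEquiv f := by
  obtain ⟨W⟩ := hwp.nonempty_whiskerMaps
  have : Nonempty (LabeledConfig (NCube n) X x₀) := ⟨LabeledConfig.empty _ X x₀⟩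
  obtain ⟨F, -, hF, -⟩ := W.exists_hasW (n := n) (Nat.zero_le n)
  obtain ⟨S, hS⟩ := W.exists_hasW_nLoop n
  have key : ∀ N, N = faces n n →
      ∃ G : C(Cfg (wt n W.u n) (cube n (Whisker X x₀)), RelConfig (NCube n) N X x₀),
        HasW G ∧ G ∅ = RelConfig.base _ N X x₀ := by
    rintro _ rfl
    obtain ⟨-, G, -, hG, h⟩ := W.exists_hasW (le_refl n)
    exact ⟨G, hG, h⟩
  obtain ⟨G, hG, h⟩ := key _ (faces_self n).symm
  exact ⟨_, ((hG.nLoop n h).comp (hS.comp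
    (hF.comp (LabeledConfig.hasW_toRel (faces_zero n))))).isWeakHomotopyEquiv⟩

end
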